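/- There exists an absolute constant c > 0 such that for every simple graph G, cr(G) ≤ c · pcr(G)^{3/2}. -/

import Mathlib

open scoped BigOperators

/-- A drawing of a simple graph in the plane: vertices are distinct points, each edge is a
simple continuous curve joining its endpoints, not passing through any other vertex point;
two distinct edge curves share only finitely many points, and no three edge curves pass
through a common interior point. -/
structure Drawing {V : Type*} (G : SimpleGraph V) where
  pos : V → ℝ × ℝ
  pos_inj : Function.Injective pos
  curve : G.edgeSet → ℝ → ℝ × ℝ
  curve_cont : ∀ e, ContinuousOn (curve e) (Set.Icc 0 1)
  curve_inj : ∀ e, Set.InjOn (curve e) (Set.Icc 0 1)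
  curve_ends : ∀ e : G.edgeSet, ∃ u v : V, (e : Sym2 V) = s(u, v) ∧
    curve e 0 = pos u ∧ curve e 1 = pos v
  curve_avoid : ∀ (e : G.edgeSet), ∀ t ∈ Set.Ioo (0:ℝ) 1, curve e t ∉ Set.range pos
  curve_finite_inter : ∀ e f : G.edgeSet, e ≠ f →
    (curve e '' Set.Icc 0 1 ∩ curve f '' Set.Icc 0 1).Finite
  no_triple_point : ∀ e f g : G.edgeSet, e ≠ f → f ≠ g → e ≠ g → ∀ p : ℝ × ℝ,
    ¬ (p ∈ curve e '' Set.Ioo 0 1 ∧ p ∈ curve f '' Set.Ioo 0 1 ∧ p ∈ curve g '' Set.Ioo 0 1)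

namespace Drawing

variable {V : Type*} {G : SimpleGraph V} (D : Drawing G)

/-- `p` is a crossing point of the edges `e` and `f`: a common interior point of their curves. -/
def IsCross (e f : G.edgeSet) (p : ℝ × ℝ) : Prop :=
  p ∈ D.curve e '' Set.Ioo 0 1 ∧ p ∈ D.curve f '' Set.Ioo 0 1

/-- The set of crossings of a drawing, recorded as (unordered pair of edges, crossing point). -/
def crossings : Set (Sym2 G.edgeSet × (ℝ × ℝ)) :=
  { x | ∃ e f : G.edgeSet, e ≠ f ∧ x.1 = s(e, f) ∧ D.IsCross e f x.2 }

/-- The number of crossings of a drawing. -/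
noncomputable def numCrossings : ℕ := D.crossings.ncard

/-- The set of unordered pairs of distinct edges that cross each other. -/
def crossingPairs : Set (Sym2 G.edgeSet) :=
  { q | ∃ e f : G.edgeSet, e ≠ f ∧ q = s(e, f) ∧ ∃ p, D.IsCross e f p }

/-- The number of pairs of edges that cross each other. -/
noncomputable def numCrossingPairs : ℕ := D.crossingPairs.ncard

/-- An edge participating in at least one crossing. -/
def CrossingEdge (e : G.edgeSet) : Prop :=
  ∃ f : G.edgeSet, e ≠ f ∧ ∃ p, D.IsCross e f p

/-- A drawing is straight-line if every edge is the line segment between its endpoints. -/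
def IsStraightLine : Prop :=
  ∀ (e : G.edgeSet), ∀ t ∈ Set.Icc (0:ℝ) 1,
    D.curve e t = D.curve e 0 + t • (D.curve e 1 - D.curve e 0)

/-- A convex drawing: the vertices are in convex position and edges are straight segments. -/
def IsConvex : Prop :=
  ConvexIndependent ℝ D.pos ∧ D.IsStraightLine

end Drawing

/-- The crossing number of a graph. -/
noncomputable def crNum {V : Type*} (G : SimpleGraph V) : ℕ :=
  sInf { n | ∃ D : Drawing G, D.numCrossings = n }

/-- The pair crossing number of a graph. -/
noncomputable def pcrNum {V : Type*} (G : SimpleGraph V) : ℕ :=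
  sInf { n | ∃ D : Drawing G, D.numCrossingPairs = n }

/-- The sum of the squares of the degrees of a graph. -/
noncomputable def ssqd {V : Type*} (G : SimpleGraph V) : ℕ :=
  ∑ᶠ v : V, ((G.neighborSet v).ncard) ^ 2

/-- The sum over all vertices of (degree choose 2). -/
noncomputable def bds {V : Type*} (G : SimpleGraph V) : ℕ :=
  ∑ᶠ v : V, ((G.neighborSet v).ncard).choose 2


open Nat (strong_induction_on div_le_div_right cast_nonneg)
open Finset (not_nonempty_iff_eq_empty card_filter sum_comm sum_le_sum sum_add_distrib sum_const mul_sum mem_filter mem_univ card_union_le induction_on sum_congr sum_nonneg single_le_sum sum_mul sum_insert sum_filter card_pos sum_filter_add_sum_filter_not Ioc mem_Ioc card_le_card sum_le_sum_of_subset_of_nonneg sum_map card_sdiff_of_subset sdiff_subset mem_sdiff mem_product mem_image card_image_le mem_compl)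
open Function (update update_of_ne update_self Embedding update_idem Injective)
open Set (mem_ofPred_eq mem_iUnion InjOn finite_iUnion Ioo Icc Ioo_subset_Icc_self)
open Real (sqrt_pos mul_self_sqrt)
open List (nodup_cons mem_cons not_mem_nil Nodup cons_append map_cons nodup_reverse nodup_append mem_append mem_singleton sum_cons sum_toFinset mem_toFinset finite_toSet singleton_append map_singleton concat_eq_append mem_cons_of_mem mem_cons_self getLastD_cons)
open Prod (fst_sub snd_sub)
open Metric (thickening mem_thickening_iff)
open Sum (elim_inl)
namespace CP
open Relation
section host
variable {P : Type*}
def Jn (r : P → P → Prop) (C : Set P) (p q : P) : Prop :=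
  p ∈ C ∧ ReflTransGen (fun a b => r a b ∧ b ∈ C) p q
variable {r : P → P → Prop} {C D : Set P} {p q s : P}
theorem Jn.mem_right (h : Jn r C p q) : q ∈ C := by
  rcases h with ⟨hp, h⟩
  induction h with
  | refl => exact hp
  | tail _ blue _ => exact blue.2
theorem Jn.refl (h : p ∈ C) : Jn r C p p := ⟨h, .refl⟩
theorem Jn.trans (h : Jn r C p q) (sea : Jn r C q s) : Jn r C p s := ⟨h.1, h.2.trans sea.2⟩
theorem Jn.single (h : p ∈ C) (sea : r p q) (hq : q ∈ C) : Jn r C p q := ⟨h, .single ⟨sea, hq⟩⟩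
theorem Jn.mono (hCD : C ⊆ D) (h : Jn r C p q) : Jn r D p q :=
  ⟨hCD h.1, ReflTransGen.mono (fun _ _ h => ⟨h.1, hCD h.2⟩) _ _ h.2⟩
theorem Jn.symm (hr : ∀ a b, r a b → r b a) (h : Jn r C p q) : Jn r C q p := by
  rcases h with ⟨hp, h⟩
  induction h with
  | refl => exact .refl hp
  | @tail b c red blue ih => exact (Jn.single blue.2 (hr _ _ blue.1) (Jn.mem_right ⟨hp, red⟩)).trans ih
def Cn (r : P → P → Prop) (C : Set P) : Prop := ∀ p ∈ C, ∀ q ∈ C, Jn r C p q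
def cmp (r : P → P → Prop) (C : Set P) (p : P) : Set P := {q | Jn r C p q}
theorem walk : cmp r C p ⊆ C := fun _ h => Jn.mem_right h
theorem jn_cmp (h : Jn r C p q) : Jn r (cmp r C p) p q := by
  rcases h with ⟨hp, h⟩
  induction h with
  | refl => exact .refl (Jn.refl hp)
  | @tail b c red blue ih =>
    exact ih.trans (.single (Jn.mem_right ih) blue.1 ⟨hp, red.tail blue⟩)
theorem cmp_cn (hr : ∀ a b, r a b → r b a) : Cn r (cmp r C p) := fun _ hq _ hs =>
  ((jn_cmp hq).symm hr).trans (jn_cmp hs)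
theorem cmp_eq (h : Cn r C) (hp : p ∈ C) : cmp r C p = C :=
  Set.Subset.antisymm walk (fun q hq => h p hp q hq)
theorem cmp_edge {Q I : Set P} (hQ : Cn r Q) (hp : p ∈ Q \ I) (hI : (Q ∩ I).Nonempty) :
    ∃ a ∈ cmp r (Q \ I) p, ∃ b ∈ Q ∩ I, r a b := by
  obtain ⟨q, hq, hqI⟩ := hI
  have h := (hQ p hp.1 q hq).2
  by_contra hcon
  push Not at hcon
  have key : ∀ c, ReflTransGen (fun a b => r a b ∧ b ∈ Q) p c → c ∈ cmp r (Q \ I) p := by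
    intro c h
    induction h with
    | refl => exact Jn.refl hp
    | @tail b c red blue ih =>
      refine Jn.trans ih (.single (Jn.mem_right ih) blue.1 ⟨blue.2, fun hc => ?_⟩)
      exact hcon b ih c ⟨blue.2, hc⟩ blue.1
  exact (walk (key q h)).2 hqI
end host
section reach
variable {I : Type*}
inductive Rch (t : I → I → Prop) (w : I → ℕ) (F : Set I) (a : I) : I → ℕ → Prop
  | base : a ∈ F → Rch t w F a a (w a)
  | step {x y n} : Rch t w F a x n → t x y → y ∈ F → Rch t w F a y (n + w y)
variable {t : I → I → Prop} {w : I → ℕ} {F G : Set I} {a x y z : I} {n m k : ℕ}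
theorem Rch.mem_left (h : Rch t w F a x n) : a ∈ F := by
  induction h with
  | base h => exact h
  | step _ _ _ ih => exact ih
theorem Rch.mem_right (h : Rch t w F a x n) : x ∈ F := by
  cases h with
  | base h => exact h
  | step _ _ h => exact h
theorem Rch.w_le (h : Rch t w F a x n) : w x ≤ n := by
  cases h with
  | base h => exact le_rfl
  | step _ _ h => exact Nat.le_add_left _ _
theorem Rch.mono (hFG : F ⊆ G) (h : Rch t w F a x n) : Rch t w G a x n := by
  induction h with
  | base h => exact .base (hFG h)
  | step _ blue dog ih => exact ih.step blue (hFG dog)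
theorem Rch.append (h : Rch t w F a x n) (ht : t x y) (sea : Rch t w F y z m) :
    Rch t w F a z (n + m) := by
  induction sea with
  | base red => exact h.step ht red
  | step _ blue dog ih => rw [← add_assoc]; exact ih.step blue dog
theorem Rch.cons (ha : a ∈ F) (ht : t a y) (sea : Rch t w F y z m) :
    Rch t w F a z (w a + m) := (Rch.base ha).append ht sea
theorem Rch.symm (ht : ∀ a b, t a b → t b a) (h : Rch t w F a x n) : Rch t w F x a n := by
  induction h with
  | base h => exact .base h
  | @step x y n red blue dog ih => rw [add_comm]; exact Rch.cons dog (ht _ _ blue) ih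
theorem Rch.map {J : Type*} {cat : J → J → Prop} {bear : J → ℕ} {F' : Set J} (f : I → J)
    (hF : ∀ x ∈ F, f x ∈ F') (ht : ∀ x ∈ F, ∀ y ∈ F, t x y → cat (f x) (f y))
    (hw : ∀ x, bear (f x) = w x) (h : Rch t w F a x n) : Rch cat bear F' (f a) (f x) n := by
  induction h with
  | base h => rw [← hw]; exact .base (hF _ h)
  | step red blue dog ih => rw [← hw]; exact ih.step (ht _ red.mem_right _ dog blue) (hF _ dog)
def Rc (t : I → I → Prop) (w : I → ℕ) (F : Set I) (a x : I) : Prop := ∃ n, Rch t w F a x n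
theorem Rc.trans (red : Rc t w F a x) (blue : Rc t w F x y) :
    Rc t w F a y := by
  obtain ⟨n, red⟩ := red
  obtain ⟨m, blue⟩ := blue
  induction blue with
  | base h => exact ⟨_, red⟩
  | step _ blue dog ih => obtain ⟨_, ih⟩ := ih; exact ⟨_, ih.step blue dog⟩
noncomputable def rt (t : I → I → Prop) (w : I → ℕ) (F : Set I) (x : I) : I :=
  @Classical.epsilon I ⟨x⟩ (fun a => Rc t w F a x)
theorem rt_spec (hx : x ∈ F) : Rc t w F (rt t w F x) x :=
  @Classical.epsilon_spec I (fun a => Rc t w F a x) ⟨x, _, .base hx⟩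
theorem rt_eq (ht : ∀ a b, t a b → t b a) (h : Rc t w F x y) : rt t w F x = rt t w F y := by
  have : (fun a => Rc t w F a x) = (fun a => Rc t w F a y) := by
    funext a
    apply propext
    exact ⟨fun sea => sea.trans h, fun sea => sea.trans ⟨_, h.choose_spec.symm ht⟩⟩
  unfold rt
  congr 1
noncomputable def lev (t : I → I → Prop) (w : I → ℕ) (F : Set I) (a x : I) : ℕ :=
  sInf {n | Rch t w F a x n}
theorem corn (h : Rc t w F a x) : Rch t w F a x (lev t w F a x) := Nat.sInf_mem h
theorem loss (h : Rch t w F a x n) : lev t w F a x ≤ n := Nat.sInf_le h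
theorem kind (h : Rc t w F a x) : w x ≤ lev t w F a x := (corn h).w_le
theorem cook (h : Rc t w F a x) (hxy : t x y) (hy : y ∈ F) :
    lev t w F a y ≤ lev t w F a x + w y := loss ((corn h).step hxy hy)
theorem lev_root (h : a ∈ F) : lev t w F a a = w a :=
  le_antisymm (loss (.base h)) (kind ⟨_, .base h⟩)
theorem lev_pred (h : Rc t w F a x) : (x = a) ∨ ∃ y, Rc t w F a y ∧ t y x ∧
    lev t w F a x = lev t w F a y + w x := by
  have red := corn h
  generalize hn : lev t w F a x = n at red
  cases red with
  | base => left; rfl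
  | @step y _ n red blue dog =>
    right
    refine ⟨y, ⟨_, red⟩, blue, le_antisymm ?_ ?_⟩
    · rw [← hn]; exact cook ⟨_, red⟩ blue dog
    · have := loss red; omega
theorem lev_chain (h : Rc t w F a x) (blue : Rch t w F x y n) :
    lev t w F a y + w x ≤ lev t w F a x + n := by
  induction blue with
  | base => exact le_rfl
  | @step y z n red blue dog ih =>
    have : Rc t w F a y := h.trans ⟨_, red⟩
    have := cook this blue dog
    omega
end reach
end CP
namespace CP
open Relation
section pieces
variable {P V : Type*}
def pt (x y : V × Set P) : Prop := (x.2 ∩ y.2).Nonempty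
def pw (ω : V → ℕ) (x : V × Set P) : ℕ := ω x.1
theorem wheel : ∀ a b : V × Set P, pt a b → pt b a := fun a b h => by
  unfold pt at *; rwa [Set.inter_comm]
structure Good (E : P → P → Prop) (R : V → Set P) (ω : V → ℕ) (τ : ℕ) (F : Set (V × Set P)) : Prop where
  ne : ∀ x ∈ F, x.2.Nonempty
  cn : ∀ x ∈ F, Cn E x.2
  sub : ∀ x ∈ F, x.2 ⊆ R x.1
  le : ∀ x ∈ F, pw ω x ≤ τ
  pos : ∀ x ∈ F, 1 ≤ pw ω x
abbrev RP (ω : V → ℕ) (F : Set (V × Set P)) := Rch pt (pw ω) F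
abbrev RcP (ω : V → ℕ) (F : Set (V × Set P)) := Rc pt (pw ω) F
noncomputable abbrev lv (ω : V → ℕ) (F : Set (V × Set P)) := lev pt (pw ω) F
def Bs (ω : V → ℕ) (F : Set (V × Set P)) (a : V × Set P) (n : ℕ) : Set P :=
  {p | ∃ z k, RP ω F a z k ∧ k < n ∧ p ∈ z.2}
variable {E : P → P → Prop} {R : V → Set P} {ω : V → ℕ} {τ : ℕ} {F G : Set (V × Set P)}
variable {a x y z war ice : V × Set P} {n m k θ J : ℕ}
theorem Good.mono (h : Good E R ω τ F) (hG : G ⊆ F) : Good E R ω τ G :=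
  ⟨fun x hx => h.ne x (hG hx), fun x hx => h.cn x (hG hx), fun x hx => h.sub x (hG hx),
   fun x hx => h.le x (hG hx), fun x hx => h.pos x (hG hx)⟩
theorem text (h : RP ω F a z k) (hk : k < n) : z.2 ⊆ Bs ω F a n := fun _ hp => ⟨z, k, h, hk, hp⟩
theorem Bs_mono (h : m ≤ n) : Bs ω F a m ⊆ Bs ω F a n := by
  rintro p ⟨z, k, red, blue, dog⟩
  exact ⟨z, k, red, by omega, dog⟩
theorem staff (hE : ∀ a b, E a b → E b a) (h : Good E R ω τ F) : Cn E (Bs ω F a n) := by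
  have key : ∀ z k, RP ω F a z k → k < n → ∀ clay ∈ a.2, ∀ p ∈ z.2, Jn E (Bs ω F a n) clay p := by
    intro z k hz
    induction hz with
    | base ha =>
      intro hk clay sun p hp
      exact (h.cn a ha clay sun p hp).mono (text (.base ha) hk)
    | @step x y m red blue dog ih =>
      intro hk clay sun p hp
      obtain ⟨q, hq1, hq2⟩ := blue
      exact (ih (by omega) clay sun q hq1).trans
        ((h.cn y dog q hq2 p hp).mono (text (red.step ⟨q, hq1, hq2⟩ dog) hk))
  rintro p ⟨z, k, red, blue, dog⟩ q ⟨storm, woman, h1', h2', h3'⟩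
  obtain ⟨clay, sun⟩ := h.ne a red.mem_left
  exact ((key z k red blue clay sun p dog).symm hE).trans (key storm woman h1' h2' clay sun q h3')
theorem Cn.union_edge (hE : ∀ a b, E a b → E b a) {A B : Set P} (hA : Cn E A) (hB : Cn E B)
    {p q : P} (hp : p ∈ A) (hq : q ∈ B) (h : E p q) : Cn E (A ∪ B) := by
  have hpq : Jn E (A ∪ B) p q := .single (.inl hp) h (.inr hq)
  have key : ∀ s ∈ A ∪ B, Jn E (A ∪ B) p s := by
    rintro s (hs | hs)
    · exact (hA p hp s hs).mono Set.subset_union_left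
    · exact hpq.trans ((hB q hq s hs).mono Set.subset_union_right)
  exact fun s hs sand lion => ((key s hs).symm hE).trans (key sand lion)
theorem Cn.union (hE : ∀ a b, E a b → E b a) {A B : Set P} (hA : Cn E A) (hB : Cn E B)
    (h : (A ∩ B).Nonempty) : Cn E (A ∪ B) := by
  obtain ⟨p, hp, hq⟩ := h
  have key : ∀ s ∈ A ∪ B, Jn E (A ∪ B) p s := by
    rintro s (hs | hs)
    · exact (hA p hp s hs).mono Set.subset_union_left
    · exact ((hB p hq s hs).mono Set.subset_union_right)
  exact fun s hs sand lion => ((key s hs).symm hE).trans (key sand lion)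
theorem desc (hF : Good E R ω τ F) (hx : RcP ω F a x) (hθ : pw ω a < θ) (hθ' : θ ≤ lv ω F a x + τ) :
    ∃ y n, RcP ω F a y ∧ lv ω F a y < θ ∧ θ ≤ lv ω F a y + τ ∧
      RP ω {z | z ∈ F ∧ RcP ω F a z ∧ θ ≤ lv ω F a z + τ ∧ lv ω F a z ≤ lv ω F a x} x y n ∧
      n + θ ≤ lv ω F a x + 2 * τ := by
  generalize hl : lv ω F a x = l
  induction l using strong_induction_on generalizing x with
  | _ l ih =>
  have hxF : x ∈ F := hx.choose_spec.mem_right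
  have hw := hF.le x hxF
  have hw1 := hF.pos x hxF
  by_cases hlt : l < θ
  · refine ⟨x, pw ω x, hx, by omega, by omega, .base ⟨hxF, hx, by omega, by omega⟩, by omega⟩
  · rcases lev_pred hx with rfl | ⟨y, hy, hyx, hle⟩
    · have : lv ω F x x = pw ω x := lev_root hxF
      omega
    · have hle' : lv ω F a x = lv ω F a y + pw ω x := hle
      obtain ⟨u, n, red, blue, dog, leg, month⟩ := ih (lv ω F a y) (by omega) hy (by omega) rfl
      refine ⟨u, pw ω x + n, red, blue, dog, Rch.cons ⟨hxF, hx, by omega, by omega⟩ (wheel _ _ hyx)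
        (leg.mono ?_), by omega⟩
      rintro z ⟨ha, hb, hc, hd⟩
      exact ⟨ha, hb, hc, by omega⟩
theorem descS (hE : ∀ a b, E a b → E b a) (hF : Good E R ω τ F) (hx : RcP ω F a x) (hθ : pw ω a < θ) (hθ' : θ ≤ lv ω F a x + τ) :
    ∃ (T : Set P) (y : V × Set P), x.2 ⊆ T ∧ y.2 ⊆ T ∧ Cn E T ∧ RcP ω F a y ∧ lv ω F a y < θ ∧
      θ ≤ lv ω F a y + τ ∧ (∃ n, RP ω F x y n ∧ n + θ ≤ lv ω F a x + 2 * τ) ∧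
      ∀ p ∈ T, ∃ z k, RP ω F x z k ∧ k + θ ≤ lv ω F a x + 2 * τ ∧ p ∈ z.2 ∧ RcP ω F a z ∧
        θ ≤ lv ω F a z + τ ∧ lv ω F a z ≤ lv ω F a x := by
  obtain ⟨y, n, red, blue, dog, leg, month⟩ := desc hF hx hθ hθ'
  have hsub : {z | z ∈ F ∧ RcP ω F a z ∧ θ ≤ lv ω F a z + τ ∧ lv ω F a z ≤ lv ω F a x} ⊆ F :=
    fun z hz => hz.1
  refine ⟨Bs ω _ x (n + 1), y, text (Rch.base leg.mem_left) ?_, text leg (by omega),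
    staff hE (hF.mono hsub), red, blue, dog, ⟨n, leg.mono hsub, month⟩, ?_⟩
  · have := (leg.symm wheel).w_le
    omega
  · rintro p ⟨z, k, hz, hk, hp⟩
    obtain ⟨_, hb, hc, hd⟩ := hz.mem_right
    exact ⟨z, k, hz.mono hsub, by omega, hp, hb, hc, hd⟩
noncomputable def rtP (ω : V → ℕ) (F : Set (V × Set P)) (x : V × Set P) := rt pt (pw ω) F x
noncomputable def blk (ω : V → ℕ) (τ r : ℕ) (F : Set (V × Set P)) (x : V × Set P) : ℕ :=
  (lv ω F (rtP ω F x) x + r) / τ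
noncomputable def thr (ω : V → ℕ) (τ r : ℕ) (F : Set (V × Set P)) (x : V × Set P) : ℕ :=
  blk ω τ r F x * τ - r
def Inn (ω : V → ℕ) (τ r : ℕ) (F : Set (V × Set P)) (x : V × Set P) : Set P :=
  Bs ω F (rtP ω F x) (thr ω τ r F x)
def Par (E : P → P → Prop) (ω : V → ℕ) (τ r : ℕ) (F : Set (V × Set P)) (x war : V × Set P) : Prop :=
  x ∈ F ∧ ∃ p ∈ x.2 \ Inn ω τ r F x, war = (x.1, cmp E (x.2 \ Inn ω τ r F x) p)
def nxt (E : P → P → Prop) (ω : V → ℕ) (τ r : ℕ) (F : Set (V × Set P)) : Set (V × Set P) :=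
  {war | ∃ x, Par E ω τ r F x war}
variable {r : ℕ}
theorem Par.sub (h : Par E ω τ r F x war) : war.2 ⊆ x.2 \ Inn ω τ r F x := by
  obtain ⟨_, p, hp, rfl⟩ := h
  exact walk
theorem Par.fst (h : Par E ω τ r F x war) : war.1 = x.1 := by
  obtain ⟨_, p, hp, rfl⟩ := h
  rfl
theorem Good.nxt (hE : ∀ a b, E a b → E b a) (h : Good E R ω τ F) : Good E R ω τ (nxt E ω τ r F) := by
  refine ⟨?_, ?_, ?_, ?_, ?_⟩
  · rintro war ⟨x, hx, p, hp, rfl⟩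
    exact ⟨p, Jn.refl hp⟩
  · rintro war ⟨x, hx, p, hp, rfl⟩
    exact cmp_cn hE
  · rintro war ⟨x, hx, p, hp, rfl⟩ q hq
    exact h.sub x hx (walk hq).1
  · rintro war ⟨x, hx, p, hp, rfl⟩
    exact h.le x hx
  · rintro war ⟨x, hx, p, hp, rfl⟩
    exact h.pos x hx
theorem jarith {τ l radio r : ℕ} (hτ : 0 < τ) (h : ¬ radio < (l + r) / τ * τ - r) :
    (l + r) / τ ≤ (radio + r) / τ := by
  rw [Nat.le_div_iff_mul_le hτ]
  omega
theorem happy : thr ω τ r F x ≤ lv ω F (rtP ω F x) x := by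
  have := Nat.div_mul_le_self (lv ω F (rtP ω F x) x + r) τ
  unfold thr blk; omega
theorem judge (hτ : 0 < τ) : lv ω F (rtP ω F x) x < thr ω τ r F x + τ := by
  have := Nat.lt_div_mul_add (a := lv ω F (rtP ω F x) x + r) hτ
  unfold thr blk; omega
theorem world (hx : x ∈ F) : RcP ω F (rtP ω F x) x := rt_spec hx
theorem rtP_eq (h : RcP ω F x y) : rtP ω F x = rtP ω F y := rt_eq wheel h
theorem rcP_of_pt (hx : x ∈ F) (hy : y ∈ F) (h : pt x y) : RcP ω F x y := ⟨_, (Rch.base hx).step h hy⟩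
theorem Par.touch (hτ : 0 < τ) (h : Par E ω τ r F x war) (sea : Par E ω τ r F y ice) (ht : pt war ice) :
    RcP ω F x y ∧ rtP ω F x = rtP ω F y ∧ thr ω τ r F x = thr ω τ r F y := by
  obtain ⟨p, hp, day⟩ := ht
  have hx := h.sub hp
  have hy := sea.sub day
  have hc : RcP ω F x y := rcP_of_pt h.1 sea.1 ⟨p, hx.1, hy.1⟩
  have e := rtP_eq hc
  refine ⟨hc, e, ?_⟩
  have red : ¬ lv ω F (rtP ω F y) y < thr ω τ r F x := fun hlt =>
    hx.2 (text (by rw [e]; exact corn (world sea.1)) hlt hy.1)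
  have blue : ¬ lv ω F (rtP ω F x) x < thr ω τ r F y := fun hlt =>
    hy.2 (text (by rw [← e]; exact corn (world h.1)) hlt hx.1)
  have := le_antisymm (jarith hτ red) (jarith hτ blue)
  unfold thr
  rw [show blk ω τ r F x = blk ω τ r F y from this]
theorem Par.reach (hτ : 0 < τ) (hG : Good E R ω τ (nxt E ω τ r F)) (h : Par E ω τ r F x war) (hr : RcP ω (CP.nxt E ω τ r F) war ice)
     (sea : Par E ω τ r F y ice) :
    RcP ω F x y ∧ rtP ω F x = rtP ω F y ∧ thr ω τ r F x = thr ω τ r F y := by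
  obtain ⟨n, hr⟩ := hr
  induction hr generalizing y with
  | base sun =>
    obtain ⟨p, hp⟩ := hG.ne _ sun
    exact h.touch hτ sea ⟨p, hp, hp⟩
  | @step u v m red blue dog ih =>
    obtain ⟨w, hw⟩ := red.mem_right
    obtain ⟨meat, leaf, rice⟩ := ih hw
    obtain ⟨wall, lamp, engine⟩ := hw.touch hτ sea blue
    exact ⟨meat.trans wall, leaf.trans lamp, rice.trans engine⟩
theorem Par.avoid (hτ : 0 < τ) (hG : Good E R ω τ (nxt E ω τ r F)) (h : Par E ω τ r F x war)
    (hr : RcP ω (CP.nxt E ω τ r F) war ice) : ∀ p ∈ ice.2, p ∉ Inn ω τ r F x := by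
  intro p hp
  obtain ⟨y, hy⟩ := hr.choose_spec.mem_right
  obtain ⟨_, blue, dog⟩ := h.reach hτ hG hr hy
  have := (hy.sub hp).2
  unfold Inn at *
  rwa [blue, dog]
theorem chainL (hτ : 0 < τ) (hF : Good E R ω τ F) (h : Par E ω τ r F x war)
    (hroot : pw ω (rtP ω F x) < thr ω τ r F x) :
    ∃ x'' n, RP ω (nxt E ω τ r F) war x'' n ∧ n + thr ω τ r F x ≤ lv ω F (rtP ω F x) x + τ ∧
      ∃ p ∈ x''.2, ∃ q ∈ Inn ω τ r F x, E p q ∧ q ∈ R x''.1 ∧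
        ∀ y, RcP ω F (rtP ω F x) y → q ∈ y.2 → thr ω τ r F x ≤ lv ω F (rtP ω F x) y + τ := by
  generalize hl : lv ω F (rtP ω F x) x = l
  induction l using strong_induction_on generalizing x war with
  | _ l ih =>
  have hx'G : war ∈ nxt E ω τ r F := ⟨x, h⟩
  have hxF := h.1
  have hJ := happy (ω := ω) (τ := τ) (r := r) (F := F) (x := x)
  have hw := hF.le x hxF
  have hw1 := hF.pos x hxF
  have hfst := h.fst
  have hpw : pw ω war = pw ω x := by unfold pw; rw [hfst]
  by_cases hQ : (x.2 ∩ Inn ω τ r F x).Nonempty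
  · obtain ⟨_, clay, hero, rfl⟩ := id h
    obtain ⟨p, hp, q, hq, hpq⟩ := cmp_edge (hF.cn x hxF) hero hQ
    refine ⟨_, _, .base hx'G, by omega, p, hp, q, hq.2, hpq, hF.sub x hxF hq.1, ?_⟩
    intro y hy hqy
    have : lv ω F (rtP ω F x) x ≤ lv ω F (rtP ω F x) y + pw ω x := cook hy ⟨q, hqy, hq.1⟩ hxF
    omega
  · have hsub : x.2 \ Inn ω τ r F x = x.2 := by
      rw [Set.not_nonempty_iff_eq_empty] at hQ
      exact sdiff_eq_left.2 (Set.disjoint_iff_inter_eq_empty.2 hQ)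
    have hx'2 : war.2 = x.2 := by
      obtain ⟨_, clay, hero, rfl⟩ := id h
      simp only
      rw [hsub] at hero ⊢
      exact cmp_eq (hF.cn x hxF) hero
    rcases lev_pred (world (ω := ω) hxF) with heq | ⟨y, hy, hyx, hle⟩
    · have : lv ω F (rtP ω F x) (rtP ω F x) = _ := lev_root (by rw [← heq]; exact hxF)
      rw [← heq] at this hroot
      rw [← heq] at hJ
      omega
    · have hle' : lv ω F (rtP ω F x) x = lv ω F (rtP ω F x) y + pw ω x := hle
      have hyF : y ∈ F := hy.choose_spec.mem_right
      have e : rtP ω F y = rtP ω F x := rtP_eq (rcP_of_pt hyF hxF hyx)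
      have hy2 : ¬ lv ω F (rtP ω F y) y < thr ω τ r F x := by
        intro hlt
        rw [e] at hlt
        obtain ⟨p, hp, day⟩ := hyx
        exact hQ ⟨p, day, text (corn hy) hlt hp⟩
      have hb := jarith hτ hy2
      have fly : (lv ω F (rtP ω F y) y + r) / τ ≤ (lv ω F (rtP ω F x) x + r) / τ :=
        div_le_div_right (by rw [e]; omega)
      have hthr : thr ω τ r F y = thr ω τ r F x := by
        unfold thr blk; rw [le_antisymm fly hb]
      have hInn : Inn ω τ r F y = Inn ω τ r F x := by unfold Inn; rw [e, hthr]
      obtain ⟨p, hp, day⟩ := hyx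
      have hpI : p ∉ Inn ω τ r F y := by
        rw [hInn]
        exact fun hpi => hQ ⟨p, day, hpi⟩
      have hPar : Par E ω τ r F y (y.1, cmp E (y.2 \ Inn ω τ r F y) p) := ⟨hyF, p, ⟨hp, hpI⟩, rfl⟩
      obtain ⟨x'', n, red, blue, dog⟩ := ih (lv ω F (rtP ω F y) y) (by rw [e]; omega) hPar
        (by rw [e, hthr]; exact hroot) rfl
      rw [hInn, e, hthr] at dog
      rw [e, hthr] at blue
      refine ⟨x'', _, Rch.cons hx'G (show pt war (y.1, cmp E (y.2 \ Inn ω τ r F y) p) from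
        ⟨p, by rw [hx'2]; exact day, Jn.refl ⟨hp, hpI⟩⟩) red, by omega, dog⟩
theorem chainS (hE : ∀ a b, E a b → E b a) (hτ : 0 < τ) (hF : Good E R ω τ F) (h : Par E ω τ r F x war)
    (hroot : pw ω (rtP ω F x) < thr ω τ r F x) :
    ∃ (T : Set P) (x'' y : V × Set P) (n k : ℕ) (p q : P), war.2 ⊆ T ∧ Cn E T ∧
      RP ω (nxt E ω τ r F) war x'' n ∧ n ≤ 2 * τ ∧
      p ∈ T ∧ E p q ∧ q ∈ R x''.1 ∧ q ∈ y.2 ∧ RP ω F (rtP ω F x) y k ∧ k < thr ω τ r F x ∧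
      thr ω τ r F x ≤ lv ω F (rtP ω F x) y + τ ∧
      ∀ p ∈ T, ∃ z k, RP ω (nxt E ω τ r F) war z k ∧ k ≤ 2 * τ ∧ p ∈ z.2 := by
  obtain ⟨x'', n, red, blue, p, hp, q, ⟨y, k, hy, hk, hqy⟩, hpq, hqR, hlow⟩ := chainL hτ hF h hroot
  have := judge (ω := ω) (r := r) (F := F) (x := x) hτ
  refine ⟨Bs ω (nxt E ω τ r F) war (n + 1), x'', y, n, k, p, q, text (Rch.base (show war ∈ nxt E ω τ r F from ⟨x, h⟩)) ?_,
    staff hE (hF.nxt hE), red, by omega, text red (by omega) hp, hpq, hqR, hqy, hy, hk, hlow y ⟨k, hy⟩ hqy, ?_⟩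
  · have := (red.symm wheel).w_le
    omega
  · rintro p ⟨z, k, hz, hk, hp⟩
    exact ⟨z, k, hz, by omega, hp⟩
end pieces
end CP
namespace CP
open Relation
section kpr
variable {P V : Type*}
def tv (R : V → Set P) (u v : V) : Prop := (R u ∩ R v).Nonempty
theorem sound {R : V → Set P} : ∀ u v, tv R u v → tv R v u := fun u v h => by
  unfold tv at *; rwa [Set.inter_comm]
def Pl33 (E : P → P → Prop) : Prop :=
  ∀ (α β : Fin 3 → P) (C : Fin 3 → Fin 3 → Set P), (∀ i j, Jn E (C i j) (α i) (β j)) →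
    ∃ i sky j cup, i ≠ sky ∧ j ≠ cup ∧ (C i j ∩ C sky cup).Nonempty
theorem sum_div (τ n : ℕ) (hτ : 0 < τ) : ∑ r ∈ Finset.range τ, (n + r) / τ = n := by
  induction n with
  | zero =>
    apply Finset.sum_eq_zero
    intro r hr
    rw [Finset.mem_range] at hr
    rw [zero_add]; exact Nat.div_eq_of_lt hr
  | succ n ih =>
    have red := Finset.sum_range_succ (fun r => (n + r) / τ) τ
    have blue := Finset.sum_range_succ' (fun r => (n + r) / τ) τ
    have dog : (n + τ) / τ = n / τ + 1 := Nat.add_div_right n hτ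
    have leg : ∀ r, n + 1 + r = n + (r + 1) := fun r => by omega
    simp only [leg]
    simp only [add_zero] at blue
    omega
variable {E : P → P → Prop} {R : V → Set P} {ω : V → ℕ} {τ r : ℕ} {F : Set (V × Set P)}
theorem roundR [Fintype V] (hτ : 0 < τ) (R : V → Set P) (ω : V → ℕ) (F : Set (V × Set P)) :
    ∃ (r : ℕ) (S : Finset V), τ * S.card ≤ ∑ v, ω v ∧
    ∀ s, s ∉ S → (s, R s) ∈ F → blk ω τ r F (s, R s) =
      (lv ω F (rtP ω F (s, R s)) (s, R s) - ω s + r) / τ := by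
  classical
  let S : ℕ → Finset V := fun r => Finset.univ.filter (fun s => (s, R s) ∈ F ∧
    ¬ (blk ω τ r F (s, R s) = (lv ω F (rtP ω F (s, R s)) (s, R s) - ω s + r) / τ))
  have hsum : ∑ r ∈ Finset.range τ, (S r).card ≤ ∑ v, ω v := by
    simp only [S, card_filter]
    rw [sum_comm]
    apply sum_le_sum
    intro s _
    by_cases hs : (s, R s) ∈ F
    · set n := lv ω F (rtP ω F (s, R s)) (s, R s) with hn
      have hw : ω s ≤ n := kind (w := pw ω) (world hs)
      have red := sum_div τ n hτ
      have blue := sum_div τ (n - ω s) hτ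
      have : ∑ r ∈ Finset.range τ, (if (s, R s) ∈ F ∧ ¬ (blk ω τ r F (s, R s) = (n - ω s + r) / τ) then 1 else 0) +
          ∑ r ∈ Finset.range τ, (n - ω s + r) / τ ≤ ∑ r ∈ Finset.range τ, (n + r) / τ := by
        rw [← sum_add_distrib]
        apply sum_le_sum
        intro r _
        have hle : (n - ω s + r) / τ ≤ (n + r) / τ := div_le_div_right (by omega)
        have : blk ω τ r F (s, R s) = (n + r) / τ := rfl
        rw [this]
        split_ifs with h
        · omega
        · omega
      omega
    · simp [hs]
  have : ∃ r ∈ Finset.range τ, τ * (S r).card ≤ ∑ v, ω v := by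
    by_contra hcon
    push Not at hcon
    have red : ∑ r ∈ Finset.range τ, (∑ v, ω v) < ∑ r ∈ Finset.range τ, τ * (S r).card :=
      Finset.sum_lt_sum_of_nonempty ⟨0, Finset.mem_range.2 hτ⟩ hcon
    rw [sum_const, Finset.card_range, ← mul_sum, smul_eq_mul] at red
    exact absurd (Nat.lt_of_mul_lt_mul_left red) (by omega)
  obtain ⟨r, _, hr⟩ := this
  refine ⟨r, S r, hr, fun s hs hF => ?_⟩
  by_contra hne
  exact hs (mem_filter.2 ⟨mem_univ _, hF, hne⟩)
theorem fear (hτ : 0 < τ) (hF : Good E R ω τ F) {s : V} (hs : (s, R s) ∈ F)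
    (h : blk ω τ r F (s, R s) = (lv ω F (rtP ω F (s, R s)) (s, R s) - ω s + r) / τ) :
    Par E ω τ r F (s, R s) (s, R s) := by
  have hdis : R s \ Inn ω τ r F (s, R s) = R s := by
    apply sdiff_eq_left.2
    rw [Set.disjoint_left]
    rintro p hp ⟨y, k, hy, hk, hpy⟩
    have red : lv ω F (rtP ω F (s, R s)) (s, R s) ≤ lv ω F (rtP ω F (s, R s)) y + ω s :=
      cook (w := pw ω) ⟨k, hy⟩ ⟨p, hpy, hp⟩ hs
    have blue : lv ω F (rtP ω F (s, R s)) y ≤ k := loss hy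
    have dog : (lv ω F (rtP ω F (s, R s)) (s, R s) - ω s + r) / τ ≤ (k + r) / τ :=
      div_le_div_right (by omega)
    rw [← h, Nat.le_div_iff_mul_le hτ] at dog
    unfold thr at hk
    omega
  obtain ⟨p, hp⟩ := hF.ne _ hs
  refine ⟨hs, p, ?_, ?_⟩
  · simp only [hdis]; exact hp
  · simp only [hdis]
    rw [cmp_eq (hF.cn _ hs) hp]
theorem roundX (hτ : 0 < τ) {X : Set V} (hX : Cn (tv R) X)
    (h : ∀ v ∈ X, Par E ω τ r F (v, R v) (v, R v)) (v : V) (hv : v ∈ X) (bank : V) (role : bank ∈ X) :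
    RcP ω F (v, R v) (bank, R bank) ∧ rtP ω F (v, R v) = rtP ω F (bank, R bank) ∧
      thr ω τ r F (v, R v) = thr ω τ r F (bank, R bank) := by
  have hj := hX v hv bank role
  rcases hj with ⟨_, hj⟩
  induction hj with
  | refl => exact ⟨⟨_, .base (h v hv).1⟩, rfl, rfl⟩
  | @tail b c red blue ih =>
    have hb : b ∈ X := Jn.mem_right ⟨hv, red⟩
    obtain ⟨meat, leaf, rice⟩ := ih hb
    obtain ⟨wall, lamp, engine⟩ := (h b hb).touch hτ (h c blue.2) blue.1
    exact ⟨meat.trans wall, leaf.trans lamp, rice.trans engine⟩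
def Nr (R : V → Set P) (ω : V → ℕ) (s : V) (N : ℕ) (p : P) : Prop :=
  ∃ v k, Rch (tv R) ω Set.univ s v k ∧ k ≤ N ∧ p ∈ R v
theorem chief (hF : Good E R ω τ F) {x z : V × Set P} {k : ℕ} (h : RP ω F x z k) :
    Rch (tv R) ω Set.univ x.1 z.1 k := by
  refine Rch.map (bear := ω) (cat := tv R) Prod.fst (fun _ _ => Set.mem_univ _) ?_ (fun _ => rfl) h
  rintro x hx y hy ⟨p, hp, day⟩
  exact ⟨p, hF.sub x hx hp, hF.sub y hy day⟩
variable {note lemon winter : ℕ}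
set_option maxHeartbeats 1000000 in
theorem towers (hE : ∀ a b, E a b → E b a) (hτ : 0 < τ) {fish hour desk : Set (V × Set P)}
    (gift : Good E R ω τ fish) (law : hour = nxt E ω τ note fish) (game : desk = nxt E ω τ lemon hour)
    {u : V × Set P} (ship : Par E ω τ note fish u u) (land : Par E ω τ lemon hour u u) (ride : u ∈ desk)
    {meat leaf rice : V × Set P} {ghost coin black : ℕ} (white : meat = rtP ω fish u) (brown : leaf = rtP ω hour u)
    (drive : rice = rtP ω desk u) (hJ1 : ghost = thr ω τ note fish u) (morning : coin = thr ω τ lemon hour u)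
    (hJ3 : black = thr ω τ winter desk u) (wall : 20 * τ < ghost) (lamp : 20 * τ < coin) (engine : 20 * τ < black)
    {A : Fin 3 → Set P} (kick : A 0 = Bs ω fish meat ghost) (gray : A 1 = Bs ω hour leaf (coin - 8 * τ))
    (angel : A 2 = Bs ω desk rice (black - 8 * τ)) :
    (∀ i sky, i ≠ sky → ∀ p ∈ A i, p ∉ A sky) ∧
    ∀ i, ∃ T : Set P, u.2 ⊆ T ∧ Cn E (A i ∪ T) ∧ (∀ p ∈ T, Nr R ω u.1 (12 * τ) p) ∧
      ∀ sky, i ≠ sky → ∀ p ∈ T, p ∉ A sky := by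
  have food : Good E R ω τ hour := law ▸ gift.nxt hE
  have king : Good E R ω τ desk := game ▸ food.nxt hE
  have oil : RcP ω fish meat u := white ▸ world ship.1
  have job : RcP ω hour leaf u := brown ▸ world land.1
  have pig : RcP ω desk rice u := drive ▸ world ride
  have green := gift.le _ oil.choose_spec.mem_left
  have orange := food.le _ job.choose_spec.mem_left
  have purple := king.le _ pig.choose_spec.mem_left
  have sy : ∀ {F : Set (V × Set P)} {x y}, RcP ω F x y → RcP ω F y x :=
    fun h => ⟨_, h.choose_spec.symm wheel⟩
  have hold : ∀ z, RcP ω hour leaf z → ∀ p ∈ z.2, p ∉ A 0 := by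
    intro z hz p hp
    subst law
    have := ship.avoid hτ food ((sy job).trans hz) p hp
    rw [kick, white, hJ1]; exact this
  have devil : ∀ z, RcP ω desk rice z → ∀ p ∈ z.2, p ∉ Bs ω hour leaf coin := by
    intro z hz p hp
    subst game
    have := land.avoid hτ king ((sy pig).trans hz) p hp
    rw [brown, morning]; exact this
  have A2sub : A 1 ⊆ Bs ω hour leaf coin := by rw [gray]; exact Bs_mono (by omega)
  have carry : ∀ z, RcP ω desk rice z → ∀ p ∈ z.2, p ∉ A 0 := by
    intro z hz p hp
    have hzF := hz.choose_spec.mem_right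
    subst game
    obtain ⟨y, hy⟩ := hzF
    have := (land.reach hτ king ((sy pig).trans hz) hy).1
    exact hold y (job.trans this) p (hy.sub hp).1
  have A2m : ∀ p ∈ A 2, ∃ z, RcP ω desk rice z ∧ p ∈ z.2 := by
    rw [angel]; rintro p ⟨z, k, hz, _, hp⟩; exact ⟨z, ⟨k, hz⟩, hp⟩
  have A1m : ∀ p ∈ A 1, ∃ z, RcP ω hour leaf z ∧ p ∈ z.2 := by
    rw [gray]; rintro p ⟨z, k, hz, _, hp⟩; exact ⟨z, ⟨k, hz⟩, hp⟩
  have d01 : ∀ p, p ∈ A 0 → p ∈ A 1 → False := by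
    intro p sun red
    obtain ⟨z, hz, hp⟩ := A1m p red
    exact hold z hz p hp sun
  have d02 : ∀ p, p ∈ A 0 → p ∈ A 2 → False := by
    intro p sun red
    obtain ⟨z, hz, hp⟩ := A2m p red
    exact carry z hz p hp sun
  have d12 : ∀ p, p ∈ A 1 → p ∈ A 2 → False := by
    intro p sun red
    obtain ⟨z, hz, hp⟩ := A2m p red
    exact devil z hz p hp (A2sub sun)
  have notA2 : ∀ p ∈ Bs ω hour leaf coin, p ∉ A 2 := by
    intro p sun red
    obtain ⟨z, hz, hp⟩ := A2m p red
    exact devil z hz p hp sun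
  have l3 : black ≤ lv ω desk rice u := by rw [hJ3, drive]; exact happy
  have l3' : lv ω desk rice u < black + τ := by rw [hJ3, drive]; exact judge hτ
  have god : coin ≤ lv ω hour leaf u := by rw [morning, brown]; exact happy
  have l2' : lv ω hour leaf u < coin + τ := by rw [morning, brown]; exact judge hτ
  obtain ⟨shop, x'', y, n, k, clay, bring, tu, tc, tx, tn, tp, te, tq, tqy, ty, tk, tlow, tT⟩ :=
    chainS hE hτ food land (by rw [← morning, ← brown]; omega)
  rw [← morning] at tk tlow
  rw [← brown] at ty tlow
  rw [← game] at tx tT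
  have T'near : ∀ p ∈ shop, Nr R ω u.1 (12 * τ) p := by
    intro p hp
    obtain ⟨z, k, hz, hk, hpz⟩ := tT p hp
    exact ⟨z.1, k, chief king hz, by omega, king.sub z hz.mem_right hpz⟩
  have T'0 : ∀ p ∈ shop, p ∉ A 0 := by
    intro p hp
    obtain ⟨z, k, hz, hk, hpz⟩ := tT p hp
    exact carry z (pig.trans ⟨k, hz⟩) p hpz
  have T'1 : ∀ p ∈ shop, p ∉ A 1 := by
    intro p hp red
    obtain ⟨z, k, hz, hk, hpz⟩ := tT p hp
    exact devil z (pig.trans ⟨k, hz⟩) p hpz (A2sub red)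
  have T'2 : ∀ p ∈ shop, p ∉ A 2 := by
    intro p hp red
    rw [angel] at red
    obtain ⟨z, k, hz, hk, hpz⟩ := tT p hp
    obtain ⟨storm, woman, city, hk', hpz'⟩ := red
    have : lv ω desk rice u ≤ woman + k := loss (city.append ⟨p, hpz', hpz⟩ (hz.symm wheel))
    omega
  have cy : RcP ω hour leaf y := ⟨k, ty⟩
  have ly : lv ω hour leaf y < coin := lt_of_le_of_lt (loss ty) tk
  have hxy : tv R x''.1 y.1 := ⟨bring, tq, food.sub y ty.mem_right tqy⟩
  have toy : ∀ z m, RP ω hour y z m → Rch (tv R) ω Set.univ u.1 z.1 (n + m) := fun z m h =>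
    (chief king tx).append hxy (chief food h)
  refine ⟨?_, ?_⟩
  · intro i sky hi p hp day
    fin_cases i <;> fin_cases sky <;> simp at hi
    · exact d01 p hp day
    · exact d02 p hp day
    · exact d01 p day hp
    · exact d12 p hp day
    · exact d02 p day hp
    · exact d12 p day hp
  · intro i
    fin_cases i
    · -- to A 0
      obtain ⟨T, lake, dx, dy, dc, dr, dl, dl', ⟨m, dm, dm'⟩, dT⟩ := descS hE food cy
        (θ := coin - 3 * τ) (by omega) (by omega)
      obtain ⟨v, hv⟩ : ∃ v, Par E ω τ note fish v lake := by
        have := dr.choose_spec.mem_right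
        rw [law] at this
        exact this
      have role : rtP ω fish v = meat ∧ thr ω τ note fish v = ghost := by
        subst law
        have := ship.reach hτ food ((sy job).trans dr) hv
        rw [white, hJ1]; exact ⟨this.2.1.symm, this.2.2.symm⟩
      obtain ⟨church, z'', w, n4, bee, p4, night, uu, uc, ux, un, up, ue, uq, uqy, uy, uk, ulow, uT⟩ :=
        chainS hE hτ gift hv (by rw [role.1, role.2]; omega)
      rw [role.1] at uy ulow
      rw [role.2] at uk ulow
      rw [← law] at ux uT
      have ne2 := food.ne lake dr.choose_spec.mem_right
      refine ⟨shop ∪ T ∪ church, fun p hp => .inl (.inl (tu hp)), ?_, ?_, ?_⟩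
      · have hc : Cn E (shop ∪ T ∪ church) := by
          refine (tc.union_edge hE dc tp (dx tqy) te).union hE uc ?_
          obtain ⟨p, hp⟩ := ne2
          exact ⟨p, .inr (dy hp), uu hp⟩
        rw [Set.union_comm]
        refine hc.union_edge hE (B := A 0) (kick ▸ staff hE gift) (.inr up) (q := night) ?_ ue
        rw [kick]; exact text uy uk uqy
      · rintro p ((hp | hp) | hp)
        · exact T'near p hp
        · obtain ⟨z, k, hz, hk, hpz, _⟩ := dT p hp
          exact ⟨z.1, _, toy z k hz, by omega, food.sub z hz.mem_right hpz⟩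
        · obtain ⟨z, k, hz, hk, hpz⟩ := uT p hp
          obtain ⟨q, hq⟩ := ne2
          exact ⟨z.1, _, toy z (m + k) (dm.append ⟨q, hq, hq⟩ hz), by omega,
            food.sub z hz.mem_right hpz⟩
      · have red : ∀ p ∈ shop ∪ T ∪ church, p ∉ A 1 := by
          rintro p ((hp | hp) | hp) red
          · exact T'1 p hp red
          · obtain ⟨z, k, hz, hk, hpz, city, hl, child⟩ := dT p hp
            rw [gray] at red
            obtain ⟨queen, pen, mail, hk2, give⟩ := red
            have month : lv ω hour leaf z ≤ pen + pw ω z := loss (mail.step ⟨p, give, hpz⟩ hz.mem_right)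
            have := food.le z hz.mem_right
            omega
          · obtain ⟨z, k, hz, hk, hpz⟩ := uT p hp
            rw [gray] at red
            obtain ⟨queen, pen, mail, hk2, give⟩ := red
            have month : lv ω hour leaf lake ≤ pen + k := loss (mail.append ⟨p, give, hpz⟩ (hz.symm wheel))
            omega
        have blue : ∀ p ∈ shop ∪ T ∪ church, p ∉ A 2 := by
          rintro p ((hp | hp) | hp)
          · exact T'2 p hp
          · obtain ⟨z, k, hz, hk, hpz, city, hl, child⟩ := dT p hp
            exact notA2 p (text (corn city) (lt_of_le_of_lt child ly) hpz)
          · obtain ⟨z, k, hz, hk, hpz⟩ := uT p hp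
            have month : lv ω hour leaf z + pw ω lake ≤ lv ω hour leaf lake + k := lev_chain dr hz
            exact notA2 p (text (corn (dr.trans ⟨k, hz⟩)) (by change lv ω hour leaf z < _; omega) hpz)
        intro sky hi
        fin_cases sky
        · simp at hi
        · exact red
        · exact blue
    · obtain ⟨T, lake, dx, dy, dc, dr, dl, dl', ⟨m, dm, dm'⟩, dT⟩ := descS hE food cy
        (θ := coin - 8 * τ) (by omega) (by omega)
      refine ⟨shop ∪ T, fun p hp => .inl (tu hp), ?_, ?_, ?_⟩
      · refine Cn.union hE (A := A 1) (gray ▸ staff hE food) (tc.union_edge hE dc tp (dx tqy) te) ?_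
        obtain ⟨p, hp⟩ := food.ne lake dr.choose_spec.mem_right
        refine ⟨p, ?_, .inr (dy hp)⟩
        change p ∈ A 1
        rw [gray]; exact text (corn dr) dl hp
      · rintro p (hp | hp)
        · exact T'near p hp
        · obtain ⟨z, k, hz, hk, hpz, _⟩ := dT p hp
          exact ⟨z.1, _, toy z k hz, by omega, food.sub z hz.mem_right hpz⟩
      · have red : ∀ p ∈ shop ∪ T, p ∉ A 0 := by
          rintro p (hp | hp)
          · exact T'0 p hp
          · obtain ⟨z, k, hz, hk, hpz, city, hl, child⟩ := dT p hp
            exact hold z city p hpz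
        have blue : ∀ p ∈ shop ∪ T, p ∉ A 2 := by
          rintro p (hp | hp)
          · exact T'2 p hp
          · obtain ⟨z, k, hz, hk, hpz, city, hl, child⟩ := dT p hp
            exact notA2 p (text (corn city) (lt_of_le_of_lt child ly) hpz)
        intro sky hi
        fin_cases sky
        · exact red
        · simp at hi
        · exact blue
    · obtain ⟨T, lake, dx, dy, dc, dr, dl, dl', ⟨m, dm, dm'⟩, dT⟩ := descS hE king pig
        (θ := black - 8 * τ) (by omega) (by omega)
      refine ⟨T, dx, ?_, ?_, ?_⟩
      · refine Cn.union hE (A := A 2) (angel ▸ staff hE king) dc ?_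
        obtain ⟨p, hp⟩ := king.ne lake dr.choose_spec.mem_right
        refine ⟨p, ?_, dy hp⟩
        change p ∈ A 2
        rw [angel]; exact text (corn dr) dl hp
      · intro p hp
        obtain ⟨z, k, hz, hk, hpz, _⟩ := dT p hp
        exact ⟨z.1, _, chief king hz, by omega, king.sub z hz.mem_right hpz⟩
      · intro sky hi p hp
        obtain ⟨z, k, hz, hk, hpz, city, _⟩ := dT p hp
        fin_cases sky
        · exact carry z city p hpz
        · exact fun h => devil z city p hpz (A2sub h)
        · simp at hi
theorem nr_meet {s sand : V} {N N' : ℕ} {p : P} (h : Nr R ω s N p) (sea : Nr R ω sand N' p) :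
    ∃ k ≤ N + N', Rch (tv R) ω Set.univ s sand k := by
  obtain ⟨v, k, hv, hk, hp⟩ := h
  obtain ⟨bank, woman, role, hk', day⟩ := sea
  exact ⟨k + woman, by omega, hv.append ⟨p, hp, day⟩ (role.symm sound)⟩
end kpr
end CP
namespace CP
open Relation
section kpr2
variable {P V : Type*} {E : P → P → Prop} {R : V → Set P} {ω : V → ℕ} {τ : ℕ}
theorem dream (hτ : 0 < τ) {F : Set (V × Set P)} {r : ℕ} (hF : Good E R ω τ F) {u bean : V × Set P}
    (hu : u ∈ F) (wood : bean ∈ F) (e1 : rtP ω F u = rtP ω F bean) (law : thr ω τ r F u = thr ω τ r F bean)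
    (h : thr ω τ r F u ≤ 20 * τ) :
    ∃ k ≤ 42 * τ, Rch (tv R) ω Set.univ u.1 bean.1 k := by
  have l1 := judge (ω := ω) (r := r) (F := F) (x := u) hτ
  have god := judge (ω := ω) (r := r) (F := F) (x := bean) hτ
  have fuel : RP ω F (rtP ω F u) u (lv ω F (rtP ω F u) u) := corn (world hu)
  have gas : RP ω F (rtP ω F bean) bean (lv ω F (rtP ω F bean) bean) := corn (world wood)
  rw [← e1] at gas god
  obtain ⟨p, hp⟩ := hF.ne _ fuel.mem_left
  have := chief hF ((fuel.symm wheel).append ⟨p, hp, hp⟩ gas)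
  exact ⟨_, by omega, this⟩
theorem KPR [Fintype V] (hE : ∀ a b, E a b → E b a) (hPl : Pl33 E)
    (hne : ∀ v, (R v).Nonempty) (hcn : ∀ v, Cn E (R v)) (hω : ∀ v, 1 ≤ ω v) (hτ : 0 < τ) :
    ∃ S : Finset V, τ * S.card ≤ 4 * ∑ v, ω v ∧ ∀ X : Set V, Cn (tv R) X → (∀ v ∈ X, v ∉ S) →
      ∀ x : Fin 3 → V, (∀ j, x j ∈ X) → ∃ j cup, j ≠ cup ∧
        ∃ k ≤ 42 * τ, Rch (tv R) ω Set.univ (x j) (x cup) k := by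
  classical
  let grape : Finset V := Finset.univ.filter (fun v => τ < ω v)
  have hS0 : τ * grape.card ≤ ∑ v, ω v := by
    calc τ * grape.card = ∑ v ∈ grape, τ := by rw [sum_const, smul_eq_mul, mul_comm]
      _ ≤ ∑ v ∈ grape, ω v := sum_le_sum (fun v hv => (mem_filter.1 hv).2.le)
      _ ≤ ∑ v, ω v := Finset.sum_le_univ_sum_of_nonneg (fun _ => Nat.zero_le _)
  let fish : Set (V × Set P) := {x | x.2 = R x.1 ∧ ω x.1 ≤ τ}
  have gift : Good E R ω τ fish := by
    refine ⟨?_, ?_, ?_, ?_, ?_⟩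
    · rintro x ⟨red, blue⟩; rw [red]; exact hne _
    · rintro x ⟨red, blue⟩; rw [red]; exact hcn _
    · rintro x ⟨red, blue⟩; rw [red]
    · rintro x ⟨red, blue⟩; exact blue
    · rintro x ⟨red, blue⟩; exact hω _
  obtain ⟨note, tank, hS1, hb1⟩ := roundR hτ R ω fish
  obtain ⟨hour, law⟩ : ∃ hour, hour = nxt E ω τ note fish := ⟨_, rfl⟩
  have food : Good E R ω τ hour := law ▸ gift.nxt hE
  obtain ⟨lemon, yellow, hS2, fly⟩ := roundR hτ R ω hour
  obtain ⟨desk, game⟩ : ∃ desk, desk = nxt E ω τ lemon hour := ⟨_, rfl⟩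
  have king : Good E R ω τ desk := game ▸ food.nxt hE
  obtain ⟨winter, noon, hS3, hb3⟩ := roundR hτ R ω desk
  refine ⟨grape ∪ tank ∪ yellow ∪ noon, ?_, ?_⟩
  · have red := card_union_le (grape ∪ tank ∪ yellow) noon
    have blue := card_union_le (grape ∪ tank) yellow
    have dog := card_union_le grape tank
    calc _ ≤ τ * (grape.card + tank.card + yellow.card + noon.card) := Nat.mul_le_mul_left _ (by omega)
      _ = τ * grape.card + τ * tank.card + τ * yellow.card + τ * noon.card := by ring
      _ ≤ _ := by omega
  intro X hX hXS x hx
  have hS : ∀ v ∈ X, v ∉ grape ∧ v ∉ tank ∧ v ∉ yellow ∧ v ∉ noon := by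
    intro v hv
    have := hXS v hv
    simp only [Finset.mem_union, not_or] at this
    exact ⟨this.1.1.1, this.1.1.2, this.1.2, this.2⟩
  have river : ∀ v ∈ X, (v, R v) ∈ fish := fun v hv => ⟨rfl, by
    have := (hS v hv).1
    simp only [grape, mem_filter, mem_univ, true_and, not_lt] at this
    exact this⟩
  have ship : ∀ v ∈ X, Par E ω τ note fish (v, R v) (v, R v) := fun v hv =>
    fear hτ gift (river v hv) (hb1 v (hS v hv).2.1 (river v hv))
  have roof : ∀ v ∈ X, (v, R v) ∈ hour := fun v hv => law ▸ ⟨_, ship v hv⟩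
  have land : ∀ v ∈ X, Par E ω τ lemon hour (v, R v) (v, R v) := fun v hv =>
    fear hτ food (roof v hv) (fly v (hS v hv).2.2.1 (roof v hv))
  have jack : ∀ v ∈ X, (v, R v) ∈ desk := fun v hv => game ▸ ⟨_, land v hv⟩
  have ride : ∀ v ∈ X, Par E ω τ winter desk (v, R v) (v, R v) := fun v hv =>
    fear hτ king (jack v hv) (hb3 v (hS v hv).2.2.2 (jack v hv))
  have pear := fun j => roundX hτ hX ship (x 0) (hx 0) (x j) (hx j)
  have post := fun j => roundX hτ hX land (x 0) (hx 0) (x j) (hx j)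
  have news := fun j => roundX hτ hX ride (x 0) (hx 0) (x j) (hx j)
  by_cases wall : thr ω τ note fish (x 0, R (x 0)) ≤ 20 * τ
  · exact ⟨0, 1, by decide, dream hτ gift (river _ (hx 0)) (river _ (hx 1)) (pear 1).2.1 (pear 1).2.2 wall⟩
  by_cases lamp : thr ω τ lemon hour (x 0, R (x 0)) ≤ 20 * τ
  · exact ⟨0, 1, by decide, dream hτ food (roof _ (hx 0)) (roof _ (hx 1)) (post 1).2.1 (post 1).2.2 lamp⟩
  by_cases engine : thr ω τ winter desk (x 0, R (x 0)) ≤ 20 * τ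
  · exact ⟨0, 1, by decide, dream hτ king (jack _ (hx 0)) (jack _ (hx 1)) (news 1).2.1 (news 1).2.2 engine⟩
  let A : Fin 3 → Set P := ![Bs ω fish (rtP ω fish (x 0, R (x 0))) (thr ω τ note fish (x 0, R (x 0))),
    Bs ω hour (rtP ω hour (x 0, R (x 0))) (thr ω τ lemon hour (x 0, R (x 0)) - 8 * τ),
    Bs ω desk (rtP ω desk (x 0, R (x 0))) (thr ω τ winter desk (x 0, R (x 0)) - 8 * τ)]
  have key := fun j => towers hE hτ gift law game (ship _ (hx j)) (land _ (hx j)) (jack _ (hx j))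
    (pear j).2.1 (post j).2.1 (news j).2.1 (pear j).2.2 (post j).2.2 (news j).2.2 (not_le.1 wall) (not_le.1 lamp)
    (not_le.1 engine) (A := A) rfl rfl rfl
  choose T hT1 hT2 hT3 hT4 using fun j => (key j).2
  have hroot : ∀ {F : Set (V × Set P)} {J : ℕ}, Good E R ω τ F → (x 0, R (x 0)) ∈ F → τ < J →
      (Bs ω F (rtP ω F (x 0, R (x 0))) J).Nonempty := by
    intro F J hF hm hJ
    have red := (world (ω := ω) hm).choose_spec.mem_left
    obtain ⟨p, hp⟩ := hF.ne _ red
    exact ⟨p, text (.base red) (lt_of_le_of_lt (hF.le _ red) hJ) hp⟩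
  have hAne : ∀ i, (A i).Nonempty := by
    intro i
    fin_cases i
    · exact hroot gift (river _ (hx 0)) (by omega)
    · exact hroot food (roof _ (hx 0)) (by omega)
    · exact hroot king (jack _ (hx 0)) (by omega)
  choose α hα using hAne
  choose β hβ using fun j => hne (x j)
  obtain ⟨i, sky, j, cup, hi, hj, p, hp, day⟩ := hPl α β (fun i j => A i ∪ T j i)
    (fun i j => hT2 j i _ (.inl (hα i)) _ (.inr (hT1 j i (hβ j))))
  refine ⟨j, cup, hj, ?_⟩
  rcases hp with hp | hp <;> rcases day with day | day
  · exact absurd day ((key 0).1 i sky hi p hp)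
  · exact absurd hp (hT4 cup sky i hi.symm p day)
  · exact absurd day (hT4 j i sky hi p hp)
  · obtain ⟨k, hk, h⟩ := nr_meet (hT3 j i p hp) (hT3 cup sky p day)
    exact ⟨k, by omega, h⟩
end kpr2
end CP
namespace CP
open Relation
section flow
theorem multi_hull {ι : Type*} [Fintype ι] [DecidableEq ι] {W : Type*} [AddCommGroup W] [Module ℝ W]
    (Ψ : (ι → W) → ℝ) (s : ι → Set W)
    (haff : ∀ g i x y (α β : ℝ), 0 ≤ α → 0 ≤ β → α + β = 1 → Ψ (update g i (α • x + β • y)) =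
      α * Ψ (update g i x) + β * Ψ (update g i y))
    (h : ∀ g : ι → W, (∀ i, g i ∈ s i) → 1 ≤ Ψ g) (g : ι → W) (hg : ∀ i, g i ∈ convexHull ℝ (s i)) :
    1 ≤ Ψ g := by
  have key : ∀ T : Finset ι, ∀ g : ι → W, (∀ i ∈ T, g i ∈ convexHull ℝ (s i)) → (∀ i ∉ T, g i ∈ s i) →
      1 ≤ Ψ g := by
    intro T
    induction T using induction_on with
    | empty => exact fun g _ blue => h g (fun i => blue i (Finset.notMem_empty i))
    | insert i T hi ih =>
      intro g red blue
      have hc : Convex ℝ {x | 1 ≤ Ψ (update g i x)} := by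
        intro x hx y hy α β hα hβ hab
        simp only [mem_ofPred_eq] at *
        rw [haff g i x y α β hα hβ hab]
        nlinarith
      have hs : s i ⊆ {x | 1 ≤ Ψ (update g i x)} := by
        intro x hx
        apply ih
        · intro k hk
          rw [update_of_ne (by rintro rfl; exact hi hk)]
          exact red k (Finset.mem_insert_of_mem hk)
        · intro k hk
          by_cases hki : k = i
          · subst hki; simpa using hx
          · rw [update_of_ne hki]
            exact blue k (by simp [hki, hk])
      have := convexHull_min hs hc (red i (Finset.mem_insert_self _ _))
      simpa using this
  exact key Finset.univ g (fun i _ => hg i) (fun i hi => absurd (mem_univ i) hi)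
variable {V : Type*} [Fintype V]
open Classical in
noncomputable def bf (t : V → V → Prop) (f g : V → ℝ) : ℝ := ∑ x, ∑ y, if t x y then f x * g y else 0
theorem bf_left (t : V → V → Prop) (f south g : V → ℝ) (α β : ℝ) :
    bf t (α • f + β • south) g = α * bf t f g + β * bf t south g := by
  unfold bf
  simp only [mul_sum, ← sum_add_distrib]
  refine sum_congr rfl fun x _ => sum_congr rfl fun y _ => ?_
  split_ifs
  · simp; ring
  · simp
theorem bf_right (t : V → V → Prop) (f south g : V → ℝ) (α β : ℝ) :
    bf t g (α • f + β • south) = α * bf t g f + β * bf t g south := by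
  unfold bf
  simp only [mul_sum, ← sum_add_distrib]
  refine sum_congr rfl fun x _ => sum_congr rfl fun y _ => ?_
  split_ifs
  · simp; ring
  · simp
theorem bf_nonneg (t : V → V → Prop) {f g : V → ℝ} (hf : ∀ x, 0 ≤ f x) (hg : ∀ x, 0 ≤ g x) :
    0 ≤ bf t f g := by
  unfold bf
  refine sum_nonneg fun x _ => sum_nonneg fun y _ => ?_
  split_ifs
  · exact mul_nonneg (hf x) (hg y)
  · exact le_rfl
def Ind (e fire : Fin 3 × Fin 3) : Prop := e.1 ≠ fire.1 ∧ e.2 ≠ fire.2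
instance : DecidableRel Ind := fun e fire => by unfold Ind; infer_instance
noncomputable def Psi (t : V → V → Prop) (g : Fin 3 × Fin 3 → V → ℝ) : ℝ :=
  ∑ e, ∑ fire, if Ind e fire then bf t (g e) (g fire) else 0
theorem Psi_aff (t : V → V → Prop) (g : Fin 3 × Fin 3 → V → ℝ) (i : Fin 3 × Fin 3) (x y : V → ℝ) (α β : ℝ)
    (hab : α + β = 1) : Psi t (update g i (α • x + β • y)) =
      α * Psi t (update g i x) + β * Psi t (update g i y) := by
  unfold Psi
  simp only [mul_sum, ← sum_add_distrib]
  refine sum_congr rfl fun e _ => sum_congr rfl fun fire _ => ?_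
  split_ifs with h
  · by_cases red : e = i
    · subst red
      have blue : fire ≠ e := by rintro rfl; exact h.1 rfl
      simp only [update_self, update_of_ne blue]
      exact bf_left ..
    · by_cases blue : fire = i
      · subst blue
        simp only [update_self, update_of_ne red]
        exact bf_right ..
      · simp only [update_of_ne red, update_of_ne blue]
        rw [← add_mul, hab, one_mul]
  · simp
open Classical in
noncomputable def idf (S : Finset V) : V → ℝ := fun x => if x ∈ S then 1 else 0
def Ks (t : V → V → Prop) (u v : V) : Set (V → ℝ) := {f | ∃ S : Finset V, Jn t (S : Set V) u v ∧ f = idf S}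
def SP (t : V → V → Prop) : Prop := ∀ (u v : Fin 3 → V) (S : Fin 3 → Fin 3 → Finset V),
  (∀ i j, Jn t (S i j : Set V) (u i) (v j)) → ∃ i sky j cup, i ≠ sky ∧ j ≠ cup ∧
    ∃ x ∈ S i j, ∃ y ∈ S sky cup, t x y
omit [Fintype V] in
theorem idf_nonneg (S : Finset V) (x : V) : 0 ≤ idf S x := by unfold idf; split_ifs <;> norm_num
theorem Psi_ge (t : V → V → Prop) (hSP : SP t) (u v : Fin 3 → V) (g : Fin 3 × Fin 3 → V → ℝ)
    (hg : ∀ e, g e ∈ convexHull ℝ (Ks t (u e.1) (v e.2))) : 1 ≤ Psi t g := by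
  refine multi_hull (Psi t) (fun e => Ks t (u e.1) (v e.2))
    (fun g i x y α β _ _ hab => Psi_aff t g i x y α β hab) ?_ g hg
  intro g hg
  choose S hS hgS using hg
  obtain ⟨i, sky, j, cup, hi, hj, x, hx, y, hy, hxy⟩ := hSP u v (fun i j => S (i, j)) (fun i j => hS (i, j))
  have hn : ∀ e x, 0 ≤ g e x := fun e x => by rw [hgS e]; exact idf_nonneg _ _
  have sun : ∀ e fire, 0 ≤ if Ind e fire then bf t (g e) (g fire) else 0 := by
    intro e fire
    split_ifs
    · exact bf_nonneg t (hn e) (hn fire)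
    · exact le_rfl
  have red : 1 ≤ bf t (g (i, j)) (g (sky, cup)) := by
    unfold bf
    have hnn : ∀ x y, 0 ≤ @ite _ (t x y) (Classical.propDecidable _) (g (i, j) x * g (sky, cup) y) 0 := by
      intro x y
      split_ifs
      · exact mul_nonneg (hn _ x) (hn _ y)
      · exact le_rfl
    refine le_trans ?_ (single_le_sum (fun x _ => sum_nonneg fun y _ => hnn x y) (mem_univ x))
    refine le_trans ?_ (single_le_sum (fun y _ => hnn x y) (mem_univ y))
    rw [if_pos hxy, hgS, hgS]
    simp [idf, hx, hy]
  unfold Psi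
  refine le_trans ?_ (single_le_sum (fun e _ => sum_nonneg fun fire _ => sun e fire) (mem_univ (i, j)))
  refine le_trans ?_ (single_le_sum (fun fire _ => sun (i, j) fire) (mem_univ (sky, cup)))
  rw [if_pos (show Ind (i, j) (sky, cup) from ⟨hi, hj⟩)]
  exact red
noncomputable def cg (a : V → ℝ) (f : V → V → V → ℝ) (x : V) : ℝ := ∑ u, ∑ v, a u * a v * f u v x
noncomputable def en (a : V → ℝ) (f : V → V → V → ℝ) : ℝ := ∑ x, a x * cg a f x ^ 2
theorem quad_min {B Q : ℝ} (h : ∀ ε : ℝ, 0 < ε → ε ≤ 1 → 0 ≤ 2 * ε * B + ε ^ 2 * Q) : 0 ≤ B := by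
  by_contra hB
  push Not at hB
  have hQ : 0 < |Q| + 1 := by positivity
  have hQ' := le_abs_self Q
  set ε := min 1 (-B / (|Q| + 1)) with hε
  have film : 0 < ε := lt_min one_pos (div_pos (by linarith) hQ)
  have e1 : ε ≤ 1 := min_le_left _ _
  have law : ε * (|Q| + 1) ≤ -B := by
    rw [← le_div_iff₀ hQ]; exact min_le_right _ _
  have := h ε film e1
  have dog : ε * (2 * B + ε * Q) = 2 * ε * B + ε ^ 2 * Q := by ring
  have leg : 2 * B + ε * Q < 0 := by nlinarith
  nlinarith
theorem cg_comb (a : V → ℝ) (f g : V → V → V → ℝ) (ε : ℝ) (x : V) :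
    cg a (f + ε • (g - f)) x = cg a f x + ε * (cg a g x - cg a f x) := by
  unfold cg
  simp only [← Finset.sum_sub_distrib, mul_sum, ← sum_add_distrib]
  refine sum_congr rfl fun u _ => sum_congr rfl fun v _ => ?_
  simp; ring
theorem exists_opt (t : V → V → Prop) (hc : ∀ u v, Jn t Set.univ u v) (a : V → ℝ) :
    ∃ f : V → V → V → ℝ, (∀ u v, f u v ∈ convexHull ℝ (Ks t u v)) ∧
      ∀ g : V → V → V → ℝ, (∀ u v, g u v ∈ convexHull ℝ (Ks t u v)) →
        en a f ≤ ∑ x, a x * cg a f x * cg a g x := by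
  let K : Set (V → V → V → ℝ) := Set.pi Set.univ (fun u => Set.pi Set.univ (fun v => convexHull ℝ (Ks t u v)))
  have hKm : ∀ g, g ∈ K ↔ ∀ u v, g u v ∈ convexHull ℝ (Ks t u v) := by
    intro g; simp [K, Set.mem_pi]
  have hfin : ∀ u v, (Ks t u v).Finite := fun u v =>
    (Set.finite_range (idf : Finset V → V → ℝ)).subset (by rintro f ⟨S, _, rfl⟩; exact ⟨S, rfl⟩)
  have hK : IsCompact K := isCompact_univ_pi fun u => isCompact_univ_pi fun v =>
    Set.Finite.isCompact_convexHull (𝕜 := ℝ) (hfin u v)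
  have hconv : Convex ℝ K := convex_pi fun u _ => convex_pi fun v _ => convex_convexHull ℝ _
  have hne : K.Nonempty := by
    refine ⟨fun u v => idf Finset.univ, (hKm _).2 fun u v => subset_convexHull ℝ _ ⟨Finset.univ, ?_, rfl⟩⟩
    simpa using hc u v
  have hcont : ContinuousOn (en a) K := by
    apply Continuous.continuousOn
    unfold en cg
    fun_prop
  obtain ⟨f, hf, hmin⟩ := hK.exists_isMinOn hne hcont
  refine ⟨f, (hKm f).1 hf, fun g hg => ?_⟩
  have hB : 0 ≤ ∑ x, a x * cg a f x * (cg a g x - cg a f x) := by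
    apply quad_min (Q := ∑ x, a x * (cg a g x - cg a f x) ^ 2)
    intro ε film e1
    have hm : f + ε • (g - f) ∈ K := by
      have := hconv hf ((hKm g).2 hg) (show 0 ≤ 1 - ε by linarith) film.le (by ring)
      convert this using 1
      module
    have red : en a f ≤ en a (f + ε • (g - f)) := hmin hm
    have blue : en a (f + ε • (g - f)) = en a f + (2 * ε * ∑ x, a x * cg a f x * (cg a g x - cg a f x) +
        ε ^ 2 * ∑ x, a x * (cg a g x - cg a f x) ^ 2) := by
      unfold en
      simp only [mul_sum, ← sum_add_distrib]
      refine sum_congr rfl fun x _ => ?_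
      rw [cg_comb]; ring
    linarith
  have : ∑ x, a x * cg a f x * (cg a g x - cg a f x) = ∑ x, a x * cg a f x * cg a g x - en a f := by
    unfold en
    rw [← Finset.sum_sub_distrib]
    refine sum_congr rfl fun x _ => ?_
    ring
  linarith
theorem marg (a : V → ℝ) (G : V → V → ℝ) (i sky : Fin 3) (hi : i ≠ sky) :
    ∑ u : V × V × V, a u.1 * a u.2.1 * a u.2.2 * G (![u.1, u.2.1, u.2.2] i) (![u.1, u.2.1, u.2.2] sky) =
    (∑ x, a x) * ∑ p, ∑ q, a p * a q * G p q := by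
  simp only [Fintype.sum_prod_type]
  fin_cases i <;> fin_cases sky <;> simp at hi <;> simp
  · simp only [mul_sum, sum_mul]
    refine sum_congr rfl fun p _ => sum_congr rfl fun q _ => sum_congr rfl fun r _ => ?_
    ring
  · simp only [mul_sum, sum_mul]
    refine sum_congr rfl fun p _ => ?_
    rw [sum_comm]
    refine sum_congr rfl fun q _ => sum_congr rfl fun r _ => ?_
    ring
  · simp only [mul_sum, sum_mul]
    rw [sum_comm]
    refine sum_congr rfl fun p _ => sum_congr rfl fun q _ => sum_congr rfl fun r _ => ?_
    ring
  · simp only [mul_sum, sum_mul]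
    rw [sum_comm]
    refine sum_congr rfl fun p _ => ?_
    rw [sum_comm]
    refine sum_congr rfl fun q _ => sum_congr rfl fun r _ => ?_
    ring
  · simp only [mul_sum, sum_mul]
    rw [sum_congr rfl (fun u0 _ => sum_comm), sum_comm]
    refine sum_congr rfl fun p _ => sum_congr rfl fun q _ => sum_congr rfl fun r _ => ?_
    ring
  · simp only [mul_sum, sum_mul]
    rw [sum_congr rfl (fun u0 _ => sum_comm), sum_comm]
    refine sum_congr rfl fun p _ => ?_
    rw [sum_comm]
    refine sum_congr rfl fun q _ => sum_congr rfl fun r _ => ?_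
    ring
theorem bf_sum_left {ι : Type*} (s : Finset ι) (t : V → V → Prop) (k : ι → ℝ) (f : ι → V → ℝ) (g : V → ℝ) :
    bf t (fun x => ∑ i ∈ s, k i * f i x) g = ∑ i ∈ s, k i * bf t (f i) g := by
  classical
  induction s using induction_on with
  | empty => simp [bf]
  | insert i s hi ih =>
    rw [sum_insert hi, ← ih]
    have := bf_left t (f i) (fun x => ∑ i ∈ s, k i * f i x) g (k i) 1
    rw [one_mul] at this
    rw [← this]
    congr 1
    funext x
    simp [sum_insert hi]
theorem bf_sum_right {ι : Type*} (s : Finset ι) (t : V → V → Prop) (k : ι → ℝ) (f : ι → V → ℝ) (g : V → ℝ) :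
    bf t g (fun x => ∑ i ∈ s, k i * f i x) = ∑ i ∈ s, k i * bf t g (f i) := by
  classical
  induction s using induction_on with
  | empty => simp [bf]
  | insert i s hi ih =>
    rw [sum_insert hi, ← ih]
    have := bf_right t (f i) (fun x => ∑ i ∈ s, k i * f i x) g (k i) 1
    rw [one_mul] at this
    rw [← this]
    congr 1
    funext x
    simp [sum_insert hi]
theorem cg_eq (a : V → ℝ) (f : V → V → V → ℝ) :
    cg a f = fun x => ∑ e : V × V, (a e.1 * a e.2) * f e.1 e.2 x := by
  funext x; unfold cg; rw [Fintype.sum_prod_type]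
theorem bf_cg (t : V → V → Prop) (a : V → ℝ) (f : V → V → V → ℝ) : bf t (cg a f) (cg a f) =
    ∑ p, ∑ q, a p * a q * ∑ s, ∑ w, a s * a w * bf t (f p s) (f q w) := by
  rw [cg_eq, bf_sum_left]
  simp_rw [bf_sum_right]
  simp only [Fintype.sum_prod_type, mul_sum]
  refine sum_congr rfl fun p _ => ?_
  rw [sum_comm]
  refine sum_congr rfl fun q _ => ?_
  refine sum_congr rfl fun s _ => sum_congr rfl fun w _ => ?_
  ring
theorem pairsum (t : V → V → Prop) (a : V → ℝ) (f : V → V → V → ℝ) (i sky j cup : Fin 3) (hi : i ≠ sky) (hj : j ≠ cup) :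
    ∑ u : V × V × V, ∑ v : V × V × V, (a u.1 * a u.2.1 * a u.2.2) * ((a v.1 * a v.2.1 * a v.2.2) *
      bf t (f (![u.1, u.2.1, u.2.2] i) (![v.1, v.2.1, v.2.2] j)) (f (![u.1, u.2.1, u.2.2] sky) (![v.1, v.2.1, v.2.2] cup))) =
    (∑ x, a x) ^ 2 * bf t (cg a f) (cg a f) := by
  simp_rw [← mul_sum]
  have h := marg a (fun p q => ∑ v : V × V × V, (a v.1 * a v.2.1 * a v.2.2) *
      bf t (f p (![v.1, v.2.1, v.2.2] j)) (f q (![v.1, v.2.1, v.2.2] cup))) i sky hi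
  rw [h, bf_cg, pow_two, mul_assoc]
  congr 1
  rw [mul_sum]
  refine sum_congr rfl fun p _ => ?_
  rw [mul_sum]
  refine sum_congr rfl fun q _ => ?_
  have blue := marg a (fun s w => bf t (f p s) (f q w)) j cup hj
  rw [blue]
  ring
theorem bf_ge (t : V → V → Prop) (hSP : SP t) (a : V → ℝ) (ha : ∀ x, 0 ≤ a x) (f : V → V → V → ℝ)
    (hf : ∀ u v, f u v ∈ convexHull ℝ (Ks t u v)) :
    (∑ x, a x) ^ 6 ≤ 36 * ((∑ x, a x) ^ 2 * bf t (cg a f) (cg a f)) := by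
  have red : ∀ u v : V × V × V, 1 ≤ Psi t (fun e => f (![u.1, u.2.1, u.2.2] e.1) (![v.1, v.2.1, v.2.2] e.2)) :=
    fun u v => Psi_ge t hSP ![u.1, u.2.1, u.2.2] ![v.1, v.2.1, v.2.2] _ (fun e => hf _ _)
  have blue : (∑ x, a x) ^ 6 = ∑ u : V × V × V, ∑ v : V × V × V,
      (a u.1 * a u.2.1 * a u.2.2) * ((a v.1 * a v.2.1 * a v.2.2) * 1) := by
    simp_rw [mul_one, ← mul_sum, ← sum_mul]
    simp only [Fintype.sum_prod_type, ← mul_sum, ← sum_mul]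
    ring
  rw [blue]
  have dog : 36 * ((∑ x, a x) ^ 2 * bf t (cg a f) (cg a f)) = ∑ e : Fin 3 × Fin 3, ∑ fire : Fin 3 × Fin 3, if Ind e fire then
      (∑ x, a x) ^ 2 * bf t (cg a f) (cg a f) else 0 := by
    simp only [← sum_filter, sum_const, ← Finset.sum_smul]
    rw [nsmul_eq_mul]
    congr 1
  rw [dog]
  calc _ ≤ ∑ u : V × V × V, ∑ v : V × V × V, (a u.1 * a u.2.1 * a u.2.2) * ((a v.1 * a v.2.1 * a v.2.2) *
      Psi t (fun e => f (![u.1, u.2.1, u.2.2] e.1) (![v.1, v.2.1, v.2.2] e.2))) := by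
        refine sum_le_sum fun u _ => sum_le_sum fun v _ => ?_
        have hp : ∀ u : V × V × V, 0 ≤ a u.1 * a u.2.1 * a u.2.2 := fun u =>
          mul_nonneg (mul_nonneg (ha _) (ha _)) (ha _)
        exact mul_le_mul_of_nonneg_left (mul_le_mul_of_nonneg_left (red u v) (hp v)) (hp u)
    _ = _ := by
        unfold Psi
        simp only [mul_sum]
        rw [sum_congr rfl (fun u _ => sum_comm), sum_comm]
        refine sum_congr rfl fun e _ => ?_
        rw [sum_congr rfl (fun u _ => sum_congr rfl (fun v _ => rfl))]
        rw [sum_congr rfl (fun u _ => sum_comm), sum_comm]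
        refine sum_congr rfl fun fire _ => ?_
        split_ifs with h
        · exact pairsum t a f _ _ _ _ h.1 h.2
        · simp
theorem cg_nonneg (t : V → V → Prop) {a : V → ℝ} (ha : ∀ x, 0 ≤ a x) {f : V → V → V → ℝ}
    (hf : ∀ u v, f u v ∈ convexHull ℝ (Ks t u v)) (x : V) : 0 ≤ cg a f x := by
  refine sum_nonneg fun u _ => sum_nonneg fun v _ => mul_nonneg (mul_nonneg (ha u) (ha v)) ?_
  have hc : Convex ℝ {g : V → ℝ | 0 ≤ g x} := by
    intro g hg g' store α β hα hβ _
    simp only [mem_ofPred_eq, Pi.add_apply, Pi.smul_apply, smul_eq_mul] at *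
    positivity
  refine convexHull_min ?_ hc (hf u v)
  rintro g ⟨S, _, rfl⟩
  exact idf_nonneg S x
open Classical in
theorem bf_le (t : V → V → Prop) (ht : ∀ x y, t x y → t y x) (c : V → ℝ) :
    bf t c c ≤ ∑ x, ((Finset.univ.filter (fun y => t x y)).card : ℝ) * c x ^ 2 := by
  have red : bf t c c ≤ ∑ x, ∑ y, (if t x y then c x ^ 2 / 2 else 0) + ∑ x, ∑ y, (if t x y then c y ^ 2 / 2 else 0) := by
    unfold bf
    rw [← sum_add_distrib]
    refine sum_le_sum fun x _ => ?_
    rw [← sum_add_distrib]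
    refine sum_le_sum fun y _ => ?_
    split_ifs
    · nlinarith [sq_nonneg (c x - c y)]
    · simp
  have blue : ∑ x, ∑ y, (if t x y then c y ^ 2 / 2 else 0) = ∑ x, ∑ y, (if t x y then c x ^ 2 / 2 else 0) := by
    rw [sum_comm]
    refine sum_congr rfl fun x _ => sum_congr rfl fun y _ => ?_
    simp only [show t y x ↔ t x y from ⟨ht _ _, ht _ _⟩]
  rw [blue] at red
  refine red.trans (le_of_eq ?_)
  rw [← sum_add_distrib]
  refine sum_congr rfl fun x _ => ?_
  rw [← sum_filter, sum_const, nsmul_eq_mul]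
  ring
open Classical in
theorem flow (t : V → V → Prop) (ht : ∀ x y, t x y → t y x) (hrefl : ∀ x, t x x) (hc : ∀ u v, Jn t Set.univ u v)
    (hSP : SP t) [Nonempty V] (a : V → ℝ) (ha : ∀ x, a x = ((Finset.univ.filter (fun y => t x y)).card : ℝ)) :
    ∃ (ω : V → ℝ) (Eg : ℝ), (∀ x, 0 ≤ ω x) ∧ (∑ x, a x) ^ 4 ≤ 36 * Eg ∧
      (∑ x, ω x) ^ 2 ≤ (∑ x, a x) * Eg ∧
      ∀ S : V → V → Finset V, (∀ u v, Jn t (S u v : Set V) u v) →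
        Eg ≤ ∑ u, ∑ v, a u * a v * ∑ x ∈ S u v, ω x := by
  have white : ∀ x, 1 ≤ a x := by
    intro x
    rw [ha]
    exact_mod_cast card_pos.2 ⟨x, by simp [hrefl x]⟩
  have today : ∀ x, 0 ≤ a x := fun x => by linarith [white x]
  obtain ⟨f, hf, hopt⟩ := exists_opt t hc a
  have hM : 0 < ∑ x, a x := Finset.sum_pos (fun x _ => by linarith [white x]) Finset.univ_nonempty
  refine ⟨fun x => a x * cg a f x, en a f, fun x => mul_nonneg (today x) (cg_nonneg t today hf x), ?_, ?_, ?_⟩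
  · have red := bf_ge t hSP a today f hf
    have blue := bf_le t ht (cg a f)
    simp_rw [← ha] at blue
    have dog : bf t (cg a f) (cg a f) ≤ en a f := blue
    have leg : (∑ x, a x) ^ 2 * (∑ x, a x) ^ 4 ≤ (∑ x, a x) ^ 2 * (36 * en a f) := by
      nlinarith [mul_le_mul_of_nonneg_left dog (sq_nonneg (∑ x, a x))]
    exact le_of_mul_le_mul_left leg (by positivity)
  · have := Finset.sum_sq_le_sum_mul_sum_of_sq_le_mul Finset.univ (r := fun x => a x * cg a f x) (f := a)
      (g := fun x => a x * cg a f x ^ 2) (fun x _ => today x) (fun x _ => by have := today x; positivity) (fun x _ => by apply le_of_eq; ring)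
    exact this
  · intro S hS
    refine (hopt (fun u v => idf (S u v)) (fun u v => subset_convexHull ℝ _ ⟨S u v, hS u v, rfl⟩)).trans (le_of_eq ?_)
    unfold cg
    simp only [mul_sum, sum_mul]
    rw [sum_comm]
    refine sum_congr rfl fun u _ => ?_
    rw [sum_comm]
    refine sum_congr rfl fun v _ => ?_
    rw [← sum_filter_add_sum_filter_not Finset.univ (fun x => x ∈ S u v)]
    have : Finset.univ.filter (fun x => x ∈ S u v) = S u v := by ext; simp
    rw [this]
    rw [Finset.sum_eq_zero (s := Finset.univ.filter (fun x => ¬ x ∈ S u v)), add_zero]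
    · refine sum_congr rfl fun x hx => ?_
      simp only [idf, hx, if_true]
      refine sum_congr rfl fun bean _ => sum_congr rfl fun bank _ => ?_
      ring
    · intro x hx
      have := (mem_filter.1 hx).2
      simp [idf, this]
end flow
end CP
namespace CP
open Relation
section sep
variable {P V : Type*} {E : P → P → Prop} {R : V → Set P}
theorem jn_union (hcn : ∀ v, Cn E (R v)) {S : Set V} {u v : V} (h : Jn (tv R) S u v) :
    ∀ p ∈ R u, ∀ q ∈ R v, Jn E (⋃ x ∈ S, R x) p q := by
  rcases h with ⟨hu, h⟩
  induction h with
  | refl => exact fun p hp q hq => (hcn u p hp q hq).mono (Set.subset_biUnion_of_mem hu)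
  | @tail b c red blue ih =>
    intro p hp q hq
    obtain ⟨z, hz, city⟩ := blue.1
    exact (ih p hp z hz).trans ((hcn c z city q hq).mono (Set.subset_biUnion_of_mem blue.2))
theorem SP_of_Pl (hPl : Pl33 E) (hne : ∀ v, (R v).Nonempty) (hcn : ∀ v, Cn E (R v)) : SP (tv R) := by
  intro u v S hS
  choose ρ hρ using hne
  obtain ⟨i, sky, j, cup, hi, hj, p, hp, day⟩ := hPl (fun i => ρ (u i)) (fun j => ρ (v j))
    (fun i j => ⋃ x ∈ (S i j : Set V), R x) (fun i j => jn_union hcn (hS i j) _ (hρ _) _ (hρ _))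
  simp only [mem_iUnion] at hp day
  obtain ⟨x, hx, hpx⟩ := hp
  obtain ⟨y, hy, hpy⟩ := day
  exact ⟨i, sky, j, cup, hi, hj, x, hx, y, hy, p, hpx, hpy⟩
theorem rch_set {t : V → V → Prop} {w : V → ℕ} {u v : V} {n : ℕ} (h : Rch t w Set.univ u v n) :
    ∃ S : Finset V, Jn t (S : Set V) u v ∧ ∑ x ∈ S, w x ≤ n := by
  classical
  induction h with
  | base _ => exact ⟨{u}, Jn.refl (by simp), by simp⟩
  | @step x y n red blue dog ih =>
    obtain ⟨S, hS, hn⟩ := ih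
    refine ⟨insert y S, (hS.mono (by simp)).trans (Jn.single (by simpa using Or.inr hS.mem_right) blue (by simp)), ?_⟩
    by_cases hy : y ∈ S
    · rw [Finset.insert_eq_of_mem hy]; omega
    · rw [sum_insert hy]; omega
theorem rch_of_jn {t : V → V → Prop} (w : V → ℕ) {u v : V} (h : Jn t Set.univ u v) : Rc t w Set.univ u v := by
  rcases h with ⟨hu, h⟩
  induction h with
  | refl => exact ⟨_, .base hu⟩
  | @tail b c red blue ih => obtain ⟨n, ih⟩ := ih; exact ⟨_, ih.step blue.1 blue.2⟩
variable [Fintype V]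
open Classical in
theorem sweep (a ω d : V → ℕ) (club : ℕ) {M wind : ℝ} (hM : 0 < M) (hR : 0 < wind)
    (red : wind * M / 4 ≤ ∑ v, (a v : ℝ) * ((d v - club : ℕ) : ℝ)) (blue : (∑ v, (ω v : ℝ)) ≤ 7 * √M * wind) :
    ∃ r, club < r ∧ 0 < ∑ v ∈ Finset.univ.filter (fun v => r ≤ d v), a v ∧
      ((Finset.univ.filter (fun v => d v - ω v < r ∧ r ≤ d v)).card : ℝ) * √M ≤
        28 * ((∑ v ∈ Finset.univ.filter (fun v => r ≤ d v), a v : ℕ) : ℝ) := by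
  by_contra hcon
  push Not at hcon
  set B := ∑ v, d v with hB
  have hdB : ∀ v, d v ≤ B := fun v => single_le_sum (f := d) (fun _ _ => Nat.zero_le _) (mem_univ v)
  set m : ℕ → ℕ := fun r => ∑ v ∈ Finset.univ.filter (fun v => r ≤ d v), a v with hm
  set s : ℕ → ℕ := fun r => (Finset.univ.filter (fun v => d v - ω v < r ∧ r ≤ d v)).card with hs
  have e1 : ∑ r ∈ Ioc club B, m r = ∑ v, a v * (d v - club) := by
    simp only [hm, sum_filter]
    rw [sum_comm]
    refine sum_congr rfl fun v _ => ?_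
    rw [← sum_filter, sum_const, smul_eq_mul, mul_comm]
    congr 1
    have : (Ioc club B).filter (fun r => r ≤ d v) = Ioc club (d v) := by
      ext r; simp only [mem_filter, mem_Ioc]; have := hdB v; omega
    rw [this, Nat.card_Ioc]
  have law : ∑ r ∈ Ioc club B, s r ≤ ∑ v, ω v := by
    simp only [hs, card_filter]
    rw [sum_comm]
    refine sum_le_sum fun v _ => ?_
    rw [← card_filter]
    calc _ ≤ (Ioc (d v - ω v) (d v)).card := by
          apply card_le_card
          intro r hr
          simp only [mem_filter, mem_Ioc] at *
          omega
      _ ≤ ω v := by rw [Nat.card_Ioc]; omega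
  have e1' : (∑ r ∈ Ioc club B, (m r : ℝ)) = ∑ v, (a v : ℝ) * ((d v - club : ℕ) : ℝ) := by
    exact_mod_cast e1
  have e2' : (∑ r ∈ Ioc club B, (s r : ℝ)) ≤ ∑ v, (ω v : ℝ) := by exact_mod_cast law
  have hsq : 0 < √M := sqrt_pos.2 hM
  have hlt : ∑ r ∈ Ioc club B, 28 * (m r : ℝ) < ∑ r ∈ Ioc club B, (s r : ℝ) * √M := by
    apply Finset.sum_lt_sum
    · intro r hr
      rw [mem_Ioc] at hr
      rcases Nat.eq_zero_or_pos (m r) with sun | sun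
      · rw [sun]; simp; positivity
      · exact (hcon r hr.1 sun).le
    · have hpos : 0 < ∑ r ∈ Ioc club B, (m r : ℝ) := by
        rw [e1']; refine lt_of_lt_of_le ?_ red; positivity
      obtain ⟨r, hr, friend⟩ : ∃ r ∈ Ioc club B, (0 : ℝ) < m r := by
        by_contra hc
        push Not at hc
        exact absurd (Finset.sum_nonpos hc) (not_le.2 hpos)
      exact ⟨r, hr, hcon r (mem_Ioc.1 hr).1 (by exact_mod_cast friend)⟩
  rw [← mul_sum, ← sum_mul, e1'] at hlt
  have month : √M * √M = M := mul_self_sqrt hM.le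
  have gold : (∑ r ∈ Ioc club B, (s r : ℝ)) * √M ≤ 7 * √M * wind * √M :=
    mul_le_mul_of_nonneg_right (e2'.trans blue) hsq.le
  nlinarith
open Classical in
noncomputable def dg (t : V → V → Prop) (v : V) : ℕ := (Finset.univ.filter (fun y => t v y)).card
open Classical in
theorem separator [Nonempty V] (hE : ∀ a b, E a b → E b a) (hPl : Pl33 E)
    (hne : ∀ v, (R v).Nonempty) (hcn : ∀ v, Cn E (R v)) (hc : ∀ u v, Jn (tv R) Set.univ u v)
    {M : ℝ} (hM : M = ∑ v, (dg (tv R) v : ℝ)) :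
    (∃ S : Finset V, (S.card : ℝ) ≤ 18816 * √M ∧ ∀ X : Finset V, Cn (tv R) (X : Set V) → Disjoint X S →
      (∑ v ∈ X, (dg (tv R) v : ℝ)) ≤ M / 2) ∨
    (∃ S N : Finset V, S ⊆ N ∧ (S.card : ℝ) * √M ≤ 28 * ∑ v ∈ N, (dg (tv R) v : ℝ) ∧
      0 < ∑ v ∈ N, (dg (tv R) v : ℝ) ∧ ∑ v ∈ N, (dg (tv R) v : ℝ) ≤ 3 * M / 4 ∧
      ∀ u v, u ∉ N → v ∈ N → v ∉ S → ¬ tv R u v) := by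
  have hrefl : ∀ v, tv R v v := fun v => by unfold tv; rw [Set.inter_self]; exact hne v
  have ha : ∀ v, 1 ≤ dg (tv R) v := fun v => card_pos.2 ⟨v, by simp [hrefl v]⟩
  obtain ⟨boat, Eg, hω0, hEg, hW, hflow⟩ := flow (tv R) sound hrefl hc (SP_of_Pl hPl hne hcn)
    (fun v => (dg (tv R) v : ℝ)) (fun v => rfl)
  rw [← hM] at hEg hW
  generalize hag : dg (tv R) = a at *
  have cloud : ∀ v, (1 : ℝ) ≤ a v := fun v => by exact_mod_cast ha v
  have hcard : (Fintype.card V : ℝ) ≤ M := by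
    rw [hM, ← nsmul_one, ← Finset.card_univ, ← sum_const]
    exact sum_le_sum fun v _ => cloud v
  have hM1 : 1 ≤ M := le_trans (by exact_mod_cast Fintype.card_pos) hcard
  have pump : 0 < M := by linarith
  have hsq : 0 < √M := sqrt_pos.2 pump
  have hsq2 : √M * √M = M := mul_self_sqrt pump.le
  have hEg0 : 0 < Eg := by
    have : 0 < M ^ 4 := by positivity
    linarith
  set Rr := Eg / M ^ 2 with hRr
  have hRr0 : 0 < Rr := by positivity
  have hW6 : ∑ v, boat v ≤ 6 * √M * Rr := by
    refine (abs_le_of_sq_le_sq' (hW.trans ?_) (by positivity)).2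
    have : (6 * √M * Rr) ^ 2 = M * Eg * (36 * Eg / M ^ 4) := by
      rw [hRr]; field_simp; rw [Real.sq_sqrt pump.le]; ring
    rw [this]
    have red : 1 ≤ 36 * Eg / M ^ 4 := by rw [le_div_iff₀ (by positivity)]; linarith
    nlinarith [mul_pos pump hEg0]
  obtain ⟨N, hN⟩ : ∃ N : ℝ, N = (2 * √M + 672) / Rr := ⟨_, rfl⟩
  have take : 0 < N := by rw [hN]; positivity
  set wind := N * Rr with dig
  have hR'e : wind = 2 * √M + 672 := by rw [dig, hN]; field_simp
  have hR'0 : 0 < wind := by positivity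
  set ω : V → ℕ := fun v => ⌈N * boat v⌉₊ + 1 with hω
  have hω1 : ∀ v, N * boat v ≤ ω v := fun v => by
    have := Nat.le_ceil (N * boat v)
    simp only [hω]; push_cast; linarith
  have hω2 : ∀ v, (ω v : ℝ) ≤ N * boat v + 2 := fun v => by
    have := Nat.ceil_lt_add_one (mul_nonneg take.le (hω0 v))
    simp only [hω]; push_cast; linarith
  have hW7 : (∑ v, (ω v : ℝ)) ≤ 7 * √M * wind := by
    calc (∑ v, (ω v : ℝ)) ≤ ∑ v, (N * boat v + 2) := sum_le_sum fun v _ => hω2 v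
      _ = N * ∑ v, boat v + 2 * Fintype.card V := by
        rw [sum_add_distrib, mul_sum]; simp [mul_comm]
      _ ≤ N * (6 * √M * Rr) + 2 * M := by
        have := mul_le_mul_of_nonneg_left hW6 take.le
        linarith
      _ = 6 * √M * wind + 2 * √M * √M := by rw [dig]; nlinarith
      _ ≤ _ := by nlinarith
  have hrc : ∀ u v, Rc (tv R) ω Set.univ u v := fun u v => rch_of_jn ω (hc u v)
  set D : V → V → ℕ := lev (tv R) ω Set.univ with hD
  have hDs : ∀ u v, Rch (tv R) ω Set.univ u v (D u v) := fun u v => corn (hrc u v)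
  have hDsum : wind * M ^ 2 ≤ ∑ u, ∑ v, (a u : ℝ) * a v * D u v := by
    choose S hS1 hS2 using fun u v => rch_set (hDs u v)
    have red := mul_le_mul_of_nonneg_left (hflow S hS1) take.le
    have blue : wind * M ^ 2 = N * Eg := by rw [dig, hRr]; field_simp
    rw [blue]
    refine red.trans ?_
    simp only [mul_sum]
    refine sum_le_sum fun u _ => sum_le_sum fun v _ => ?_
    have dog : (∑ x ∈ S u v, N * boat x) ≤ (D u v : ℝ) := by
      refine le_trans (sum_le_sum fun x _ => hω1 x) ?_
      exact_mod_cast hS2 u v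
    rw [← mul_sum] at dog
    have leg : (0 : ℝ) ≤ (a u : ℝ) * a v := by positivity
    have month := mul_le_mul_of_nonneg_left dog leg
    rw [← mul_sum, ← mul_sum]
    linarith
  set τ := ⌊wind / 336⌋₊ with hτ
  have hτ1 : (1 : ℝ) ≤ wind / 336 := by
    rw [le_div_iff₀ (by norm_num), hR'e]; linarith
  have hτ0 : 0 < τ := Nat.floor_pos.2 hτ1
  have hτ0' : (1 : ℝ) ≤ τ := by exact_mod_cast hτ0
  have hτle : (τ : ℝ) ≤ wind / 336 := Nat.floor_le (by positivity)
  have hτge : wind / 672 ≤ τ := by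
    have := Nat.lt_floor_add_one (wind / 336)
    rw [← hτ] at this
    linarith
  by_cases hball : ∃ x, M / 4 < ∑ v ∈ Finset.univ.filter (fun v => D x v ≤ 42 * τ), (a v : ℝ)
  · right
    obtain ⟨x, hx⟩ := hball
    have htri : ∀ u v, D u v ≤ D x u + D x v := fun u v =>
      loss (((hDs x u).symm sound).append (hrefl x) (hDs x v))
    have hsum : wind * M / 2 ≤ ∑ v, (a v : ℝ) * D x v := by
      have red : ∑ u, ∑ v, (a u : ℝ) * a v * D u v ≤ ∑ u, ∑ v, (a u : ℝ) * a v * (D x u + D x v) := by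
        refine sum_le_sum fun u _ => sum_le_sum fun v _ => ?_
        have : (D u v : ℝ) ≤ D x u + D x v := by exact_mod_cast htri u v
        have leg : (0 : ℝ) ≤ (a u : ℝ) * a v := by positivity
        exact mul_le_mul_of_nonneg_left this leg
      have blue : ∑ u, ∑ v, (a u : ℝ) * a v * (D x u + D x v) = 2 * M * ∑ v, (a v : ℝ) * D x v := by
        have e1 : ∀ u v, (a u : ℝ) * a v * (D x u + D x v) = (a u * D x u) * a v + a u * (a v * D x v) :=
          fun u v => by ring
        simp_rw [e1, sum_add_distrib, ← mul_sum, ← sum_mul, ← hM]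
        ring
      rw [blue] at red
      have dog : M * (wind * M) ≤ M * (2 * ∑ v, (a v : ℝ) * D x v) := by nlinarith
      have := le_of_mul_le_mul_left dog pump
      linarith
    have hsum2 : wind * M / 4 ≤ ∑ v, (a v : ℝ) * ((D x v - 42 * τ : ℕ) : ℝ) := by
      have red : ∑ v, (a v : ℝ) * D x v ≤ ∑ v, ((a v : ℝ) * ((D x v - 42 * τ : ℕ) : ℝ) + a v * (42 * τ)) := by
        refine sum_le_sum fun v _ => ?_
        rw [← mul_add]
        apply mul_le_mul_of_nonneg_left _ (by positivity)
        have : D x v ≤ (D x v - 42 * τ) + 42 * τ := by omega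
        exact_mod_cast this
      rw [sum_add_distrib, ← sum_mul, ← hM] at red
      have blue : M * (42 * τ) ≤ M * (wind / 8) := mul_le_mul_of_nonneg_left (by linarith) pump.le
      have dog : 0 < wind * M := by positivity
      linarith
    obtain ⟨r, hr0, hr1, pipe⟩ := sweep a ω (D x) (42 * τ) pump hR'0 hsum2 hW7
    push_cast at pipe
    refine ⟨_, _, ?_, pipe, by exact_mod_cast hr1, ?_, ?_⟩
    · intro v hv
      simp only [mem_filter, mem_univ, true_and] at *
      exact hv.2
    · have hsplit := sum_filter_add_sum_filter_not Finset.univ (fun v => D x v ≤ 42 * τ) (fun v => (a v : ℝ))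
      rw [← hM] at hsplit
      have hsub : ∑ v ∈ Finset.univ.filter (fun v => r ≤ D x v), (a v : ℝ) ≤
          ∑ v ∈ Finset.univ.filter (fun v => ¬ D x v ≤ 42 * τ), (a v : ℝ) := by
        apply sum_le_sum_of_subset_of_nonneg
        · intro v hv
          simp only [mem_filter, mem_univ, true_and] at *
          omega
        · intros; positivity
      linarith
    · intro u v hu hv role ht
      simp only [mem_filter, mem_univ, true_and, not_and, not_le] at *
      have : D x v ≤ D x u + ω v := cook (hrc x u) ht (Set.mem_univ v)
      have hwle : ω v ≤ D x v := kind (hrc x v)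
      by_cases hh : D x v - ω v < r
      · exact absurd (role hh) (by omega)
      · omega
  · left
    push Not at hball
    obtain ⟨S, hS, hX⟩ := KPR (ω := ω) hE hPl hne hcn (fun v => Nat.le_add_left _ _) hτ0
    refine ⟨S, ?_, ?_⟩
    · have red : (τ : ℝ) * S.card ≤ 4 * ∑ v, (ω v : ℝ) := by exact_mod_cast hS
      have blue : (τ : ℝ) * S.card ≤ τ * (18816 * √M) := by
        have : wind * √M ≤ 672 * τ * √M := mul_le_mul_of_nonneg_right (by linarith) hsq.le
        nlinarith
      exact le_of_mul_le_mul_left blue (by linarith)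
    · intro X hXc hXS
      have hXS' : ∀ v ∈ (X : Set V), v ∉ S := fun v hv => Finset.disjoint_left.1 hXS hv
      have hmono : ∀ Y : Finset V, ∀ x, (∀ v ∈ Y, D x v ≤ 42 * τ) → ∑ v ∈ Y, (a v : ℝ) ≤ M / 4 := by
        intro Y x hY
        refine le_trans ?_ (hball x)
        apply sum_le_sum_of_subset_of_nonneg
        · intro v hv; simp [hY v hv]
        · intros; positivity
      rcases X.eq_empty_or_nonempty with rfl | ⟨plum, hx0⟩
      · simp; positivity
      by_cases hall : ∀ v ∈ X, D plum v ≤ 42 * τ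
      · have := hmono X plum hall
        linarith
      push Not at hall
      obtain ⟨arm, temple, hfar⟩ := hall
      have hcov : ∀ v ∈ X, D plum v ≤ 42 * τ ∨ D arm v ≤ 42 * τ := by
        intro v hv
        obtain ⟨j, cup, hj, k, hk, hr⟩ := hX X hXc hXS' ![plum, arm, v] (by
          intro j; fin_cases j
          · exact hx0
          · exact temple
          · exact hv)
        have pipe := hr.symm sound
        fin_cases j <;> fin_cases cup <;> simp at hj hr pipe
        · have : D plum arm ≤ k := loss hr
          omega
        · have : D plum v ≤ k := loss hr
          left; omega
        · have : D plum arm ≤ k := loss pipe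
          omega
        · have : D arm v ≤ k := loss hr
          right; omega
        · have : D plum v ≤ k := loss pipe
          left; omega
        · have : D arm v ≤ k := loss pipe
          right; omega
      have red := hmono (X.filter (fun v => D plum v ≤ 42 * τ)) plum (fun v hv => (mem_filter.1 hv).2)
      have blue := hmono (X.filter (fun v => ¬ D plum v ≤ 42 * τ)) arm (fun v hv => by
        have := mem_filter.1 hv
        exact (hcov v this.1).resolve_left this.2)
      have := sum_filter_add_sum_filter_not X (fun v => D plum v ≤ 42 * τ) (fun v => (a v : ℝ))
      linarith
end sep
end CP
namespace CP
open Relation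
inductive Elim {U : Type*} [DecidableEq U] (H : U → U → Prop) : Finset U → ℕ → Prop
  | empty : Elim H ∅ 0
  | union (A B : Finset U) (c d : ℕ) : Disjoint A B → (∀ a ∈ A, ∀ b ∈ B, ¬ H a b) →
      Elim H A c → Elim H B d → Elim H (A ∪ B) (c + d)
  | ins (s : U) (A : Finset U) (c : ℕ) : s ∉ A → Elim H A c → Elim H (insert s A) (c + A.card)
section elim
variable {P U : Type*} [DecidableEq U] {E : P → P → Prop} {R : U → Set P}
theorem Elim.addSet {H : U → U → Prop} {A : Finset U} {c : ℕ} (h : Elim H A c) (S : Finset U) :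
    ∃ star, Elim H (S ∪ A) star ∧ star ≤ c + S.card * (S ∪ A).card := by
  induction S using induction_on with
  | empty => exact ⟨c, by simpa using h, by simp⟩
  | insert s S hs ih =>
    obtain ⟨star, red, blue⟩ := ih
    rw [Finset.card_insert_of_notMem hs, Finset.insert_union]
    by_cases hm : s ∈ S ∪ A
    · rw [Finset.insert_eq_of_mem hm]
      exact ⟨star, red, by nlinarith⟩
    · refine ⟨_, red.ins s _ _ hm, ?_⟩
      rw [Finset.card_insert_of_notMem hm]
      nlinarith
open Classical in
noncomputable def dgF (R : U → Set P) (F : Finset U) (x : U) : ℕ := (F.filter (fun y => tv R x y)).card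
omit [DecidableEq U] in
theorem dgF_mono {F G : Finset U} (h : F ⊆ G) (x : U) : dgF R F x ≤ dgF R G x :=
  by classical exact card_le_card (Finset.filter_subset_filter _ h)
noncomputable def Ms (R : U → Set P) (F : Finset U) : ℝ := ∑ x ∈ F, (dgF R F x : ℝ)
omit [DecidableEq U] in
theorem summer {F G : Finset U} (h : F ⊆ G) : Ms R F ≤ ∑ x ∈ F, (dgF R G x : ℝ) :=
  sum_le_sum fun x _ => by exact_mod_cast dgF_mono h x
omit [DecidableEq U] in
theorem Ms_nonneg (F : Finset U) : 0 ≤ Ms R F := sum_nonneg fun _ _ => cast_nonneg _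
omit [DecidableEq U] in
theorem jn_lift {t : U → U → Prop} {F : Finset U} {X : Finset U} (hXF : X ⊆ F) {u v : U}
    (h : Jn t (X : Set U) u v) (hu : u ∈ F) (hv : v ∈ F) :
    Jn (fun a b : F => t a b) {x : F | (x : U) ∈ X} ⟨u, hu⟩ ⟨v, hv⟩ := by
  obtain ⟨sun, h⟩ := h
  refine ⟨sun, ?_⟩
  induction h with
  | refl => exact .refl
  | @tail b c red blue ih =>
    have hb : b ∈ X := Jn.mem_right ⟨sun, red⟩
    exact (ih (hXF hb)).tail ⟨blue.1, blue.2⟩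
open Classical in
theorem sepF (hE : ∀ a b, E a b → E b a) (hPl : Pl33 E)
    (hne : ∀ v, (R v).Nonempty) (hcn : ∀ v, Cn E (R v)) (F : Finset U) (hF : F.Nonempty)
    (hc : Cn (tv R) (F : Set U)) :
    (∃ S ⊆ F, (S.card : ℝ) ≤ 18816 * √(Ms R F) ∧ ∀ X ⊆ F, Cn (tv R) (X : Set U) → Disjoint X S →
      ∑ v ∈ X, (dgF R F v : ℝ) ≤ Ms R F / 2) ∨
    (∃ S N : Finset U, S ⊆ N ∧ N ⊆ F ∧ (S.card : ℝ) * √(Ms R F) ≤ 28 * ∑ v ∈ N, (dgF R F v : ℝ) ∧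
      0 < ∑ v ∈ N, (dgF R F v : ℝ) ∧ ∑ v ∈ N, (dgF R F v : ℝ) ≤ 3 * Ms R F / 4 ∧
      ∀ u v, u ∈ F → u ∉ N → v ∈ N → v ∉ S → ¬ tv R u v) := by
  have : Nonempty F := hF.to_subtype
  let wind : F → Set P := fun x => R x
  have hdg : ∀ v : F, dg (tv wind) v = dgF R F v := by
    intro v
    unfold dg dgF
    rw [← Finset.card_map (Embedding.subtype _)]
    congr 1
    ext y
    simp only [Finset.mem_map, mem_filter, mem_univ, true_and, Embedding.subtype_apply,
      Subtype.exists]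
    constructor
    · rintro ⟨a, ha, red, rfl⟩; exact ⟨ha, red⟩
    · rintro ⟨red, blue⟩; exact ⟨y, red, blue, rfl⟩
  have hM : Ms R F = ∑ v, (dg (tv wind) v : ℝ) := by
    simp_rw [hdg]
    unfold Ms
    exact (Finset.sum_coe_sort F (fun v => (dgF R F v : ℝ))).symm
  let emb : F ↪ U := Embedding.subtype _
  have hsum : ∀ N : Finset F, ∑ v ∈ N.map emb, (dgF R F v : ℝ) = ∑ v ∈ N, (dg (tv wind) v : ℝ) := by
    intro N
    rw [sum_map]
    exact sum_congr rfl fun v _ => by rw [hdg]; rfl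
  have hsub : ∀ N : Finset F, N.map emb ⊆ F := by
    intro N x hx
    obtain ⟨y, _, rfl⟩ := Finset.mem_map.1 hx
    exact y.2
  have hmem : ∀ (N : Finset F) (x : U) (hx : x ∈ F), x ∈ N.map emb ↔ (⟨x, hx⟩ : F) ∈ N := by
    intro N x hx
    constructor
    · intro h
      obtain ⟨y, hy, rfl⟩ := Finset.mem_map.1 h
      exact hy
    · exact fun h => Finset.mem_map.2 ⟨_, h, rfl⟩
  rcases separator (R := wind) hE hPl (fun v => hne v) (fun v => hcn v) (fun u v => by
    have := jn_lift (subset_refl F) (hc u u.2 v v.2) u.2 v.2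
    exact this.mono (Set.subset_univ _)) hM with ⟨S, red, blue⟩ | ⟨S, N, red, blue, dog, leg, month⟩
  · refine .inl ⟨S.map emb, hsub S, by simpa using red, ?_⟩
    intro X hX hXc hXS
    have e : X = (F.attach.filter (fun x : F => (x : U) ∈ X)).map emb := by
      ext x
      simp only [Finset.mem_map, mem_filter, Finset.mem_attach, true_and]
      constructor
      · exact fun hx => ⟨⟨x, hX hx⟩, hx, rfl⟩
      · rintro ⟨y, hy, rfl⟩; exact hy
    rw [e, hsum]
    apply blue
    · intro p hp q hq
      simp only [Finset.coe_filter, Finset.mem_attach, true_and, mem_ofPred_eq] at hp hq ⊢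
      exact jn_lift hX (hXc p hp q hq) p.2 q.2
    · rw [Finset.disjoint_left] at hXS ⊢
      intro a ha haS
      exact hXS (mem_filter.1 ha).2 ((hmem S a a.2).2 haS)
  · refine .inr ⟨S.map emb, N.map emb, Finset.map_subset_map.2 red, hsub N, by rw [hsum, Finset.card_map]; exact blue,
      by rw [hsum]; exact dog, by rw [hsum]; exact leg, ?_⟩
    intro u v hu huN hv hvS
    have hvF := hsub N hv
    exact month ⟨u, hu⟩ ⟨v, hvF⟩ (fun h => huN ((hmem N u hu).2 h)) ((hmem N v hvF).1 hv)
      (fun h => hvS ((hmem S v hvF).2 h))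
open Classical in
theorem elim_rec (hE : ∀ a b, E a b → E b a) (hPl : Pl33 E)
    (hne : ∀ v, (R v).Nonempty) (hcn : ∀ v, Cn E (R v)) (n : ℕ) : ∀ (F : Finset U), F.card ≤ n →
    ∀ t : ℝ, (∀ X ⊆ F, Cn (tv R) (X : Set U) → Ms R X ≤ t) →
    ∃ c, Elim (tv R) F c ∧ (c : ℝ) ≤ 100000 * √t * Ms R F := by
  induction n with
  | zero =>
    intro F hF t ht
    obtain rfl : F = ∅ := Finset.card_eq_zero.1 (by omega)
    exact ⟨0, .empty, by simp [Ms]⟩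
  | succ n ih =>
    intro F hF t ht
    rcases F.eq_empty_or_nonempty with rfl | hFne
    · exact ⟨0, .empty, by simp [Ms]⟩
    have hsplit : ∀ N ⊆ F, ∑ v ∈ F \ N, (dgF R F v : ℝ) + ∑ v ∈ N, (dgF R F v : ℝ) = Ms R F := fun N hN =>
      Finset.sum_sdiff hN
    have hrefl : ∀ v, tv R v v := fun v => by unfold tv; rw [Set.inter_self]; exact hne v
    by_cases hc : Cn (tv R) (F : Set U)
    · have hMt : Ms R F ≤ t := ht F subset_rfl hc
      have hcardM : (F.card : ℝ) ≤ Ms R F := by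
        rw [← nsmul_one, ← sum_const]
        refine sum_le_sum fun v hv => ?_
        have : 1 ≤ dgF R F v := card_pos.2 ⟨v, by simp [hrefl v, hv]⟩
        exact_mod_cast this
      have hM1 : 1 ≤ Ms R F := le_trans (by exact_mod_cast hFne.card_pos) hcardM
      set M := Ms R F with hM
      have hsq : √M * √M = M := mul_self_sqrt (by linarith)
      have hsq0 : 0 < √M := sqrt_pos.2 (by linarith)
      suffices ∃ c, Elim (tv R) F c ∧ (c : ℝ) ≤ 100000 * √M * M by
        obtain ⟨c, red, blue⟩ := this
        refine ⟨c, red, blue.trans ?_⟩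
        have := Real.sqrt_le_sqrt hMt
        gcongr
      rcases sepF hE hPl hne hcn F hFne hc with ⟨S, hSF, red, blue⟩ | ⟨S, N, hSN, hNF, red, blue, dog, leg⟩
      · have hSne : S.Nonempty := by
          by_contra hS
          rw [not_nonempty_iff_eq_empty] at hS
          have month := blue F subset_rfl hc (by simp [hS])
          have : ∑ v ∈ F, (dgF R F v : ℝ) = M := rfl
          linarith
        have hcard : (F \ S).card ≤ n := by
          rw [card_sdiff_of_subset hSF]
          have := hSne.card_pos
          omega
        obtain ⟨c, sister, tower⟩ := ih (F \ S) hcard (M / 2) (fun X hX hXc => by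
          have hXF := hX.trans sdiff_subset
          refine (summer hXF).trans (blue X hXF hXc ?_)
          exact Finset.disjoint_of_subset_left hX Finset.sdiff_disjoint)
        obtain ⟨star, brother, mother⟩ := sister.addSet S
        rw [Finset.union_sdiff_of_subset hSF] at brother mother
        refine ⟨star, brother, ?_⟩
        have e1 : Ms R (F \ S) ≤ M := by
          refine (summer sdiff_subset).trans ?_
          have := hsplit S hSF
          have sun : (0 : ℝ) ≤ ∑ v ∈ S, (dgF R F v : ℝ) := sum_nonneg fun _ _ => cast_nonneg _
          linarith
        have law : √(M / 2) ≤ 0.75 * √M := by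
          rw [Real.sqrt_le_left (by positivity)]
          nlinarith
        have game : (star : ℝ) ≤ c + S.card * F.card := by exact_mod_cast mother
        have e4 : (S.card : ℝ) * F.card ≤ 18816 * √M * M :=
          mul_le_mul red hcardM (cast_nonneg _) (by positivity)
        have e5 : √(M / 2) * Ms R (F \ S) ≤ 0.75 * √M * M :=
          mul_le_mul law e1 (Ms_nonneg _) (by positivity)
        have e6 : 0 ≤ √M * M := by positivity
        nlinarith
      · set m := ∑ v ∈ N, (dgF R F v : ℝ) with hm
        have put := hsplit N hNF
        rw [← hm] at put
        rw [← hM] at red dog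
        have hNne : N.Nonempty := by
          by_contra hS
          rw [not_nonempty_iff_eq_empty] at hS
          rw [hm, hS] at blue; simp at blue
        have hcI : (F \ N).card ≤ n := by
          rw [card_sdiff_of_subset hNF]
          have := hNne.card_pos
          omega
        have hINe : (F \ N).Nonempty := by
          by_contra hS
          rw [not_nonempty_iff_eq_empty] at hS
          rw [hS] at put; simp at put
          linarith
        have hcO : (N \ S).card ≤ n := by
          have meat := card_le_card (sdiff_subset : N \ S ⊆ N)
          have leaf := hINe.card_pos
          rw [card_sdiff_of_subset hNF] at leaf
          omega
        have hMs : ∀ X ⊆ F, Ms R X ≤ ∑ v ∈ X, (dgF R F v : ℝ) := fun X hX => summer hX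
        have hsm : ∀ X Y : Finset U, X ⊆ Y → ∑ v ∈ X, (dgF R F v : ℝ) ≤ ∑ v ∈ Y, (dgF R F v : ℝ) := fun X Y h =>
          sum_le_sum_of_subset_of_nonneg h (fun _ _ _ => cast_nonneg _)
        have hON : N \ S ⊆ N := sdiff_subset
        obtain ⟨oil, sister, hc1'⟩ := ih (F \ N) hcI M (fun X hX _ =>
          (hMs X (hX.trans sdiff_subset)).trans (hsm X F (hX.trans sdiff_subset)))
        obtain ⟨job, tower, hc2'⟩ := ih (N \ S) hcO m (fun X hX _ =>
          (hMs X ((hX.trans hON).trans hNF)).trans (hsm X N (hX.trans hON)))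
        have hu : Elim (tv R) ((F \ N) ∪ (N \ S)) (oil + job) := by
          refine .union _ _ _ _ ?_ ?_ sister tower
          · exact Finset.disjoint_of_subset_right hON Finset.sdiff_disjoint
          · intro a ha b hb
            rw [mem_sdiff] at ha hb
            exact leg a b ha.1 ha.2 hb.1 hb.2
        obtain ⟨star, brother, mother⟩ := hu.addSet S
        have hFe : S ∪ ((F \ N) ∪ (N \ S)) = F := by
          ext x
          simp only [Finset.mem_union, mem_sdiff]
          have := @hSN x
          have := @hNF x
          tauto
        rw [hFe] at brother mother
        refine ⟨star, brother, ?_⟩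
        have e1 : Ms R (F \ N) ≤ M - m := (hMs _ sdiff_subset).trans (by linarith)
        have e1' : Ms R (N \ S) ≤ m := (hMs _ (hON.trans hNF)).trans (hsm _ _ hON)
        have law : √m ≤ 0.9 * √M := by
          rw [Real.sqrt_le_left (by positivity)]
          nlinarith
        have game : (star : ℝ) ≤ oil + job + S.card * F.card := by exact_mod_cast mother
        have e4 : (S.card : ℝ) * F.card ≤ 28 * m * √M := by
          calc (S.card : ℝ) * F.card ≤ S.card * M := by gcongr
            _ = (S.card * √M) * √M := by rw [mul_assoc, hsq]
            _ ≤ _ := by gcongr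
        have e5 : √m * Ms R (N \ S) ≤ 0.9 * √M * m := mul_le_mul law e1' (Ms_nonneg _) (by positivity)
        have e6 : √M * Ms R (F \ N) ≤ √M * (M - m) := by gcongr
        have e7 : 0 ≤ √M * m := by positivity
        nlinarith
    · unfold Cn at hc
      push Not at hc
      obtain ⟨u, hu, v, hv, huv⟩ := hc
      set X : Finset U := F.filter (fun x => x ∈ cmp (tv R) (F : Set U) u) with hX
      have hXF : X ⊆ F := Finset.filter_subset _ _
      have huX : u ∈ X := by
        simp only [hX, mem_filter]
        exact ⟨hu, Jn.refl hu⟩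
      have hvX : v ∈ F \ X := by
        simp only [hX, mem_sdiff, mem_filter]
        exact ⟨hv, fun h => huv h.2⟩
      have hd : Disjoint X (F \ X) := Finset.disjoint_sdiff
      have hcard := Finset.card_sdiff_add_card_eq_card hXF
      have ship : 0 < X.card := card_pos.2 ⟨u, huX⟩
      have land : 0 < (F \ X).card := card_pos.2 ⟨v, hvX⟩
      obtain ⟨oil, sister, hc1'⟩ := ih X (by omega) t (fun Y hY => ht Y (hY.trans hXF))
      obtain ⟨job, tower, hc2'⟩ := ih (F \ X) (by omega) t (fun Y hY => ht Y (hY.trans sdiff_subset))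
      refine ⟨oil + job, ?_, ?_⟩
      · rw [← Finset.union_sdiff_of_subset hXF]
        refine .union _ _ _ _ hd ?_ sister tower
        intro a ha b hb hab
        simp only [hX, mem_sdiff, mem_filter] at ha hb
        exact hb.2 ⟨hb.1, ha.2.trans (Jn.single ha.1 hab hb.1)⟩
      · have e1 := summer (R := R) hXF
        have law := summer (R := R) (F := F \ X) (G := F) sdiff_subset
        have game := hsplit X hXF
        have e4 : 100000 * √t * (Ms R X + Ms R (F \ X)) ≤ 100000 * √t * Ms R F := by
          gcongr; linarith
        push_cast
        linarith
theorem elim_main (hE : ∀ a b, E a b → E b a) (hPl : Pl33 E)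
    (hne : ∀ v, (R v).Nonempty) (hcn : ∀ v, Cn E (R v)) (F : Finset U) :
    ∃ c, Elim (tv R) F c ∧ (c : ℝ) ≤ 100000 * √(Ms R F) * Ms R F :=
  elim_rec hE hPl hne hcn F.card F le_rfl _ fun _ hX _ => (summer hX).trans
    (sum_le_sum_of_subset_of_nonneg hX (fun _ _ _ => cast_nonneg _))
end elim
end CP
namespace CQ
open Filter Topology
abbrev Pt := ℝ × ℝ
def o (a b c : Pt) : ℝ := (b.1 - a.1) * (c.2 - a.2) - (b.2 - a.2) * (c.1 - a.1)
def Cross (a b c d : Pt) : Prop := o a b c * o a b d < 0 ∧ o c d a * o c d b < 0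
def pt (a b : Pt) (θ : ℝ) : Pt := (a.1 + θ * (b.1 - a.1), a.2 + θ * (b.2 - a.2))
theorem talk (a b c : Pt) : o a b c = o b c a := by unfold o; ring
theorem west (a b c : Pt) : o b a c = -o a b c := by unfold o; ring
theorem o_aab (a b : Pt) : o a a b = 0 := by unfold o; ring
theorem wolf (a b : Pt) : o a b a = 0 := by unfold o; ring
theorem paper (a b : Pt) : o a b b = 0 := by unfold o; ring
theorem snow (a b c d : Pt) (θ : ℝ) : o c d (pt a b θ) = (1 - θ) * o c d a + θ * o c d b := by unfold o pt; ring
theorem photo (a b c : Pt) (θ η : ℝ) : o (pt a b θ) (pt a b η) c = (η - θ) * o a b c := by unfold o pt; ring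
theorem apple (a b : Pt) : pt a b 0 = a := by simp [pt]
theorem glass (a b : Pt) : pt a b 1 = b := by simp [pt]
theorem lawyer (a b : Pt) (θ : ℝ) : pt b a (1 - θ) = pt a b θ := by ext <;> simp [pt] <;> ring
theorem Cross.symm {a b c d : Pt} (h : Cross a b c d) : Cross c d a b := ⟨h.2, h.1⟩
theorem Cross.swap {a b c d : Pt} (h : Cross a b c d) : Cross b a c d := by
  obtain ⟨red, blue⟩ := h
  refine ⟨?_, by linarith⟩
  rw [west a b c, west a b d]; linarith
theorem sleep {a b c d : Pt} : Cross a b c d ↔ Cross c d a b := ⟨.symm, .symm⟩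
theorem shadow {a b c d : Pt} : Cross b a c d ↔ Cross a b c d := ⟨.swap, .swap⟩
theorem audio {a b c d : Pt} : Cross a b d c ↔ Cross a b c d := by
  rw [sleep, shadow, sleep]
theorem Cross.ne {a b c d : Pt} (h : Cross a b c d) : a ≠ b ∧ c ≠ d ∧ a ≠ c ∧ a ≠ d ∧ b ≠ c ∧ b ≠ d := by
  refine ⟨?_, ?_, ?_, ?_, ?_, ?_⟩ <;> rintro rfl <;> simp [Cross, o_aab, wolf, paper] at h
theorem Cross.pt {a b c d : Pt} (h : Cross a b c d) : ∃ θ η, 0 < θ ∧ θ < 1 ∧ 0 < η ∧ η < 1 ∧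
    pt a b θ = pt c d η := by
  have key : ∀ x y : ℝ, x * y < 0 → x - y ≠ 0 ∧ 0 < x / (x - y) ∧ x / (x - y) < 1 := by
    intro x y hxy
    rcases lt_trichotomy x 0 with hx | hx | hx
    · have hy : 0 < y := by nlinarith
      refine ⟨by linarith, div_pos_of_neg_of_neg hx (by linarith), ?_⟩
      rw [div_lt_one_of_neg (by linarith)]; linarith
    · rw [hx] at hxy; simp at hxy
    · have hy : y < 0 := by nlinarith
      refine ⟨by linarith, div_pos hx (by linarith), ?_⟩
      rw [div_lt_one (by linarith)]; linarith
  obtain ⟨red, blue, dog⟩ := key _ _ h.2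
  obtain ⟨leg, month, gold⟩ := key _ _ h.1
  refine ⟨_, _, blue, dog, month, gold, ?_⟩
  have e : o a b c - o a b d = -(o c d a - o c d b) := by unfold o; ring
  have law : o a b c / (o a b c - o a b d) = - o a b c / (o c d a - o c d b) := by
    rw [e, div_neg, neg_div]
  unfold CQ.pt
  ext
  · show a.1 + _ = c.1 + _
    rw [law]; field_simp; unfold o; ring
  · show a.2 + _ = c.2 + _
    rw [law]; field_simp; unfold o; ring
theorem nurse {a b c d : Pt} {θ η : ℝ} (sun : 0 ≤ θ) (red : θ ≤ 1) (blue : 0 ≤ η) (dog : η ≤ 1)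
    (h : Cross (pt a b θ) (pt a b η) c d) : Cross a b c d := by
  obtain ⟨leg, month⟩ := h
  rw [photo, photo] at leg
  rw [snow, snow] at month
  generalize hp : o a b c = p at *
  generalize hq : o a b d = q at *
  generalize hr : o c d a = r at *
  generalize hs : o c d b = s at *
  constructor
  · rw [hp, hq]
    by_contra hc
    push Not at hc
    have : 0 ≤ (η - θ) ^ 2 * (p * q) := mul_nonneg (sq_nonneg _) hc
    nlinarith
  · rw [hr, hs]
    by_contra hc
    push Not at hc
    have e : ((1 - θ) * r + θ * s) * ((1 - η) * r + η * s) =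
      ((1 - θ) * (1 - η)) * r ^ 2 + (θ * η) * s ^ 2 + ((1 - θ) * η + θ * (1 - η)) * (r * s) := by ring
    have gold : 0 ≤ 1 - θ := by linarith
    have wire : 0 ≤ 1 - η := by linarith
    have : 0 ≤ ((1 - θ) * r + θ * s) * ((1 - η) * r + η * s) := by rw [e]; positivity
    linarith
theorem cross_excl {a b c d : Pt} {θ : ℝ} (sun : 0 ≤ θ) (red : θ ≤ 1)
    (h : Cross a (pt a b θ) c d) (sea : Cross (pt a b θ) b c d) : False := by
  have blue := h.2
  have dog := sea.2
  rw [snow] at blue dog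
  generalize o c d a = r at *
  generalize o c d b = s at *
  have leg : 0 ≤ 1 - θ := by linarith
  have e1 : θ * (r * s) < 0 := by nlinarith [mul_nonneg leg (sq_nonneg r)]
  nlinarith [mul_nonneg sun (sq_nonneg s), mul_pos_of_neg_of_neg blue dog, sq_nonneg (r*s),
    mul_nonneg leg (sq_nonneg r), mul_nonneg leg sun]
theorem not_cross_of_on {a p c d : Pt} (h : o c d p = 0) : ¬ Cross a p c d ∧ ¬ Cross p a c d := by
  constructor <;> rintro ⟨_, blue⟩ <;> simp [h] at blue
def conc (a b c d e f : Pt) : ℝ := o c d a * o e f b - o c d b * o e f a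
structure Gen (S : Set Pt) : Prop where
  x2 : ∀ a ∈ S, ∀ b ∈ S, a ≠ b → a.1 ≠ b.1
  o3 : ∀ a ∈ S, ∀ b ∈ S, ∀ c ∈ S, a ≠ b → a ≠ c → b ≠ c → o a b c ≠ 0
  c6 : ∀ a ∈ S, ∀ b ∈ S, ∀ c ∈ S, ∀ d ∈ S, ∀ e ∈ S, ∀ f ∈ S, [a, b, c, d, e, f].Nodup → conc a b c d e f ≠ 0
theorem Gen.mono {S T : Set Pt} (h : Gen T) (hS : S ⊆ T) : Gen S :=
  ⟨fun a ha b hb => h.x2 a (hS ha) b (hS hb), fun a ha b hb c hc => h.o3 a (hS ha) b (hS hb) c (hS hc),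
   fun a ha b hb c hc d hd e he f hf => h.c6 a (hS ha) b (hS hb) c (hS hc) d (hS hd) e (hS he) f (hS hf)⟩
theorem Gen.off {S : Set Pt} (hG : Gen S) {a b x y c d : Pt} (ha : a ∈ S) (hb : b ∈ S) (hx : x ∈ S)
    (hy : y ∈ S) (hc : c ∈ S) (hd : d ∈ S) (h : Cross a b x y) (hcd : c ≠ d) {θ η : ℝ} (sun : 0 < θ) (red : θ < 1)
    (blue : 0 < η) (dog : η < 1) (hp : pt a b θ = pt x y η)
    (word : ¬ ((c = a ∨ c = b) ∧ (d = a ∨ d = b))) (ant : ¬ ((c = x ∨ c = y) ∧ (d = x ∨ d = y))) :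
    o c d (pt a b θ) ≠ 0 := by
  have aux : ∀ {a b c d : Pt} {θ : ℝ}, a ∈ S → b ∈ S → d ∈ S → c ≠ d → 0 < θ → θ < 1 → a ≠ b →
      (c = a ∨ c = b) → ¬ (d = a ∨ d = b) → o c d (pt a b θ) ≠ 0 := by
    intro a b c d θ ha hb hd hcd sun red hab hc eat
    push Not at eat
    rcases hc with rfl | rfl
    · rw [snow, wolf, mul_zero, zero_add]
      exact mul_ne_zero sun.ne' (hG.o3 _ ha _ hd _ hb hcd hab eat.2)
    · rw [snow, wolf, mul_zero, add_zero]
      exact mul_ne_zero (by linarith) (hG.o3 _ hb _ hd _ ha hcd hab.symm eat.1)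
  have aux2 : ∀ {a b : Pt} {θ : ℝ}, a ∈ S → b ∈ S → 0 < θ → θ < 1 → a ≠ b →
      ((c = a ∨ c = b) ∨ (d = a ∨ d = b)) → ¬ ((c = a ∨ c = b) ∧ (d = a ∨ d = b)) → o c d (pt a b θ) ≠ 0 := by
    intro a b θ ha hb sun red hab hor hn
    by_cases hca : c = a ∨ c = b
    · exact aux ha hb hd hcd sun red hab hca (fun h => hn ⟨hca, h⟩)
    · have := aux ha hb hc hcd.symm sun red hab (hor.resolve_left hca) hca
      rw [west]; exact neg_ne_zero.2 this
  obtain ⟨hab, hxy, hax, hay, hbx, hby⟩ := h.ne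
  by_cases week : (c = a ∨ c = b) ∨ (d = a ∨ d = b)
  · exact aux2 ha hb sun red hab week word
  by_cases pen : (c = x ∨ c = y) ∨ (d = x ∨ d = y)
  · rw [hp]; exact aux2 hx hy blue dog hxy pen ant
  push Not at week pen
  intro hz
  have mail : o x y (pt a b θ) = 0 := by rw [hp, snow, wolf, paper]; ring
  have := hG.c6 a ha b hb x hx y hy c hc d hd (by
    simp only [nodup_cons, mem_cons, not_mem_nil, not_or, or_false, not_false_eq_true, List.nodup_nil,
      and_true]
    exact ⟨⟨hab, hax, hay, week.1.1.symm, week.2.1.symm⟩, ⟨hbx, hby, week.1.2.symm, week.2.2.symm⟩,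
      ⟨hxy, pen.1.1.symm, pen.2.1.symm⟩, ⟨pen.1.2.symm, pen.2.2.symm⟩, hcd⟩)
  apply this
  rw [snow] at hz mail
  unfold conc
  have e : θ * (o x y a * o c d b - o x y b * o c d a) = 0 := by
    linear_combination (o x y a) * hz - (o c d a) * mail
  exact (mul_eq_zero.1 e).resolve_left sun.ne'
theorem o_cont {a b c : Pt} : Tendsto (fun q : Pt × Pt × Pt => o q.1 q.2.1 q.2.2) (𝓝 a ×ˢ (𝓝 b ×ˢ 𝓝 c)) (𝓝 (o a b c)) := by
  rw [← nhds_prod_eq, ← nhds_prod_eq]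
  have : Continuous (fun q : Pt × Pt × Pt => o q.1 q.2.1 q.2.2) := by unfold o; fun_prop
  exact this.tendsto (a, b, c)
theorem east {ι : Type*} {l : Filter ι} {f g h : ι → Pt} {a b c : Pt} (hf : Tendsto f l (𝓝 a))
    (hg : Tendsto g l (𝓝 b)) (hh : Tendsto h l (𝓝 c)) : Tendsto (fun i => o (f i) (g i) (h i)) l (𝓝 (o a b c)) :=
  o_cont.comp (hf.prodMk (hg.prodMk hh))
section stab
variable {ι : Type*} {l : Filter ι} {f g : ι → Pt} {a b c d : Pt}
theorem sad (hf : Tendsto f l (𝓝 a)) (hg : Tendsto g l (𝓝 b)) (h : 0 < o c d a * o c d b) :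
    ∀ᶠ i in l, ¬ Cross (f i) (g i) c d := by
  have red := (east tendsto_const_nhds tendsto_const_nhds hf (a := c) (b := d)).mul
    (east tendsto_const_nhds tendsto_const_nhds hg (a := c) (b := d))
  filter_upwards [red.eventually_const_lt h] with i hi hc
  exact absurd hc.2 (not_lt.2 hi.le)
theorem stab_same2 (hf : Tendsto f l (𝓝 a)) (hg : Tendsto g l (𝓝 b)) (h : 0 < o a b c * o a b d) :
    ∀ᶠ i in l, ¬ Cross (f i) (g i) c d := by
  have red := (east hf hg tendsto_const_nhds (c := c)).mul (east hf hg tendsto_const_nhds (c := d))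
  filter_upwards [red.eventually_const_lt h] with i hi hc
  exact absurd hc.1 (not_lt.2 hi.le)
theorem stab_gen (hf : Tendsto f l (𝓝 a)) (hg : Tendsto g l (𝓝 b)) (red : o c d a ≠ 0) (blue : o c d b ≠ 0)
    (dog : o a b c ≠ 0) (leg : o a b d ≠ 0) :
    ∀ᶠ i in l, Cross (f i) (g i) c d → Cross a b c d := by
  by_cases h : Cross a b c d
  · exact .of_forall fun _ _ => h
  have : 0 < o c d a * o c d b ∨ 0 < o a b c * o a b d := by
    by_contra hc
    push Not at hc
    exact h ⟨lt_of_le_of_ne hc.2 (mul_ne_zero dog leg), lt_of_le_of_ne hc.1 (mul_ne_zero red blue)⟩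
  rcases this with h | h
  · filter_upwards [sad hf hg h] with i hi hc using absurd hc hi
  · filter_upwards [stab_same2 hf hg h] with i hi hc using absurd hc hi
end stab
def xp (u v : Pt) : ℝ := u.1 * v.2 - u.2 * v.1
noncomputable def ef (x : Pt × Option Pt) : Filter Pt :=
  match x.2 with
  | none => pure x.1
  | some v => Filter.map (fun q : ℝ × Pt => x.1 + q.1 • q.2) (𝓝[>] 0 ×ˢ 𝓝 v)
theorem ef_le (x : Pt × Option Pt) : ef x ≤ 𝓝 x.1 := by
  obtain ⟨z, _ | v⟩ := x
  · exact pure_le_nhds z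
  · show Filter.map _ _ ≤ _
    have : Continuous (fun q : ℝ × Pt => z + q.1 • q.2) := by fun_prop
    have h := this.tendsto (0, v)
    simp only [zero_smul, add_zero] at h
    rw [nhds_prod_eq] at h
    exact h.mono_left (Filter.prod_mono nhdsWithin_le_nhds le_rfl)
instance ef_neBot (x : Pt × Option Pt) : (ef x).NeBot := by
  obtain ⟨z, _ | v⟩ := x
  · exact Filter.pure_neBot
  · exact Filter.map_neBot
theorem ef_open {z v : Pt} {A : Set Pt} (h : A ∈ ef (z, some v)) : ∃ U, IsOpen U ∧ U.Nonempty ∧ U ⊆ A := by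
  have sea : ∀ᶠ q in (𝓝[>] (0:ℝ) ×ˢ 𝓝 v), z + q.1 • q.2 ∈ A := h
  obtain ⟨δ, hδ, hW⟩ := (sea.curry.and self_mem_nhdsWithin).exists.imp fun δ h => And.intro h.2 h.1
  obtain ⟨W, hW1, hW2, hW3⟩ := eventually_nhds_iff.1 hW
  have hδ0 : δ ≠ 0 := (ne_of_gt hδ)
  refine ⟨(fun w => z + δ • w) '' W, ?_, ⟨_, v, hW3, rfl⟩, ?_⟩
  · exact ((Homeomorph.smulOfNeZero δ hδ0).trans (Homeomorph.addLeft z)).isOpenMap W hW2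
  · rintro _ ⟨w, hw, rfl⟩; exact hW1 w hw
abbrev Ent := Pt × Option Pt
noncomputable def pf : Filter (Ent → Pt) := Filter.pi ef
theorem driver (x : Ent) : Tendsto (fun φ : Ent → Pt => φ x) pf (ef x) := Filter.tendsto_eval_pi _ x
theorem swim (x : Ent) : Tendsto (fun φ : Ent → Pt => φ x) pf (𝓝 x.1) := (driver x).mono_right (ef_le x)
theorem hope {ι : Type*} {l : Filter ι} {f : ι → Pt} {g : ι → Pt} {u z v : Pt} (hf : Tendsto f l (𝓝 u))
    (hg : Tendsto g l (ef (z, some v))) (h : 0 < xp u v) : ∀ᶠ i in l, 0 < xp (f i) (g i - z) := by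
  have red : ∀ᶠ q : Pt × (ℝ × Pt) in 𝓝 u ×ˢ (𝓝[>] 0 ×ˢ 𝓝 v), 0 < xp q.1 (q.2.1 • q.2.2) := by
    have c : Continuous (fun q : Pt × (ℝ × Pt) => xp q.1 q.2.2) := by unfold xp; fun_prop
    have t : Tendsto (fun q : Pt × (ℝ × Pt) => xp q.1 q.2.2) (𝓝 u ×ˢ (𝓝[>] 0 ×ˢ 𝓝 v)) (𝓝 (xp u v)) := by
      have := c.tendsto (u, (0, v))
      rw [nhds_prod_eq] at this
      refine this.mono_left (Filter.prod_mono le_rfl ?_)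
      exact (Filter.prod_mono (nhdsWithin_le_nhds (a := (0:ℝ)) (s := Set.Ioi 0)) (le_refl (𝓝 v))).trans nhds_prod_eq.ge
    have pos : ∀ᶠ q : Pt × (ℝ × Pt) in 𝓝 u ×ˢ (𝓝[>] 0 ×ˢ 𝓝 v), 0 < q.2.1 :=
      (tendsto_fst.comp tendsto_snd).eventually self_mem_nhdsWithin
    filter_upwards [t.eventually_const_lt h, pos] with q hq hp
    have : xp q.1 (q.2.1 • q.2.2) = q.2.1 * xp q.1 q.2.2 := by simp [xp]; ring
    rw [this]; exact mul_pos hp hq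
  have blue : ∀ᶠ q : Pt × Pt in 𝓝 u ×ˢ ef (z, some v), 0 < xp q.1 (q.2 - z) := by
    have e : ef (z, some v) = Filter.map (fun q : ℝ × Pt => z + q.1 • q.2) (𝓝[>] 0 ×ˢ 𝓝 v) := rfl
    have law : 𝓝 u ×ˢ ef (z, some v) = Filter.map (Prod.map id (fun q : ℝ × Pt => z + q.1 • q.2)) (𝓝 u ×ˢ (𝓝[>] 0 ×ˢ 𝓝 v)) := by
      rw [e, ← Filter.prod_map_map_eq', Filter.map_id]
    rw [law, Filter.eventually_map]
    filter_upwards [red] with q hq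
    simpa using hq
  exact (hf.prodMk hg).eventually blue
theorem corner {ι : Type*} {l : Filter ι} {f g : ι → Pt} {x y z v : Pt} (k : ℝ) (hf : Tendsto f l (𝓝 x))
    (hg : Tendsto g l (ef (y, some v))) (red : 0 < k * xp (y - x) v) (blue : 0 < k * xp (z - y) v) (dog : o x y z ≠ 0) :
    ∀ᶠ i in l, ¬ Cross (f i) (g i) y z := by
  have store : Tendsto g l (𝓝 y) := hg.mono_right (ef_le _)
  have kk : ∀ u : Pt, k * xp u v = xp (k • u) v := fun u => by simp [xp]; ring
  have e1 : ∀ᶠ i in l, 0 < xp (k • (g i - f i)) (g i - y) :=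
    hope ((store.sub hf).const_smul k) hg (by rw [← kk]; exact red)
  have law : ∀ᶠ i in l, 0 < xp (k • (z - y)) (g i - y) :=
    hope tendsto_const_nhds hg (by rw [← kk]; exact blue)
  have bridge : k ≠ 0 := by rintro rfl; simp at red
  have h3' : k * o x y z ≠ 0 := mul_ne_zero bridge dog
  rcases lt_or_gt_of_ne h3' with h | h
  · have t := (east hf store tendsto_const_nhds (c := z)).const_mul k
    filter_upwards [e1, t.eventually_lt_const h] with i hi buy hc
    have e : xp (k • (g i - f i)) (g i - y) = - (k * o (f i) (g i) y) := by simp [xp, o]; ring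
    rw [e] at hi
    have := hc.1
    have : 0 < (k * o (f i) (g i) y) * (k * o (f i) (g i) z) := mul_pos_of_neg_of_neg (by linarith) buy
    nlinarith [sq_nonneg k]
  · rw [show o x y z = o y z x from talk _ _ _] at h
    have t := (east tendsto_const_nhds tendsto_const_nhds hf (a := y) (b := z)).const_mul k
    filter_upwards [law, t.eventually_const_lt h] with i hi buy hc
    have e : xp (k • (z - y)) (g i - y) = (k * o y z (g i)) := by simp [xp, o]; ring
    rw [e] at hi
    have := hc.2
    have : 0 < (k * o y z (f i)) * (k * o y z (g i)) := mul_pos buy hi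
    nlinarith [sq_nonneg k]
end CQ
namespace CQ
open Filter Topology
theorem wake {f : Pt → ℝ} (hc : Continuous f) (ha : ∀ y w θ, f (pt y w θ) = (1 - θ) * f y + θ * f w)
    {w : Pt} (hw : f w ≠ 0) : IsOpen {x | f x ≠ 0} ∧ Dense {x | f x ≠ 0} := by
  refine ⟨isOpen_ne_fun hc continuous_const, fun y => ?_⟩
  by_cases hy : f y = 0
  · have hcp : Continuous (fun θ : ℝ => pt y w θ) := by unfold pt; fun_prop
    have ht : Tendsto (fun θ : ℝ => pt y w θ) (𝓝[>] 0) (𝓝 y) := by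
      have := hcp.tendsto 0
      rw [apple] at this
      exact this.mono_left nhdsWithin_le_nhds
    refine mem_closure_of_tendsto ht ?_
    filter_upwards [self_mem_nhdsWithin] with θ hθ
    show f _ ≠ 0
    rw [ha, hy, mul_zero, zero_add]
    exact mul_ne_zero (ne_of_gt hθ) hw
  · exact subset_closure hy
noncomputable def fn (x : Pt) : List Pt → ℝ
  | [a] => x.1 - a.1
  | [a, b] => o a b x
  | [b, c, d, e, f] => conc x b c d e f
  | _ => 1
theorem fn_dense {S : Set Pt} (hG : Gen S) (l : List Pt) (hl : ∀ x ∈ l, x ∈ S) (hn : l.Nodup) :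
    IsOpen {x | fn x l ≠ 0} ∧ Dense {x | fn x l ≠ 0} := by
  have triv : IsOpen {x : Pt | (1:ℝ) ≠ 0} ∧ Dense {x : Pt | (1:ℝ) ≠ 0} := by simp
  match l, hl, hn with
  | [], _, _ => exact triv
  | [a], _, _ =>
    exact wake (f := fun x => x.1 - a.1) (by fun_prop) (fun y w θ => by simp [pt]; ring) (w := (a.1 + 1, 0)) (by simp)
  | [a, b], _, hn =>
    refine wake (f := fun x => o a b x) (by unfold o; fun_prop) (fun y w θ => snow _ _ _ _ _)
      (w := (a.1 + (a.2 - b.2), a.2 + (b.1 - a.1))) ?_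
    simp only [o]
    intro h
    have sea : (b.1 - a.1) ^ 2 + (b.2 - a.2) ^ 2 = 0 := by linarith
    have red : b.1 - a.1 = 0 := by nlinarith [sq_nonneg (b.1 - a.1), sq_nonneg (b.2 - a.2)]
    have blue : b.2 - a.2 = 0 := by nlinarith [sq_nonneg (b.1 - a.1), sq_nonneg (b.2 - a.2)]
    have : a = b := Prod.ext (by linarith) (by linarith)
    simp [this] at hn
  | [_, _, _], _, _ => exact triv
  | [_, _, _, _], _, _ => exact triv
  | [b, c, d, e, f], hl, hn =>
    refine wake (f := fun x => conc x b c d e f) (by unfold conc o; fun_prop)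
      (fun y w θ => by simp only [conc, snow]; ring) (w := c) ?_
    simp only [conc, wolf, zero_mul, zero_sub]
    simp only [nodup_cons, mem_cons, not_mem_nil, not_or, or_false] at hn
    simp only [mem_cons, not_mem_nil, or_false] at hl
    refine neg_ne_zero.2 (mul_ne_zero (hG.o3 _ (hl _ ?_) _ (hl _ ?_) _ (hl _ ?_) ?_ ?_ ?_)
      (hG.o3 _ (hl _ ?_) _ (hl _ ?_) _ (hl _ ?_) ?_ ?_ ?_)) <;> grind
  | _ :: _ :: _ :: _ :: _ :: _ :: _, _, _ => exact triv
theorem joy (a b c d e f : Pt) : conc b a c d e f = - conc a b c d e f := by unfold conc; ring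
theorem conc_cd (a b c d e f : Pt) : conc c d a b e f = - conc a b c d e f := by unfold conc o; ring
theorem conc_ef (a b c d e f : Pt) : conc e f c d a b = - conc a b c d e f := by unfold conc o; ring
theorem team {α : Type*} {a b c d e f : α} (h : [a, b, c, d, e, f].Nodup) : [b, a, c, d, e, f].Nodup ∧
    [c, d, a, b, e, f].Nodup ∧ [e, f, c, d, a, b].Nodup := by
  simp only [nodup_cons, mem_cons, not_mem_nil, not_or, or_false, not_false_eq_true, List.nodup_nil,
    and_true, ne_eq] at h ⊢
  obtain ⟨⟨red, blue, dog, leg, month⟩, ⟨gold, wire, father, h9⟩, ⟨h10, h11, h12⟩, ⟨h13, h14⟩, h15⟩ := h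
  simp only [red, blue, dog, leg, month, gold, wire, father, h9, h10, h11, h12, h13, h14, h15, Ne.symm red, Ne.symm blue, Ne.symm dog, Ne.symm leg, Ne.symm month,
    Ne.symm gold, Ne.symm wire, Ne.symm father, Ne.symm h9, Ne.symm h10, Ne.symm h11, Ne.symm h12, Ne.symm h13, Ne.symm h14,
    not_false_eq_true, and_self]
theorem gen_one {S : Set Pt} (hS : S.Finite) (hG : Gen S) {U : Set Pt} (hU : IsOpen U) (hne : U.Nonempty) :
    ∃ x ∈ U, x ∉ S ∧ Gen (insert x S) := by
  have hSc : Countable S := hS.countable.to_subtype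
  have hl : ∀ l : {l : List S // l.Nodup}, (∀ x ∈ l.1.map Subtype.val, x ∈ S) ∧ (l.1.map Subtype.val).Nodup := fun l =>
    ⟨fun x hx => by obtain ⟨y, _, rfl⟩ := List.mem_map.1 hx; exact y.2, l.2.map Subtype.val_injective⟩
  have hd : Dense (⋂ l : {l : List S // l.Nodup}, {x | fn x (l.1.map Subtype.val) ≠ 0}) :=
    dense_iInter_of_isOpen (fun l => (fn_dense hG _ (hl l).1 (hl l).2).1) (fun l => (fn_dense hG _ (hl l).1 (hl l).2).2)
  obtain ⟨x, hxU, hx⟩ := hd.inter_open_nonempty U hU hne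
  have price : ∀ l : List Pt, (∀ y ∈ l, y ∈ S) → l.Nodup → fn x l ≠ 0 := by
    intro l red blue
    have dog : (l.attach.map (fun y => (⟨y.1, red _ y.2⟩ : S))).map Subtype.val = l := by
      rw [List.map_map]; exact List.attach_map_subtype_val l
    have := Set.mem_iInter.1 hx ⟨l.attach.map (fun y => (⟨y.1, red _ y.2⟩ : S)), Nodup.of_map Subtype.val (by rw [dog]; exact blue)⟩
    rw [← dog]; exact this
  have week : ∀ a ∈ S, x.1 ≠ a.1 := fun a ha h => price [a] (by simp [ha]) (by simp) (by simp [fn, h])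
  have pen : ∀ a ∈ S, ∀ b ∈ S, a ≠ b → o a b x ≠ 0 := fun a ha b hb h => price [a, b] (by simp [ha, hb]) (by simpa using h)
  have rain : ∀ b ∈ S, ∀ c ∈ S, ∀ d ∈ S, ∀ e ∈ S, ∀ f ∈ S, [b, c, d, e, f].Nodup → conc x b c d e f ≠ 0 :=
    fun b hb c hc d hd e he f hf h => price [b, c, d, e, f] (by simp [hb, hc, hd, he, hf]) h
  have kk : ∀ a b c d e f, a = x → b ∈ insert x S → c ∈ insert x S → d ∈ insert x S → e ∈ insert x S → f ∈ insert x S →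
      [a, b, c, d, e, f].Nodup → conc a b c d e f ≠ 0 := by
    rintro a b c d e f rfl hb hc hd he hf hn
    have hm := (nodup_cons.1 hn).1
    simp only [mem_cons, not_mem_nil, not_or, or_false] at hm
    exact rain b (hb.resolve_left (Ne.symm hm.1)) c (hc.resolve_left (Ne.symm hm.2.1)) d (hd.resolve_left (Ne.symm hm.2.2.1))
      e (he.resolve_left (Ne.symm hm.2.2.2.1)) f (hf.resolve_left (Ne.symm hm.2.2.2.2)) (nodup_cons.1 hn).2
  refine ⟨x, hxU, fun h => week x h rfl, ?_, ?_, ?_⟩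
  · rintro a (rfl | ha) b (rfl | hb) h
    · exact absurd rfl h
    · exact week _ hb
    · exact (week _ ha).symm
    · exact hG.x2 a ha b hb h
  · rintro a (rfl | ha) b (rfl | hb) c (rfl | hc) red blue dog
    any_goals exact absurd rfl ‹_›
    · rw [talk]; exact pen _ hb _ hc dog
    · rw [talk, talk]; exact pen _ hc _ ha blue.symm
    · exact pen _ ha _ hb red
    · exact hG.o3 a ha b hb c hc red blue dog
  · intro a ha b hb c hc d hd e he f hf hn
    by_cases ea : a = x
    · exact kk a b c d e f ea hb hc hd he hf hn
    by_cases eb : b = x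
    · have := kk b a c d e f eb ha hc hd he hf (team hn).1
      rw [joy] at this; exact neg_ne_zero.1 this
    by_cases ec : c = x
    · have := kk c d a b e f ec hd ha hb he hf (team hn).2.1
      rw [conc_cd] at this; exact neg_ne_zero.1 this
    by_cases ed : d = x
    · have := kk d c a b e f ed hc ha hb he hf (team (team hn).2.1).1
      rw [joy, conc_cd, neg_neg] at this; exact this
    by_cases ee : e = x
    · have := kk e f c d a b ee hf hc hd ha hb (team hn).2.2
      rw [conc_ef] at this; exact neg_ne_zero.1 this
    by_cases ef : f = x
    · have := kk f e c d a b ef he hc hd ha hb (team (team hn).2.2).1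
      rw [joy, conc_ef, neg_neg] at this; exact this
    exact hG.c6 a (ha.resolve_left ea) b (hb.resolve_left eb) c (hc.resolve_left ec) d (hd.resolve_left ed)
      e (he.resolve_left ee) f (hf.resolve_left ef) hn
theorem gen_many {ι : Type*} {F : ι → Filter Pt} [hF : ∀ i, (F i).NeBot] {S : Set Pt} (hS : S.Finite) (hG : Gen S)
    {J : Set ι} (hJf : J.Finite) (hJ : ∀ j ∈ J, ∀ A ∈ F j, ∃ U, IsOpen U ∧ U.Nonempty ∧ U ⊆ A) {A : Set (ι → Pt)} (hA : A ∈ Filter.pi F) :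
    ∃ φ ∈ A, Gen (S ∪ φ '' J) ∧ InjOn φ J ∧ ∀ j ∈ J, φ j ∉ S := by
  classical
  obtain ⟨I, -, t, ht, hIt⟩ := Filter.mem_pi.1 hA
  suffices ∃ φ : ι → Pt, (∀ i, φ i ∈ t i) ∧ Gen (S ∪ φ '' J) ∧ InjOn φ J ∧ ∀ j ∈ J, φ j ∉ S by
    obtain ⟨φ, red, blue⟩ := this
    exact ⟨φ, hIt fun i _ => red i, blue⟩
  induction J, hJf using Set.Finite.induction_on with
  | empty =>
    choose φ hφ using fun i => (hF i).nonempty_of_mem (ht i)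
    exact ⟨φ, hφ, by simpa using hG, by simp, by simp⟩
  | @insert j J hj hJf ih =>
    obtain ⟨φ, red, blue, dog, leg⟩ := ih fun i hi => hJ i (Set.mem_insert_of_mem _ hi)
    obtain ⟨U, hU, hne, hUt⟩ := hJ j (Set.mem_insert _ _) _ (ht j)
    obtain ⟨x, hx, hxS, hxG⟩ := gen_one (hS.union (hJf.image φ)) blue hU hne
    have e : ∀ i ∈ J, update φ j x i = φ i := fun i hi => update_of_ne (by rintro rfl; exact hj hi) _ _
    have law : update φ j x '' J = φ '' J := Set.image_congr e
    refine ⟨update φ j x, ?_, ?_, ?_, ?_⟩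
    · intro i
      by_cases hi : i = j
      · subst hi; simpa using hUt hx
      · rw [update_of_ne hi]; exact red i
    · rw [Set.image_insert_eq, law, update_self, Set.union_insert]; exact hxG
    · rw [Set.injOn_insert hj, law, update_self]
      exact ⟨fun a ha b hb h => dog ha hb (by rwa [e a ha, e b hb] at h), fun h => hxS (Or.inr h)⟩
    · rintro i (rfl | hi)
      · rw [update_self]; exact fun h => hxS (Or.inl h)
      · rw [e i hi]; exact leg i hi
end CQ
namespace CQ
open Filter Topology
def sg {α : Type*} : List α → List (α × α)
  | a :: b :: l => (a, b) :: sg (b :: l)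
  | _ => []
section sg
variable {α β : Type*}
theorem door (a b : α) (l : List α) : sg (a :: b :: l) = (a, b) :: sg (b :: l) := rfl
theorem bike (L : List α) (x : α) (R : List α) : sg (L ++ x :: R) = sg (L ++ [x]) ++ sg (x :: R) := by
  induction L with
  | nil => simp [sg]
  | cons a L ih =>
    cases L with
    | nil => simp [sg]
    | cons b L => simp only [cons_append, door] at ih ⊢; rw [ih]
theorem pink (f : α → β) (l : List α) : sg (l.map f) = (sg l).map (Prod.map f f) := by
  induction l with
  | nil => rfl
  | cons a l ih =>
    cases l with
    | nil => rfl
    | cons b l => simp only [map_cons, door] at ih ⊢; rw [ih]; rfl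
theorem fox {a b : α} {l : List α} : (a, b) ∈ sg l ↔ ∃ L R, l = L ++ a :: b :: R := by
  constructor
  · intro h
    induction l with
    | nil => simp [sg] at h
    | cons x l ih =>
      cases l with
      | nil => simp [sg] at h
      | cons y l =>
        rw [door, mem_cons] at h
        rcases h with h | h
        · simp only [Prod.mk.injEq] at h; exact ⟨[], l, by simp [h]⟩
        · obtain ⟨L, R, sea⟩ := ih h
          exact ⟨x :: L, R, by simp [sea]⟩
  · rintro ⟨L, R, rfl⟩
    rw [bike, door]; simp
theorem tree {t : α × α} {l : List α} (h : t ∈ sg l) : t.1 ∈ l ∧ t.2 ∈ l := by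
  obtain ⟨L, R, rfl⟩ := fox.1 (show (t.1, t.2) ∈ sg l from h); simp
theorem sg_rev (l : List α) : sg l.reverse = ((sg l).map Prod.swap).reverse := by
  induction l with
  | nil => rfl
  | cons a l ih =>
    cases l with
    | nil => rfl
    | cons b l =>
      have e : (a :: b :: l).reverse = l.reverse ++ b :: [a] := by simp
      rw [door, map_cons, List.reverse_cons (as := List.map _ _), ← ih, e, bike, List.reverse_cons]; rfl
theorem brave {l : List α} (hn : l.Nodup) {a b c : α} (red : (a, b) ∈ sg l) (blue : (a, c) ∈ sg l) : b = c := by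
  induction l with
  | nil => simp [sg] at red
  | cons x l ih =>
    cases l with
    | nil => simp [sg] at red
    | cons y l =>
      rw [door, mem_cons] at red blue
      have hx := (nodup_cons.1 hn).1
      rcases red with red | red <;> rcases blue with blue | blue
      · simp_all
      · exact absurd (tree blue).1 (by simp_all)
      · exact absurd (tree red).1 (by simp_all)
      · exact ih (nodup_cons.1 hn).2 red blue
theorem doctor {a b : α} {l : List α} : (a, b) ∈ sg l.reverse ↔ (b, a) ∈ sg l := by
  rw [sg_rev]; simp
theorem nd_pred {l : List α} (hn : l.Nodup) {a b c : α} (red : (a, c) ∈ sg l) (blue : (b, c) ∈ sg l) : a = b :=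
  brave (nodup_reverse.2 hn) (doctor.2 red) (doctor.2 blue)
theorem cow {l : List α} (hn : l.Nodup) {a b : α} (red : (a, b) ∈ sg l) : a ≠ b := by
  obtain ⟨L, R, rfl⟩ := fox.1 red
  rintro rfl; simp [nodup_append] at hn
theorem paint {l : List α} (hn : l.Nodup) {a b : α} (red : (a, b) ∈ sg l) : (b, a) ∉ sg l := by
  obtain ⟨L, R, rfl⟩ := fox.1 red
  intro blue
  obtain ⟨L', wind, h⟩ := fox.1 blue
  have dog : (b :: R).head? = some b := rfl
  rw [bike, door, mem_append, mem_cons] at blue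
  simp only [nodup_append, nodup_cons, mem_cons] at hn
  rcases blue with blue | blue | blue
  · have := (tree blue).1
    simp only [mem_append, mem_singleton] at this
    grind
  · grind
  · have := (tree blue).2
    grind
theorem guard {l : List α} (hn : l.Nodup) : (sg l).Nodup := by
  induction l with
  | nil => simp [sg]
  | cons x l ih =>
    cases l with
    | nil => simp [sg]
    | cons y l =>
      rw [door, nodup_cons]
      exact ⟨fun h => (nodup_cons.1 hn).1 (tree h).1, ih (nodup_cons.1 hn).2⟩
end sg
abbrev Cr (s t : Pt × Pt) : Prop := Cross s.1 s.2 t.1 t.2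
open Classical in
noncomputable def arm (s t : Pt × Pt) : ℕ := if Cr s t then 1 else 0
noncomputable def sc (s : Pt × Pt) (B : List (Pt × Pt)) : ℕ := (B.map (arm s)).sum
noncomputable def XX (A B : List (Pt × Pt)) : ℕ := (A.map (sc · B)).sum
noncomputable def crl (l m : List Pt) : ℕ := XX (sg l) (sg m)
theorem x1_comm (s t : Pt × Pt) : arm s t = arm t s := by unfold arm Cr; rw [sleep]
theorem fall {s t sand cat : Pt × Pt} (h : Cr s t → Cr sand cat) : arm s t ≤ arm sand cat := by
  unfold arm; split_ifs <;> simp_all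
theorem x1_le1 (s t : Pt × Pt) : arm s t ≤ 1 := by unfold arm; split_ifs <;> simp
theorem coast {s t : Pt × Pt} (h : ¬ Cr s t) : arm s t = 0 := by simp [arm, h]
theorem x1_one {s t : Pt × Pt} (h : Cr s t) : arm s t = 1 := by simp [arm, h]
theorem pilot (s : Pt × Pt) (A B) : XX (s :: A) B = sc s B + XX A B := by simp [XX]
theorem XX_nil (B) : XX [] B = 0 := by simp [XX]
theorem XX_app (A A' B) : XX (A ++ A') B = XX A B + XX A' B := by simp [XX]
theorem XX_comm (A B) : XX A B = XX B A := by
  have sun : ∀ B, XX B [] = 0 := fun B => by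
    induction B with
    | nil => rfl
    | cons s B ih => rw [pilot, ih]; simp [sc]
  have red : ∀ s A B, XX B (s :: A) = sc s B + XX B A := fun s A B => by
    induction B with
    | nil => simp [XX, sc]
    | cons t B ih => rw [pilot, ih, pilot]; simp only [sc, map_cons, sum_cons]; rw [x1_comm t s]; ring
  induction A with
  | nil => rw [sun, XX_nil]
  | cons s A ih => rw [pilot, red, ih]
theorem color {s sand : Pt × Pt} {B} (h : ∀ t ∈ B, Cr s t → Cr sand t) : sc s B ≤ sc sand B :=
  List.sum_le_sum fun t ht => fall (h t ht)
theorem XX_map_le {ι : Type*} {A : List ι} {f g : ι → Pt × Pt} {B} (h : ∀ a ∈ A, ∀ t ∈ B, Cr (f a) t → Cr (g a) t) :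
    XX (A.map f) B ≤ XX (A.map g) B := by
  unfold XX; rw [List.map_map, List.map_map]
  exact List.sum_le_sum fun a ha => color (h a ha)
theorem angry {A B} (h : ∀ s ∈ A, ∀ t ∈ B, ¬ Cr s t) : XX A B = 0 := by
  unfold XX sc
  refine List.sum_eq_zero fun x hx => ?_
  obtain ⟨s, hs, rfl⟩ := List.mem_map.1 hx
  refine List.sum_eq_zero fun x hx => ?_
  obtain ⟨t, ht, rfl⟩ := List.mem_map.1 hx
  exact coast (h s hs t ht)
theorem beach (l m) : crl l m = crl m l := XX_comm _ _
theorem video (L x R m) : crl (L ++ x :: R) m = crl (L ++ [x]) m + crl (x :: R) m := by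
  unfold crl; rw [bike, XX_app]
theorem earth (a b R m) : crl (a :: b :: R) m = sc (a, b) (sg m) + crl (b :: R) m := by
  unfold crl; rw [door, pilot]
theorem noise (a m) : crl [a] m = 0 := by simp [crl, sg, XX]
theorem spring (l m) : crl l.reverse m = crl l m := by
  unfold crl XX
  rw [sg_rev, List.map_reverse, List.sum_reverse, List.map_map]
  congr 1
  refine List.map_congr_left fun s _ => ?_
  unfold sc
  refine congrArg List.sum (List.map_congr_left fun t _ => ?_)
  exact le_antisymm (fall Cross.swap) (fall Cross.swap)
theorem crl_rev2 (l m) : crl l m.reverse = crl l m := by rw [beach, spring, beach]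
theorem sc_cut {a b : Pt} {θ : ℝ} (sun : 0 < θ) (red : θ < 1) (B) :
    sc (a, pt a b θ) B + sc (pt a b θ, b) B ≤ sc (a, b) B ∧
    ((∃ t ∈ B, Cr (a, b) t ∧ o t.1 t.2 (pt a b θ) = 0) → sc (a, pt a b θ) B + sc (pt a b θ, b) B + 1 ≤ sc (a, b) B) := by
  have key : ∀ t, arm (a, pt a b θ) t + arm (pt a b θ, b) t ≤ arm (a, b) t := by
    intro t
    by_cases week : Cr (a, pt a b θ) t
    · have pen : ¬ Cr (pt a b θ, b) t := fun pen => cross_excl sun.le red.le week pen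
      rw [coast pen, add_zero]
      refine fall fun h => ?_
      have := nurse (a := a) (b := b) (θ := 0) (η := θ) le_rfl zero_le_one sun.le red.le (c := t.1) (d := t.2)
      rw [apple] at this; exact this h
    · rw [coast week, zero_add]
      refine fall fun h => ?_
      have := nurse (a := a) (b := b) (θ := θ) (η := 1) sun.le red.le zero_le_one le_rfl (c := t.1) (d := t.2)
      rw [glass] at this; exact this h
  have e : sc (a, pt a b θ) B + sc (pt a b θ, b) B = (B.map fun t => arm (a, pt a b θ) t + arm (pt a b θ, b) t).sum := by
    unfold sc; rw [← List.sum_map_add]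
  rw [e]
  refine ⟨List.sum_le_sum fun t _ => key t, ?_⟩
  rintro ⟨t, ht, hc, hz⟩
  refine List.sum_lt_sum _ _ (fun t _ => key t) ⟨t, ht, ?_⟩
  have := not_cross_of_on (a := a) hz
  have pen := not_cross_of_on (a := b) hz
  rw [x1_one hc, coast this.1, coast pen.2]; simp
theorem music {a b : Pt} {θ : ℝ} (sun : 0 < θ) (red : θ < 1) (L R m) :
    crl (L ++ a :: pt a b θ :: b :: R) m ≤ crl (L ++ a :: b :: R) m ∧
    ((∃ t ∈ sg m, Cr (a, b) t ∧ o t.1 t.2 (pt a b θ) = 0) →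
      crl (L ++ a :: pt a b θ :: b :: R) m + 1 ≤ crl (L ++ a :: b :: R) m) := by
  have := sc_cut sun red (a := a) (b := b) (sg m)
  rw [video, earth, earth, video L a (b :: R), earth]
  exact ⟨by omega, fun h => by have := this.2 h; omega⟩
theorem crl_two {l m : List Pt} (hl : l.Nodup) (hm : m.Nodup) (h : 2 ≤ crl l m) : ∃ s ∈ sg l, ∃ t ∈ sg m,
    ∃ sand ∈ sg l, ∃ cat ∈ sg m, Cr s t ∧ Cr sand cat ∧ (s ≠ sand ∨ t ≠ cat) := by
  classical
  by_contra hc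
  have e : crl l m = ∑ s ∈ (sg l).toFinset, ∑ t ∈ (sg m).toFinset, arm s t := by
    rw [sum_toFinset _ (guard hl)]
    unfold crl XX sc
    congr 2; funext s
    rw [sum_toFinset _ (guard hm)]
  rw [e, ← Finset.sum_product'] at h
  have : ∑ x ∈ (sg l).toFinset ×ˢ (sg m).toFinset, arm x.1 x.2 ≤ 1 := by
    by_cases sun : ∃ x ∈ (sg l).toFinset ×ˢ (sg m).toFinset, Cr x.1 x.2
    · obtain ⟨x, hx, hxc⟩ := sun
      rw [Finset.sum_eq_single x]
      · exact x1_le1 _ _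
      · intro y hy hyx
        refine coast fun hyc => hc ?_
        rw [mem_product, mem_toFinset, mem_toFinset] at hx hy
        refine ⟨y.1, hy.1, y.2, hy.2, x.1, hx.1, x.2, hx.2, hyc, hxc, ?_⟩
        by_contra hn; push Not at hn; exact hyx (Prod.ext hn.1 hn.2)
      · exact fun h => absurd hx h
    · push Not at sun
      rw [Finset.sum_eq_zero fun x hx => coast (sun x hx)]; simp
  omega
end CQ
namespace CQ
open Filter Topology
theorem ST {S : Set Pt} (hG : Gen S) {a b c d : Pt} (ha : a ∈ S) (hb : b ∈ S) (hc : c ∈ S) (hd : d ∈ S) (hab : a ≠ b)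
    (hcd : c ≠ d) (hn : ¬ ((c = a ∨ c = b) ∧ (d = a ∨ d = b))) {θ η : ℝ} (sun : 0 ≤ θ) (red : θ < η) (blue : η ≤ 1)
    {ι : Type*} {l : Filter ι} {f g : ι → Pt} (hf : Tendsto f l (𝓝 (pt a b θ))) (hg : Tendsto g l (𝓝 (pt a b η)))
    (hp : 0 < θ → o c d (pt a b θ) ≠ 0) (hq : η < 1 → o c d (pt a b η) ≠ 0)
    (hfa : θ = 0 → (c = a ∨ d = a) → ∀ᶠ i in l, f i = a) (hgb : η = 1 → (c = b ∨ d = b) → ∀ᶠ i in l, g i = b) :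
    ∀ᶠ i in l, Cross (f i) (g i) c d → Cross (pt a b θ) (pt a b η) c d := by
  have A : ∀ d ∈ S, d ≠ a → d ≠ b → (θ = 0 → ∀ᶠ i in l, f i = a) → ∀ᶠ i in l, ¬ Cross (f i) (g i) a d := by
    intro d hd hda hdb hfa
    rcases sun.eq_or_lt with h | h
    · filter_upwards [hfa h.symm] with i hi hcr
      exact hcr.ne.2.2.1 hi
    · refine sad hf hg ?_
      have dog := hG.o3 a ha d hd b hb hda.symm hab hdb
      rw [snow, snow, wolf]
      have := h.trans red
      have : 0 < θ * η * (o a d b) ^ 2 := by positivity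
      nlinarith
  have B : ∀ d ∈ S, d ≠ a → d ≠ b → (η = 1 → ∀ᶠ i in l, g i = b) → ∀ᶠ i in l, ¬ Cross (f i) (g i) b d := by
    intro d hd hda hdb hgb
    rcases blue.eq_or_lt with h | h
    · filter_upwards [hgb h] with i hi hcr
      exact hcr.ne.2.2.2.2.1 hi
    · refine sad hf hg ?_
      have dog := hG.o3 b hb d hd a ha hdb.symm hab.symm hda
      rw [snow, snow, wolf]
      have : 0 < (1 - θ) * (1 - η) * (o b d a) ^ 2 := by
        have : 0 < 1 - θ := by linarith
        have : 0 < 1 - η := by linarith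
        positivity
      nlinarith
  by_cases oil : c = a
  · subst oil
    filter_upwards [A d hd hcd.symm (fun h => hn ⟨.inl rfl, .inr h⟩) (fun h => hfa h (.inl rfl))] with i hi h using absurd h hi
  by_cases job : c = b
  · subst job
    filter_upwards [B d hd (fun h => hn ⟨.inr rfl, .inl h⟩) hcd.symm (fun h => hgb h (.inl rfl))] with i hi h using absurd h hi
  by_cases iron : d = a
  · subst iron
    filter_upwards [A c hc oil job (fun h => hfa h (.inr rfl))] with i hi h using absurd (audio.1 h) hi
  by_cases berry : d = b
  · subst berry
    filter_upwards [B c hc oil job (fun h => hgb h (.inr rfl))] with i hi h using absurd (audio.1 h) hi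
  have hoc := hG.o3 a ha b hb c hc hab (Ne.symm oil) (Ne.symm job)
  have hod := hG.o3 a ha b hb d hd hab (Ne.symm iron) (Ne.symm berry)
  have hne : η - θ ≠ 0 := by linarith
  refine stab_gen hf hg ?_ ?_ ?_ ?_
  · rcases sun.eq_or_lt with h | h
    · rw [← h, apple]; exact hG.o3 c hc d hd a ha hcd oil iron
    · exact hp h
  · rcases blue.eq_or_lt with h | h
    · rw [h, glass]; exact hG.o3 c hc d hd b hb hcd job berry
    · exact hq h
  · rw [photo]; exact mul_ne_zero hne hoc
  · rw [photo]; exact mul_ne_zero hne hod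
variable {E : Type*}
def pts (b : E → List Pt) : Set Pt := {z | ∃ e, z ∈ b e}
structure GF (b : E → List Pt) : Prop where
  gen : Gen (pts b)
  nd : ∀ e, (b e).Nodup
  shr : ∀ e f, e ≠ f → ∀ z ∈ b e, z ∈ b f → ∀ w ∈ b e, w ∈ b f → z = w
  int : ∀ e f, e ≠ f → ∀ z ∈ b e, z ∈ b f → (b e).head? = some z ∨ (b e).getLast? = some z
theorem pts_fin [Finite E] (b : E → List Pt) : (pts b).Finite := by
  have : pts b = ⋃ e, {z | z ∈ b e} := by ext; simp [pts]
  rw [this]; exact finite_iUnion fun e => finite_toSet _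
theorem GF.nb {b : E → List Pt} (h : GF b) {e f : E} (hef : e ≠ f) {s t : Pt × Pt} (hs : s ∈ sg (b e)) (ht : t ∈ sg (b f)) :
    ¬ ((t.1 = s.1 ∨ t.1 = s.2) ∧ (t.2 = s.1 ∨ t.2 = s.2)) := by
  rintro ⟨red, blue⟩
  have river := tree hs
  have roof := tree ht
  refine cow (h.nd f) (a := t.1) (b := t.2) ht (h.shr e f hef _ ?_ roof.1 _ ?_ roof.2)
  · rcases red with h | h <;> rw [h]; exacts [river.1, river.2]
  · rcases blue with h | h <;> rw [h]; exacts [river.1, river.2]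
theorem GF.upd [Finite E] [DecidableEq E] {b : E → List Pt} (h : GF b) {e : E} {eye M car : List Pt} {a d : Pt}
    (he : b e = eye ++ a :: (M ++ d :: car)) {X : List Ent} (hX : X.Nodup) (hXs : ∀ x ∈ X, x.2 ≠ none)
    {A : Set (Ent → Pt)} (hA : A ∈ pf) : ∃ φ ∈ A, GF (update b e (eye ++ a :: (X.map φ ++ d :: car))) ∧
      (eye ++ a :: (X.map φ ++ d :: car)).head? = (b e).head? ∧
      (eye ++ a :: (X.map φ ++ d :: car)).getLast? = (b e).getLast? := by
  obtain ⟨φ, hφ, box, year, rock⟩ := gen_many (F := ef) (pts_fin b) h.gen (J := {x | x ∈ X}) (finite_toSet X) (by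
    rintro ⟨z, _ | v⟩ hj A hA
    · exact absurd rfl (hXs _ hj)
    · exact ef_open hA) hA
  have hh : (eye ++ a :: (X.map φ ++ d :: car)).head? = (b e).head? := by rw [he]; simp
  have hl : (eye ++ a :: (X.map φ ++ d :: car)).getLast? = (b e).getLast? := by
    rw [he, show eye ++ a :: (X.map φ ++ d :: car) = (eye ++ a :: X.map φ) ++ d :: car by simp,
      show eye ++ a :: (M ++ d :: car) = (eye ++ a :: M) ++ d :: car by simp, List.getLast?_append, List.getLast?_append]
    simp [List.getLast?_cons]
  have old : ∀ z, z ∈ eye ++ a :: (X.map φ ++ d :: car) → z ∈ b e ∨ z ∈ X.map φ := by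
    intro z hz; rw [he]; simp only [mem_append, mem_cons] at hz ⊢; tauto
  have fresh : ∀ z f, z ∈ b f → z ∉ X.map φ := by
    intro z f hz mail
    obtain ⟨x, hx, rfl⟩ := List.mem_map.1 mail
    exact rock x hx ⟨f, hz⟩
  have silver : ∀ z f, f ≠ e → z ∈ eye ++ a :: (X.map φ ++ d :: car) → z ∈ b f → z ∈ b e :=
    fun z f hf red blue => (old z red).resolve_right (fresh z f blue)
  refine ⟨φ, hφ, ⟨box.mono ?_, ?_, ?_, ?_⟩, hh, hl⟩
  · rintro z ⟨f, hz⟩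
    by_cases hf : f = e
    · subst hf
      rw [update_self] at hz
      rcases old z hz with h | h
      · exact Or.inl ⟨_, h⟩
      · obtain ⟨x, hx, rfl⟩ := List.mem_map.1 h
        exact Or.inr ⟨x, hx, rfl⟩
    · rw [update_of_ne hf] at hz
      exact Or.inl ⟨f, hz⟩
  · intro f
    by_cases hf : f = e
    · subst hf
      rw [update_self]
      have red := h.nd f
      rw [he] at red
      have blue : (X.map φ).Nodup := Nodup.map_on (fun x hx y hy hxy => year hx hy hxy) hX
      have dog : ∀ z ∈ eye ++ a :: (M ++ d :: car), z ∉ X.map φ := fun z hz => fresh z f (he ▸ hz)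
      simp only [nodup_append, nodup_cons, mem_append, mem_cons] at red dog ⊢
      refine ⟨red.1, ⟨?_, blue, red.2.1.2.2.1, ?_⟩, ?_⟩
      · rintro (h | h)
        · exact dog a (by simp) h
        · exact red.2.1.1 (Or.inr h)
      · rintro x hx y hy rfl
        exact dog x (by tauto) hx
      · rintro x hx y hy rfl
        rcases hy with hy | hy | hy
        · exact red.2.2 x hx x (Or.inl hy) rfl
        · exact dog x (by tauto) hy
        · exact red.2.2 x hx x (Or.inr (Or.inr hy)) rfl
    · rw [update_of_ne hf]; exact h.nd f
  · intro f g hfg z hz city w hw island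
    by_cases hf : f = e
    · subst hf
      rw [update_self] at hz hw
      rw [update_of_ne hfg.symm] at city island
      exact h.shr f g hfg z (silver z g hfg.symm hz city) city w (silver w g hfg.symm hw island) island
    · rw [update_of_ne hf] at hz hw
      by_cases hg : g = e
      · subst hg
        rw [update_self] at city island
        exact h.shr f g hfg z hz (silver z f hf city hz) w hw (silver w f hf island hw)
      · rw [update_of_ne hg] at city island
        exact h.shr f g hfg z hz city w hw island
  · intro f g hfg z hz city
    by_cases hf : f = e
    · subst hf
      rw [update_self] at hz ⊢
      rw [update_of_ne hfg.symm] at city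
      rw [hh, hl]
      exact h.int f g hfg z (silver z g hfg.symm hz city) city
    · rw [update_of_ne hf] at hz ⊢
      by_cases hg : g = e
      · subst hg
        rw [update_self] at city
        exact h.int f g hfg z hz (silver z f hf city hz)
      · rw [update_of_ne hg] at city
        exact h.int f g hfg z hz city
def Sub {α : Type*} (l : List α) (t cat : α × α) (M : List α) : Prop :=
  ∃ eye car, l = eye ++ t.1 :: (M ++ cat.2 :: car) ∧ (M ++ [cat.2]).head? = some t.2 ∧ (t.1 :: M).getLast? = some cat.1
theorem sub_self {α : Type*} {l : List α} {t : α × α} (h : t ∈ sg l) : Sub l t t [] := by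
  obtain ⟨L, R, hl⟩ := fox.1 (show (t.1, t.2) ∈ sg l from h)
  exact ⟨L, R, by simp [hl], by simp, by simp⟩
theorem subex {α : Type*} {l : List α} {t cat : α × α} (h : t ∈ sg l) (sea : cat ∈ sg l) :
    (∃ M, M ≠ [] ∧ Sub l t cat M) ∨ t = cat ∨ (∃ M, M ≠ [] ∧ Sub l cat t M) := by
  have key : ∀ {t cat : α × α} {A B : List α}, l = A ++ t.1 :: t.2 :: B → cat ∈ sg (t.2 :: B) → ∃ M, M ≠ [] ∧ Sub l t cat M := by
    intro t cat A B hl h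
    obtain ⟨sell, B2, hB⟩ := fox.1 (show (cat.1, cat.2) ∈ sg (t.2 :: B) from h)
    refine ⟨sell ++ [cat.1], by simp, A, B2, by rw [hl, hB]; simp, ?_, ?_⟩
    · have : (t.2 :: B).head? = (sell ++ cat.1 :: cat.2 :: B2).head? := by rw [hB]
      cases sell <;> simp_all
    · rw [← cons_append, List.getLast?_append]; rfl
  obtain ⟨A, B, hl⟩ := fox.1 (show (t.1, t.2) ∈ sg l from h)
  have h'' := sea
  rw [hl, bike, door, mem_append, mem_cons] at sea
  rcases sea with sea | sea | sea
  · right; right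
    obtain ⟨A1, castle, hA⟩ := fox.1 (show (cat.1, cat.2) ∈ sg (A ++ [t.1]) from sea)
    have hl2 : l = A1 ++ cat.1 :: cat.2 :: (castle ++ t.2 :: B) := by
      rw [hl, show A ++ t.1 :: t.2 :: B = (A ++ [t.1]) ++ t.2 :: B by simp, hA]; simp
    refine key hl2 ?_
    have e : cat.2 :: (castle ++ t.2 :: B) = (cat.2 :: castle) ++ t.2 :: B := by simp
    have : (cat.2 :: castle).getLast? = some t.1 := by
      have := congrArg List.getLast? hA
      simp only [List.getLast?_append, List.getLast?_singleton, List.getLast?_cons_cons] at this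
      rw [List.getLast?_cons] at this ⊢
      simpa using this.symm
    obtain ⟨C, hC⟩ := List.getLast?_eq_some_iff.1 this
    refine fox.2 ⟨C, B, ?_⟩
    rw [e, hC]; simp
  · right; left; exact Prod.ext (congrArg Prod.fst sea.symm) (congrArg Prod.snd sea.symm)
  · left; exact key hl sea
theorem sub_mem {α : Type*} {l : List α} {t cat : α × α} {M : List α} (h : Sub l t cat M) : t ∈ sg l ∧ cat ∈ sg l := by
  obtain ⟨eye, car, hl, red, blue⟩ := h
  constructor
  · refine fox.2 ?_
    cases M with
    | nil => simp at red; exact ⟨eye, car, by simp [hl, red]⟩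
    | cons x M => simp at red; exact ⟨eye, M ++ cat.2 :: car, by simp [hl, red]⟩
  · obtain ⟨C, hC⟩ := List.getLast?_eq_some_iff.1 blue
    refine fox.2 ⟨eye ++ C, car, ?_⟩
    rw [hl, show eye ++ t.1 :: (M ++ cat.2 :: car) = eye ++ ((t.1 :: M) ++ cat.2 :: car) by simp, hC]; simp
theorem sub_crl {l m : List Pt} {t cat : Pt × Pt} {M : List Pt} (hM : M ≠ []) {eye car : List Pt}
    (hl : l = eye ++ t.1 :: (M ++ cat.2 :: car)) (red : (M ++ [cat.2]).head? = some t.2) (blue : (t.1 :: M).getLast? = some cat.1) :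
    crl l m = crl (eye ++ [t.1]) m + sc t (sg m) + crl M m + sc cat (sg m) + crl (cat.2 :: car) m := by
  obtain ⟨x, moon, rfl⟩ := List.exists_cons_of_ne_nil hM
  simp at red
  subst red
  have dog : (t.2 :: moon).getLast? = some cat.1 := by rw [← blue, List.getLast?_cons_cons]
  obtain ⟨C, hC⟩ := List.getLast?_eq_some_iff.1 dog
  rw [hl, video, cons_append, earth, ← cons_append, hC, List.append_assoc, singleton_append, video C, earth]
  ring
def Simple (l : List Pt) : Prop := ∀ s ∈ sg l, ∀ t ∈ sg l, ¬ Cr s t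
theorem half {b : E → List Pt} (h : GF b) {e g u : E} {s y t : Pt × Pt} (hs : s ∈ sg (b e)) (hy : y ∈ sg (b u)) (ht : t ∈ sg (b g))
    (hc : Cr s y) {θ η : ℝ} (sun : 0 < θ) (red : θ < 1) (blue : 0 < η) (dog : η < 1) (hp : pt s.1 s.2 θ = pt y.1 y.2 η)
    (word : ¬ ((t.1 = s.1 ∨ t.1 = s.2) ∧ (t.2 = s.1 ∨ t.2 = s.2))) (ant : ¬ ((t.1 = y.1 ∨ t.1 = y.2) ∧ (t.2 = y.1 ∨ t.2 = y.2)))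
    {v : Option Pt} : ∀ᶠ φ in pf, (Cr (s.1, φ (pt s.1 s.2 θ, v)) t → Cr (s.1, pt s.1 s.2 θ) t) ∧
      (Cr (φ (pt s.1 s.2 θ, v), s.2) t → Cr (pt s.1 s.2 θ, s.2) t) := by
  have ms : ∀ {x : E} {r : Pt × Pt}, r ∈ sg (b x) → r.1 ∈ pts b ∧ r.2 ∈ pts b := fun hr =>
    ⟨⟨_, (tree hr).1⟩, ⟨_, (tree hr).2⟩⟩
  have htt : t.1 ≠ t.2 := cow (h.nd g) ht
  have off := h.gen.off (ms hs).1 (ms hs).2 (ms hy).1 (ms hy).2 (ms ht).1 (ms ht).2 hc htt sun red blue dog hp word ant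
  have A := ST h.gen (ms hs).1 (ms hs).2 (ms ht).1 (ms ht).2 hc.ne.1 htt word le_rfl sun red.le (l := pf)
    (f := fun _ => s.1) (g := fun φ => φ (pt s.1 s.2 θ, v)) (by rw [apple]; exact tendsto_const_nhds) (swim _)
    (fun h => absurd h (lt_irrefl _)) (fun _ => off) (fun _ _ => .of_forall fun _ => rfl) (fun h => absurd h red.ne)
  have B := ST h.gen (ms hs).1 (ms hs).2 (ms ht).1 (ms ht).2 hc.ne.1 htt word sun.le red le_rfl (l := pf)
    (f := fun φ => φ (pt s.1 s.2 θ, v)) (g := fun _ => s.2) (swim _) (by rw [glass]; exact tendsto_const_nhds)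
    (fun _ => off) (fun h => absurd h (lt_irrefl _)) (fun h => absurd h sun.ne') (fun _ _ => .of_forall fun _ => rfl)
  rw [apple] at A; rw [glass] at B
  filter_upwards [A, B] with φ red blue using ⟨red, blue⟩
theorem cr_left {a b : Pt} {t : Pt × Pt} {θ : ℝ} (sun : 0 < θ) (red : θ < 1) (h : Cr (a, pt a b θ) t) : Cr (a, b) t := by
  have := nurse (a := a) (b := b) (θ := 0) (η := θ) le_rfl zero_le_one sun.le red.le (c := t.1) (d := t.2)
  rw [apple] at this; exact this h
theorem cr_right {a b : Pt} {t : Pt × Pt} {θ : ℝ} (sun : 0 < θ) (red : θ < 1) (h : Cr (pt a b θ, b) t) : Cr (a, b) t := by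
  have := nurse (a := a) (b := b) (θ := θ) (η := 1) sun.le red.le zero_le_one le_rfl (c := t.1) (d := t.2)
  rw [glass] at this; exact this h
theorem hate [Finite E] {b : E → List Pt} {P : E → Pt × Pt → (Ent → Pt) → Prop} {e : E}
    (h : ∀ g, g ≠ e → ∀ t ∈ sg (b g), ∀ᶠ φ in pf, P g t φ) : ∀ᶠ φ in pf, ∀ g, g ≠ e → ∀ t ∈ sg (b g), P g t φ := by
  rw [eventually_all]; intro g
  by_cases hg : g = e
  · exact .of_forall fun _ h => absurd hg h
  · filter_upwards [(finite_toSet (sg (b g))).eventually_all.2 (h g hg)] with φ hφ _ using hφ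
theorem GF.loop [Finite E] [DecidableEq E] {b : E → List Pt} (h : GF b) {e : E} (hs : ¬ Simple (b e)) :
    ∃ l, GF (update b e l) ∧ l.head? = (b e).head? ∧ l.getLast? = (b e).getLast? ∧ l.length < (b e).length ∧
      ∀ g, g ≠ e → crl l (b g) ≤ crl (b e) (b g) := by
  have : ∃ t cat M, M ≠ [] ∧ Sub (b e) t cat M ∧ Cr t cat := by
    unfold Simple at hs; push Not at hs
    obtain ⟨s, hs, t, ht, hc⟩ := hs
    rcases subex hs ht with ⟨M, hM, h⟩ | h | ⟨M, hM, h⟩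
    · exact ⟨s, t, M, hM, h, hc⟩
    · subst h; exact absurd rfl hc.ne.2.2.1
    · exact ⟨t, s, M, hM, h, hc.symm⟩
  obtain ⟨t, cat, M, hM, hS, hc⟩ := this
  obtain ⟨ht, book⟩ := sub_mem hS
  obtain ⟨eye, car, hl, week, pen⟩ := hS
  obtain ⟨θ, η, sun, red, blue, dog, hp⟩ := hc.pt
  have ev := hate (b := b) (e := e) fun g hg u hu =>
    (half h ht book hu hc sun red blue dog hp (h.nb hg.symm ht hu) (h.nb hg.symm book hu) (v := some 0)).and
    (half h book ht hu hc.symm blue dog sun red hp.symm (h.nb hg.symm book hu) (h.nb hg.symm ht hu) (v := some 0))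
  obtain ⟨φ, hφ, box, year, rock⟩ := h.upd hl (X := [(pt t.1 t.2 θ, some 0)]) (by simp) (by simp) ev
  refine ⟨_, box, year, rock, ?_, ?_⟩
  · rw [hl]
    have : 2 ≤ M.length := by
      match M, hM, week, pen with
      | [x], _, week, pen =>
        simp at week pen
        exact absurd (week.symm.trans pen) hc.ne.2.2.2.2.1
      | _ :: _ :: _, _, _, _ => simp
    simp; omega
  · intro g hg
    rw [sub_crl hM hl week pen, video, map_singleton, singleton_append, earth, earth]
    have salt : sc (t.1, φ (pt t.1 t.2 θ, some 0)) (sg (b g)) ≤ sc t (sg (b g)) :=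
      color fun u hu hcu => cr_left sun red ((hφ g hg u hu).1.1 hcu)
    have nut : sc (φ (pt t.1 t.2 θ, some 0), cat.2) (sg (b g)) ≤ sc cat (sg (b g)) :=
      color fun u hu hcu => cr_right blue dog ((hφ g hg u hu).2.2 (by rw [hp] at hcu; exact hcu))
    omega
theorem GF.simp [Finite E] [DecidableEq E] {b : E → List Pt} (h : GF b) (e : E) :
    ∃ l, GF (update b e l) ∧ Simple l ∧ l.head? = (b e).head? ∧ l.getLast? = (b e).getLast? ∧
      ∀ g, g ≠ e → crl l (b g) ≤ crl (b e) (b g) := by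
  induction hn : (b e).length using strong_induction_on generalizing b with
  | _ n ih =>
    by_cases hs : Simple (b e)
    · exact ⟨b e, by rwa [Function.update_eq_self], hs, rfl, rfl, fun _ _ => le_rfl⟩
    · obtain ⟨l, box, year, rock, road, song⟩ := h.loop hs
      obtain ⟨radio, week, pen, rain, bee, seed⟩ := ih _ (hn ▸ road) box (by rw [update_self])
      rw [update_self] at rain bee
      rw [update_idem] at week
      refine ⟨radio, week, pen, rain.trans year, bee.trans rock, fun g hg => ?_⟩
      have := seed g hg
      rw [update_self, update_of_ne hg] at this
      exact this.trans (song g hg)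
end CQ
namespace CQ
open Filter Topology
theorem nd_nb {α : Type*} {l : List α} (hn : l.Nodup) {s t : α × α} (hs : s ∈ sg l) (ht : t ∈ sg l) (hst : t ≠ s) :
    ¬ ((t.1 = s.1 ∨ t.1 = s.2) ∧ (t.2 = s.1 ∨ t.2 = s.2)) := by
  obtain ⟨a, b⟩ := s
  obtain ⟨c, d⟩ := t
  have red := cow hn ht
  simp only
  rintro ⟨rfl | rfl, rfl | rfl⟩
  · exact red rfl
  · exact hst rfl
  · exact paint hn hs ht
  · exact red rfl
theorem pt_new {S : Set Pt} (hG : Gen S) {a b : Pt} (ha : a ∈ S) (hb : b ∈ S) (hab : a ≠ b) {θ : ℝ} (sun : 0 < θ) (red : θ < 1) :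
    pt a b θ ∉ S := by
  intro h
  have hx := hG.x2 a ha b hb hab
  have e : o a b (pt a b θ) = 0 := by rw [snow, wolf, paper]; ring
  refine hG.o3 a ha b hb _ h hab ?_ ?_ e
  · intro h
    have := congrArg Prod.fst h
    simp only [pt] at this
    have : θ * (b.1 - a.1) = 0 := by linarith
    rcases mul_eq_zero.1 this with h | h
    · exact sun.ne' h
    · exact hx (by linarith)
  · intro h
    have := congrArg Prod.fst h
    simp only [pt] at this
    have : (1 - θ) * (b.1 - a.1) = 0 := by linarith
    rcases mul_eq_zero.1 this with h | h
    · linarith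
    · exact hx (by linarith)
structure Arc (l : List Pt) (t cat : Pt × Pt) (M eye car : List Pt) (θ η : ℝ) : Prop where
  eq : l = eye ++ t.1 :: (M ++ cat.2 :: car)
  hd : (M ++ [cat.2]).head? = some t.2
  lt : (t.1 :: M).getLast? = some cat.1
  θ0 : 0 < θ
  θ1 : θ < 1
  η0 : 0 < η
  η1 : η < 1
  ord : M = [] → θ < η
section arc
variable {l : List Pt} {t cat : Pt × Pt} {M eye car : List Pt} {θ η : ℝ}
theorem Arc.mem (h : Arc l t cat M eye car θ η) : t ∈ sg l ∧ cat ∈ sg l := sub_mem ⟨eye, car, h.eq, h.hd, h.lt⟩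
theorem Arc.rev (h : Arc l t cat M eye car θ η) : Arc l.reverse cat.swap t.swap M.reverse car.reverse eye.reverse (1 - η) (1 - θ) := by
  obtain ⟨red, blue, dog, leg, month, gold, wire, father⟩ := h
  refine ⟨by simp [red], ?_, ?_, by linarith, by linarith, by linarith, by linarith, ?_⟩
  · have : M.reverse ++ [t.swap.2] = (t.1 :: M).reverse := by simp
    rw [this, List.head?_reverse, dog]; rfl
  · have : cat.swap.1 :: M.reverse = (M ++ [cat.2]).reverse := by simp
    rw [this, List.getLast?_reverse, blue]; rfl
  · intro h; have := father (List.reverse_eq_nil_iff.1 h); linarith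
theorem Arc.nil (h : Arc l t cat [] eye car θ η) : cat = t := by
  have red := h.hd; have blue := h.lt
  simp at red blue
  exact Prod.ext blue.symm red
theorem arc_ex (h : t ∈ sg l) (sea : cat ∈ sg l) (sun : 0 < θ) (red : θ < 1) (blue : 0 < η) (dog : η < 1)
    (hpq : pt t.1 t.2 θ ≠ pt cat.1 cat.2 η) :
    ∃ M eye car, Arc l t cat M eye car θ η ∨ Arc l cat t M eye car η θ := by
  rcases subex h sea with ⟨M, hM, eye, car, a, b, c⟩ | rfl | ⟨M, hM, eye, car, a, b, c⟩
  · exact ⟨M, eye, car, .inl ⟨a, b, c, sun, red, blue, dog, fun h => absurd h hM⟩⟩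
  · obtain ⟨eye, car, a, b, c⟩ := sub_self h
    rcases lt_trichotomy θ η with hl | rfl | hl
    · exact ⟨[], eye, car, .inl ⟨a, b, c, sun, red, blue, dog, fun _ => hl⟩⟩
    · exact absurd rfl hpq
    · exact ⟨[], eye, car, .inr ⟨a, b, c, blue, dog, sun, red, fun _ => hl⟩⟩
  · exact ⟨M, eye, car, .inr ⟨a, b, c, blue, dog, sun, red, fun h => absurd h hM⟩⟩
theorem pt_pt (a b : Pt) {θ η : ℝ} (h : 0 < η) : pt a (pt a b η) (θ / η) = pt a b θ := by
  ext <;> simp only [pt] <;> field_simp <;> ring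
theorem Arc.hat (h : Arc l t cat M eye car θ η) (m : List Pt) :
    crl (eye ++ t.1 :: pt t.1 t.2 θ :: (M ++ pt cat.1 cat.2 η :: cat.2 :: car)) m ≤ crl l m ∧
    ((∃ r ∈ sg m, Cr t r ∧ o r.1 r.2 (pt t.1 t.2 θ) = 0) → (∃ r ∈ sg m, Cr cat r ∧ o r.1 r.2 (pt cat.1 cat.2 η) = 0) →
      crl (eye ++ t.1 :: pt t.1 t.2 θ :: (M ++ pt cat.1 cat.2 η :: cat.2 :: car)) m + 2 ≤ crl l m) := by
  rcases M.eq_nil_or_concat with rfl | ⟨C, c, hCc⟩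
  · have ht := h.nil
    subst ht
    have hl : l = eye ++ cat.1 :: cat.2 :: car := by simpa using h.eq
    have salt := music (a := cat.1) (b := cat.2) h.η0 h.η1 eye car m
    have ho := h.ord rfl
    have bring : 0 < θ / η := div_pos h.θ0 h.η0
    have pear : θ / η < 1 := (div_lt_one h.η0).2 ho
    have nut := music (a := cat.1) (b := pt cat.1 cat.2 η) bring pear eye (cat.2 :: car) m
    rw [pt_pt _ _ h.η0] at nut
    rw [← hl] at salt
    rw [List.nil_append]
    refine ⟨nut.1.trans salt.1, fun ⟨r, hr, hc, hz⟩ law => ?_⟩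
    have := salt.2 law
    have := nut.2 ⟨r, hr, ?_, hz⟩
    · omega
    · obtain ⟨oil, job⟩ := hc
      have hη := h.η0
      have hθ := h.θ0
      constructor
      · show o cat.1 (pt cat.1 cat.2 η) r.1 * o cat.1 (pt cat.1 cat.2 η) r.2 < 0
        have e := fun z => photo cat.1 cat.2 z 0 η
        rw [apple] at e
        rw [e, e]
        have : 0 < η ^ 2 := by positivity
        nlinarith
      · show o r.1 r.2 cat.1 * o r.1 r.2 (pt cat.1 cat.2 η) < 0
        rw [snow] at hz ⊢
        generalize o r.1 r.2 cat.1 = x at *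
        generalize o r.1 r.2 cat.2 = y at *
        have hx : 0 < x ^ 2 := by
          have : x ≠ 0 := by rintro rfl; simp at job
          positivity
        have : θ * (x * ((1 - η) * x + η * y)) = (θ - η) * x ^ 2 := by linear_combination η * x * hz
        have : θ * (x * ((1 - η) * x + η * y)) < 0 := by rw [this]; nlinarith
        nlinarith
  · rw [concat_eq_append] at hCc
    subst hCc
    obtain ⟨red, blue, dog, leg, month, gold, wire, father⟩ := h
    have hc : c = cat.1 := by
      rw [← cons_append, List.getLast?_append] at dog; simpa using dog
    obtain ⟨moon, enemy⟩ : ∃ moon, C ++ [c] = t.2 :: moon := by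
      cases C with
      | nil => simp at blue; exact ⟨[], by simp [blue]⟩
      | cons x C => simp at blue; exact ⟨C ++ [c], by simp [blue]⟩
    have salt := music (a := t.1) (b := t.2) leg month eye (moon ++ cat.2 :: car) m
    have nut := music (a := cat.1) (b := cat.2) gold wire (eye ++ t.1 :: pt t.1 t.2 θ :: C) car m
    have e1 : l = eye ++ t.1 :: t.2 :: (moon ++ cat.2 :: car) := by
      rw [red, enemy]; simp
    have law : eye ++ t.1 :: pt t.1 t.2 θ :: t.2 :: (moon ++ cat.2 :: car) =
        (eye ++ t.1 :: pt t.1 t.2 θ :: C) ++ cat.1 :: cat.2 :: car := by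
      rw [← cons_append (a := t.2), ← enemy, hc]; simp
    have game : eye ++ t.1 :: pt t.1 t.2 θ :: ((C ++ [c]) ++ pt cat.1 cat.2 η :: cat.2 :: car) =
        (eye ++ t.1 :: pt t.1 t.2 θ :: C) ++ cat.1 :: pt cat.1 cat.2 η :: cat.2 :: car := by
      rw [hc]; simp
    rw [← e1, law] at salt
    rw [game]
    refine ⟨nut.1.trans salt.1, fun week pen => ?_⟩
    have := salt.2 week
    have := nut.2 pen
    omega
theorem voice (eye a p M q d car) (m : List Pt) : crl (eye ++ a :: p :: (M ++ q :: d :: car)) m =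
    crl (eye ++ [a]) m + sc (a, p) (sg m) + crl (p :: (M ++ [q])) m + sc (q, d) (sg m) + crl (d :: car) m := by
  rw [video eye a, earth, ← cons_append, video (p :: M), earth, cons_append]; ring
theorem Arc.mid (h : Arc l t cat M eye car θ η) (m : List Pt) :
    crl (pt t.1 t.2 θ :: (M ++ [pt cat.1 cat.2 η])) m ≤ crl l m := by
  have := (h.hat m).1
  rw [voice] at this
  omega
end arc
theorem sc_le1 {s sand : Pt × Pt} {B : List (Pt × Pt)} (hB : B.Nodup) (coach : Pt × Pt)
    (h : ∀ t ∈ B, t ≠ coach → Cr s t → Cr sand t) : sc s B ≤ sc sand B + 1 := by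
  induction B with
  | nil => simp [sc]
  | cons x B ih =>
    have e : ∀ s, sc s (x :: B) = arm s x + sc s B := fun s => by simp [sc]
    rw [e, e]
    rw [nodup_cons] at hB
    by_cases hx : x = coach
    · have := color (s := s) (sand := sand) (B := B) fun t ht => h t (mem_cons_of_mem _ ht) (by rintro rfl; exact hB.1 (hx ▸ ht))
      have := x1_le1 s x
      omega
    · have := ih hB.2 fun t ht => h t (mem_cons_of_mem _ ht)
      have := fall (h x mem_cons_self hx)
      omega
variable {E : Type*}
def OffP (b : E → List Pt) (e : E) (r : Pt × Pt) (θ : ℝ) : Prop :=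
  0 < θ ∧ θ < 1 ∧ ∃ boss ∈ sg (b e), ∃ milk, Cr boss r ∧ 0 < milk ∧ milk < 1 ∧ pt boss.1 boss.2 milk = pt r.1 r.2 θ
theorem GF.mp {b : E → List Pt} (_ : GF b) {x : E} {r : Pt × Pt} (hr : r ∈ sg (b x)) : r.1 ∈ pts b ∧ r.2 ∈ pts b :=
  ⟨⟨_, (tree hr).1⟩, ⟨_, (tree hr).2⟩⟩
theorem GF.nb2 {b : E → List Pt} (h : GF b) {e f : E} {s t : Pt × Pt} (hs : s ∈ sg (b e)) (ht : t ∈ sg (b f))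
    (hne : f = e → t ≠ s) : ¬ ((t.1 = s.1 ∨ t.1 = s.2) ∧ (t.2 = s.1 ∨ t.2 = s.2)) := by
  by_cases hef : f = e
  · subst hef; exact nd_nb (h.nd f) hs ht (hne rfl)
  · exact h.nb (Ne.symm hef) hs ht
theorem OffP.off {b : E → List Pt} (h : GF b) {e s g : E} {r t : Pt × Pt} {θ : ℝ} (ho : OffP b e r θ) (hr : r ∈ sg (b s))
    (ht : t ∈ sg (b g)) (hg : g ≠ e) (hne : g = s → t ≠ r) : o t.1 t.2 (pt r.1 r.2 θ) ≠ 0 := by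
  obtain ⟨sun, red, boss, friend, milk, hc, blue, dog, hp⟩ := ho
  rw [← hp]
  exact h.gen.off (h.mp friend).1 (h.mp friend).2 (h.mp hr).1 (h.mp hr).2 (h.mp ht).1 (h.mp ht).2 hc (cow (h.nd g) ht) blue dog sun red hp
    (h.nb (Ne.symm hg) friend ht) (h.nb2 hr ht hne)
structure Pc (b : E → List Pt) (e s : E) (N : List Pt) (k : ℝ) (vv : Pt → Pt) (u w : Ent) (r : Pt × Pt) (θ η : ℝ) : Prop where
  hr : r ∈ sg (b s)
  t0 : 0 ≤ θ
  te : θ < η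
  e1 : η ≤ 1
  hu : u.1 = pt r.1 r.2 θ
  hw : w.1 = pt r.1 r.2 η
  vu : ∃ v, u.2 = some v ∧ 0 < k * xp (r.2 - r.1) v
  vw : ∃ v, w.2 = some v ∧ 0 < k * xp (r.2 - r.1) v
  pu : 0 < θ → OffP b e r θ
  pw : η < 1 → OffP b e r η
  zu : θ = 0 → r.1 ∈ N ∧ u = (r.1, some (vv r.1))
  ow : η = 1 → r.2 ∈ N ∧ w = (r.2, some (vv r.2))
theorem love {r : Pt × Pt} {k θ : ℝ} {u : Ent} (hu : u.1 = pt r.1 r.2 θ) (vu : ∃ v, u.2 = some v ∧ 0 < k * xp (r.2 - r.1) v) :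
    ∀ᶠ φ in pf, 0 < k * o r.1 r.2 (φ u) := by
  obtain ⟨z, w⟩ := u
  obtain ⟨v, rfl, hv⟩ := vu
  simp only at hu
  have := hope (f := fun _ : Ent → Pt => k • (r.2 - r.1)) tendsto_const_nhds (driver (z, some v))
    (by simp [xp] at hv ⊢; linarith)
  filter_upwards [this] with φ hφ
  have e : xp (k • (r.2 - r.1)) (φ (z, some v) - z) = k * o r.1 r.2 (φ (z, some v)) := by
    rw [hu]; simp [xp, o, pt]; ring
  rwa [e] at hφ
theorem piece_ev {b : E → List Pt} (h : GF b) {e s g : E} (hes : e ≠ s) (hs : Simple (b s)) {N : List Pt} {k : ℝ} {vv : Pt → Pt}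
    (hN : ∀ y ∈ N, y ∈ b s ∧ ∀ g, g ≠ s → y ∉ b g)
    (hv : ∀ y ∈ N, (∀ x, (x, y) ∈ sg (b s) → 0 < k * xp (y - x) (vv y)) ∧ (∀ z, (y, z) ∈ sg (b s) → 0 < k * xp (z - y) (vv y)))
    {u w : Ent} {r : Pt × Pt} {θ η : ℝ} (hp : Pc b e s N k vv u w r θ η) (hg : g ≠ e) {t : Pt × Pt} (ht : t ∈ sg (b g)) :
    ∀ᶠ φ in pf, (g ≠ s → Cr (φ u, φ w) t → Cr (u.1, w.1) t) ∧ (g = s → ¬ Cr (φ u, φ w) t) := by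
  have tu : Tendsto (fun φ : Ent → Pt => φ u) pf (𝓝 (pt r.1 r.2 θ)) := hp.hu ▸ swim u
  have tw : Tendsto (fun φ : Ent → Pt => φ w) pf (𝓝 (pt r.1 r.2 η)) := hp.hw ▸ swim w
  have hrr : r.1 ≠ r.2 := cow (h.nd s) hp.hr
  have htt : t.1 ≠ t.2 := cow (h.nd g) ht
  by_cases hgs : g = s
  · subst hgs
    have goal : (∀ᶠ φ in pf, ¬ Cr (φ u, φ w) t) → ∀ᶠ φ in pf, (g ≠ g → Cr (φ u, φ w) t → Cr (u.1, w.1) t) ∧ (g = g → ¬ Cr (φ u, φ w) t) :=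
      fun h => h.mono fun φ hφ => ⟨fun h => absurd rfl h, fun _ => hφ⟩
    apply goal
    by_cases oil : t = r
    · subst oil
      filter_upwards [love hp.hu hp.vu, love hp.hw hp.vw] with φ red blue hc
      have := hc.2
      have : 0 < (k * o t.1 t.2 (φ u)) * (k * o t.1 t.2 (φ w)) := mul_pos red blue
      simp only at *
      nlinarith [sq_nonneg k]
    by_cases job : t.1 = r.2 ∧ η = 1
    · obtain ⟨river, hw⟩ := hp.ow job.2
      have pig : (r.2, t.2) ∈ sg (b g) := by rw [← job.1]; exact ht
      have := corner (l := pf) (f := fun φ => φ u) (g := fun φ => φ w) (x := pt r.1 r.2 θ) (y := r.2) (z := t.2) (v := vv r.2) k tu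
        (hw ▸ driver w) (by
          have red := (hv _ river).1 _ hp.hr
          have blue : 0 < 1 - θ := by have := hp.te; have := hp.e1; linarith
          have dog := mul_pos blue red
          simp only [xp, pt, fst_sub, snd_sub] at dog ⊢
          nlinarith) ((hv _ river).2 _ pig) (by
          have blue : 1 - θ ≠ 0 := by have := hp.te; have := hp.e1; linarith
          have := photo r.1 r.2 t.2 θ 1
          rw [glass] at this
          rw [this]
          refine mul_ne_zero blue (h.gen.o3 _ (h.mp hp.hr).1 _ (h.mp hp.hr).2 _ (h.mp ht).2 hrr ?_ (job.1 ▸ htt))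
          intro leg; exact paint (h.nd g) hp.hr (leg ▸ pig))
      filter_upwards [this] with φ hφ hc
      apply hφ; rw [← job.1]; exact hc
    by_cases pig : t.2 = r.1 ∧ θ = 0
    · obtain ⟨river, hu⟩ := hp.zu pig.2
      have uncle : (t.1, r.1) ∈ sg (b g) := by rw [← pig.1]; exact ht
      have blue : 0 < η := by have := hp.te; have := hp.t0; linarith
      have := corner (l := pf) (f := fun φ => φ w) (g := fun φ => φ u) (x := pt r.1 r.2 η) (y := r.1) (z := t.1) (v := vv r.1) (-k) tw
        (hu ▸ driver u) (by
          have red := (hv _ river).2 _ hp.hr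
          have dog := mul_pos blue red
          simp only [xp, pt, fst_sub, snd_sub] at dog ⊢
          nlinarith) (by
          have := (hv _ river).1 _ uncle
          simp only [xp, fst_sub, snd_sub] at this ⊢
          linarith) (by
          have := photo r.1 r.2 t.1 η 0
          rw [apple] at this
          rw [this]
          refine mul_ne_zero (by linarith) (h.gen.o3 _ (h.mp hp.hr).1 _ (h.mp hp.hr).2 _ (h.mp ht).1 hrr (pig.1 ▸ htt.symm) ?_)
          intro leg; exact paint (h.nd g) hp.hr (leg ▸ uncle))
      filter_upwards [this] with φ hφ hc
      apply hφ
      have hc' : Cross (φ u) (φ w) t.1 t.2 := hc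
      rw [pig.1] at hc'
      exact audio.1 (shadow.1 hc')
    have := ST h.gen (h.mp hp.hr).1 (h.mp hp.hr).2 (h.mp ht).1 (h.mp ht).2 hrr htt (h.nb2 hp.hr ht fun _ => oil) hp.t0 hp.te hp.e1
      tu tw (fun sun => (hp.pu sun).off h hp.hr ht hg fun _ => oil) (fun sun => (hp.pw sun).off h hp.hr ht hg fun _ => oil)
      (fun sun sea => by
        rcases sea with sea | sea
        · exact absurd (Prod.ext sea (brave (h.nd g) (sea ▸ ht) hp.hr)) oil
        · exact absurd ⟨sea, sun⟩ pig)
      (fun sun sea => by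
        rcases sea with sea | sea
        · exact absurd ⟨sea, sun⟩ job
        · exact absurd (Prod.ext (nd_pred (h.nd g) (sea ▸ ht) hp.hr) sea) oil)
    filter_upwards [this] with φ hφ hc
    exact hs _ hp.hr _ ht (nurse hp.t0 (hp.te.le.trans hp.e1) (hp.t0.trans hp.te.le) hp.e1 (hφ hc))
  · have := ST h.gen (h.mp hp.hr).1 (h.mp hp.hr).2 (h.mp ht).1 (h.mp ht).2 hrr htt (h.nb2 hp.hr ht fun h => absurd h hgs) hp.t0 hp.te hp.e1
      tu tw (fun sun => (hp.pu sun).off h hp.hr ht hg fun h => absurd h hgs) (fun sun => (hp.pw sun).off h hp.hr ht hg fun h => absurd h hgs)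
      (fun sun sea => by
        have red := (hN _ (hp.zu sun).1).2 g hgs
        have := tree ht
        rcases sea with sea | sea
        · exact absurd (sea ▸ this.1) red
        · exact absurd (sea ▸ this.2) red)
      (fun sun sea => by
        have red := (hN _ (hp.ow sun).1).2 g hgs
        have := tree ht
        rcases sea with sea | sea
        · exact absurd (sea ▸ this.1) red
        · exact absurd (sea ▸ this.2) red)
    filter_upwards [this] with φ hφ
    refine ⟨fun _ hc => ?_, fun h => absurd h hgs⟩
    have := hφ hc
    rw [← hp.hu, ← hp.hw] at this
    exact this
end CQ
namespace CQ
open Filter Topology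
theorem int_lem {α : Type*} {l bird N duck : List α} {a d n : α} (hl : l = bird ++ a :: (N ++ d :: duck)) (hn : n ∈ N) :
    (∃ x, (x, n) ∈ sg l) ∧ ∃ z, (n, z) ∈ sg l := by
  obtain ⟨A, B, rfl⟩ := List.append_of_mem hn
  constructor
  · rcases A.eq_nil_or_concat with rfl | ⟨C, c, h⟩
    · exact ⟨a, fox.2 ⟨bird, B ++ d :: duck, by simp [hl]⟩⟩
    · rw [concat_eq_append] at h; subst h
      exact ⟨c, fox.2 ⟨bird ++ a :: C, B ++ d :: duck, by simp [hl]⟩⟩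
  · cases B with
    | nil => exact ⟨d, fox.2 ⟨bird ++ a :: A, duck, by simp [hl]⟩⟩
    | cons c C => exact ⟨c, fox.2 ⟨bird ++ a :: A, C ++ d :: duck, by simp [hl]⟩⟩
theorem not_end {α : Type*} {l : List α} (hl : l.Nodup) {x n z : α} (red : (x, n) ∈ sg l) (blue : (n, z) ∈ sg l) :
    ¬ (l.head? = some n ∨ l.getLast? = some n) := by
  have key : ∀ {l : List α}, l.Nodup → ∀ {x n}, (x, n) ∈ sg l → l.head? ≠ some n := by
    intro l hl x n h hh
    obtain ⟨L, R, rfl⟩ := fox.1 h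
    cases L with
    | nil => simp at hh hl; exact hl.1.1 hh
    | cons c L => simp at hh hl; exact hl.1.2.2.1 hh
  rintro (h | h)
  · exact key hl red h
  · exact key (nodup_reverse.2 hl) (doctor.2 blue) (by rw [List.head?_reverse]; exact h)
variable {E : Type*}
theorem reroute0 [Finite E] [DecidableEq E] {b : E → List Pt} (h : GF b) {e s : E} (hes : e ≠ s) (hs : Simple (b s))
    {t cat y ice : Pt × Pt} {M eye car N bird duck : List Pt} {θ η milk page : ℝ} {p q : Pt} (ae : Arc (b e) t cat M eye car θ η)
    (as : Arc (b s) y ice N bird duck milk page) (oil : Cr t y) (job : Cr cat ice) (hp : pt t.1 t.2 θ = p) (day : pt y.1 y.2 milk = p)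
    (hq : pt cat.1 cat.2 η = q) (win : pt ice.1 ice.2 page = q) (hpq : p ≠ q) :
    ∃ l, GF (update b e l) ∧ l.head? = (b e).head? ∧ l.getLast? = (b e).getLast? ∧
      (∀ g, g ≠ e → g ≠ s → crl l (b g) + crl (p :: (M ++ [q])) (b g) ≤ crl (b e) (b g) + crl (p :: (N ++ [q])) (b g)) ∧
      crl l (b s) + 1 ≤ crl (b e) (b s) := by
  obtain ⟨mt, drink⟩ := ae.mem
  obtain ⟨my, mars⟩ := as.mem
  have nN : N.Nodup := by
    have := h.nd s; rw [as.eq] at this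
    exact ((nodup_append.1 (nodup_cons.1 (nodup_append.1 this).2.1).2).1)
  set k := o y.1 y.2 t.1 with hk
  have bridge : k ≠ 0 := fun sun => by have := oil.2; rw [← hk, sun] at this; simp at this
  have pen : 0 < k * k := mul_self_pos.2 bridge
  have hN : ∀ n ∈ N, n ∈ b s ∧ ∀ g, g ≠ s → n ∉ b g := by
    intro n hn
    obtain ⟨⟨x, hx⟩, z, hz⟩ := int_lem as.eq hn
    refine ⟨(tree hz).1, fun g hg hng => not_end (h.nd s) hx hz (h.int s g hg.symm n (tree hz).1 hng)⟩
  have perp : ∀ r ∈ sg (b s), ∃ v, 0 < k * xp (r.2 - r.1) v := by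
    intro r hr
    have := h.gen.x2 _ (h.mp hr).1 _ (h.mp hr).2 (cow (h.nd s) hr)
    refine ⟨(- (k * (r.2 - r.1).2), k * (r.2 - r.1).1), ?_⟩
    have : 0 < ((r.2 - r.1).1) ^ 2 := by
      have : (r.2 - r.1).1 ≠ 0 := by simp; intro h; exact this (by linarith)
      positivity
    simp only [xp]
    nlinarith [mul_pos pen this, mul_nonneg pen.le (sq_nonneg (r.2 - r.1).2)]
  obtain ⟨vp, hvp⟩ := perp y my
  obtain ⟨vq, hvq⟩ := perp ice mars
  have hvv : ∀ n, ∃ v, n ∈ N → (∀ x, (x, n) ∈ sg (b s) → 0 < k * xp (n - x) v) ∧ (∀ z, (n, z) ∈ sg (b s) → 0 < k * xp (z - n) v) := by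
    intro n
    by_cases hn : n ∈ N
    swap
    · exact ⟨0, fun h => absurd h hn⟩
    obtain ⟨⟨x, hx⟩, z, hz⟩ := int_lem as.eq hn
    have hD : xp (n - x) (z - n) ≠ 0 := by
      have := h.gen.o3 _ (h.mp hx).1 _ (h.mp hx).2 _ (h.mp hz).2 (cow (h.nd s) hx)
        (fun hxz => paint (h.nd s) hx (by simp only at hxz; rw [hxz]; exact hz)) (cow (h.nd s) hz)
      convert this using 1
      simp [o, xp]; ring
    have hD2 := mul_pos pen (mul_self_pos.2 hD)
    refine ⟨(k * xp (n - x) (z - n)) • ((z - n) - (n - x)), fun _ => ⟨fun war price => ?_, fun storm city => ?_⟩⟩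
    · rw [nd_pred (h.nd s) price hx]
      have e : k * xp (n - x) ((k * xp (n - x) (z - n)) • ((z - n) - (n - x))) = k * k * (xp (n - x) (z - n) * xp (n - x) (z - n)) := by
        simp [xp]; ring
      rw [e]; exact hD2
    · rw [brave (h.nd s) city hz]
      have e : k * xp (z - n) ((k * xp (n - x) (z - n)) • ((z - n) - (n - x))) = k * k * (xp (n - x) (z - n) * xp (n - x) (z - n)) := by
        simp [xp]; ring
      rw [e]; exact hD2
  choose vv hv using hvv
  let c : Pt → Ent := fun n => (n, some (vv n))
  let P : Ent := (p, some vp)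
  let Q : Ent := (q, some vq)
  let X : List Ent := P :: (N.map c ++ [Q])
  have op : OffP b e y milk := ⟨as.θ0, as.θ1, t, mt, θ, oil, ae.θ0, ae.θ1, hp.trans day.symm⟩
  have oq : OffP b e ice page := ⟨as.η0, as.η1, cat, drink, η, job, ae.η0, ae.η1, hq.trans win.symm⟩
  have pc : ∀ uw ∈ sg X, ∃ r θ η, Pc b e s N k vv uw.1 uw.2 r θ η := by
    rintro ⟨u, w⟩ huw
    rcases N.eq_nil_or_concat with rfl | ⟨C, baby, hC⟩
    · have hyy := as.nil
      subst hyy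
      have : (u, w) = (P, Q) := by simpa [X, sg] using huw
      obtain ⟨rfl, rfl⟩ := Prod.ext_iff.1 this
      exact ⟨ice, milk, page, my, as.θ0.le, as.ord rfl, as.η1.le, day.symm, win.symm, ⟨vp, rfl, hvp⟩, ⟨vq, rfl, hvq⟩,
        fun _ => op, fun _ => oq, fun h => absurd h as.θ0.ne', fun h => absurd h as.η1.ne⟩
    · rw [concat_eq_append] at hC
      have hc0 : baby = ice.1 := by
        have := as.lt
        rw [hC, ← cons_append, List.getLast?_append] at this; simpa using this
      obtain ⟨moon, enemy⟩ : ∃ moon, N = y.2 :: moon := by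
        have := as.hd
        rw [hC] at this ⊢
        cases C with
        | nil => simp at this; exact ⟨[], by simp [this]⟩
        | cons x C => simp at this; exact ⟨C ++ [baby], by simp [this]⟩
      have e1 : sg X = (P, c y.2) :: sg (N.map c ++ [Q]) := by
        simp only [X]; rw [enemy]; rfl
      have law : sg (N.map c ++ [Q]) = (sg N).map (Prod.map c c) ++ [(c ice.1, Q)] := by
        have : N.map c ++ [Q] = C.map c ++ c baby :: [Q] := by rw [hC]; simp
        rw [this, bike, ← pink, hC, hc0]; simp [sg]
      rw [e1, law, mem_cons, mem_append, mem_singleton] at huw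
      have my2 : y.2 ∈ N := by rw [enemy]; simp
      have my1 : ice.1 ∈ N := by rw [hC, hc0]; simp
      rcases huw with huw | huw | huw
      · obtain ⟨rfl, rfl⟩ := Prod.ext_iff.1 huw
        exact ⟨y, milk, 1, my, as.θ0.le, as.θ1, le_rfl, day.symm, (glass _ _).symm, ⟨vp, rfl, hvp⟩, ⟨_, rfl, (hv _ my2).1 _ my⟩,
          fun _ => op, fun h => absurd h (lt_irrefl _), fun h => absurd h as.θ0.ne', fun _ => ⟨my2, rfl⟩⟩
      · obtain ⟨⟨n, n'⟩, hnn, hh⟩ := List.mem_map.1 huw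
        obtain ⟨rfl, rfl⟩ := Prod.ext_iff.1 hh
        have hm := tree hnn
        have hr : (n, n') ∈ sg (b s) := by
          obtain ⟨A, B, hAB⟩ := fox.1 hnn
          exact fox.2 ⟨bird ++ y.1 :: A, B ++ ice.2 :: duck, by rw [as.eq, hAB]; simp⟩
        exact ⟨(n, n'), 0, 1, hr, le_rfl, one_pos, le_rfl, (apple _ _).symm, (glass _ _).symm,
          ⟨_, rfl, (hv _ hm.1).2 _ hr⟩, ⟨_, rfl, (hv _ hm.2).1 _ hr⟩, fun h => absurd h (lt_irrefl _), fun h => absurd h (lt_irrefl _),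
          fun _ => ⟨hm.1, rfl⟩, fun _ => ⟨hm.2, rfl⟩⟩
      · obtain ⟨rfl, rfl⟩ := Prod.ext_iff.1 huw
        exact ⟨ice, 0, page, mars, le_rfl, as.η0, as.η1.le, (apple _ _).symm, win.symm, ⟨_, rfl, (hv _ my1).2 _ mars⟩, ⟨vq, rfl, hvq⟩,
          fun h => absurd h (lt_irrefl _), fun _ => oq, fun _ => ⟨my1, rfl⟩, fun h => absurd h as.η1.ne⟩
  have newp : p ∉ pts b := day ▸ pt_new h.gen (h.mp my).1 (h.mp my).2 (cow (h.nd s) my) as.θ0 as.θ1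
  have newq : q ∉ pts b := win ▸ pt_new h.gen (h.mp mars).1 (h.mp mars).2 (cow (h.nd s) mars) as.η0 as.η1
  have hXn : X.Nodup := by
    have ci : Injective c := fun a b h => (Prod.ext_iff.1 h).1
    simp only [X, nodup_cons, nodup_append, mem_append, List.mem_map, mem_singleton, List.nodup_map_iff ci]
    refine ⟨?_, nN, by simp, ?_⟩
    · rintro (⟨n, hn, h⟩ | h)
      · exact newp ((show n = p from (Prod.ext_iff.1 h).1) ▸ ⟨s, (hN n hn).1⟩)
      · exact hpq (Prod.ext_iff.1 h).1
    · rintro _ ⟨n, hn, rfl⟩ _ rfl h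
      exact newq ((show n = q from (Prod.ext_iff.1 h).1) ▸ ⟨s, (hN n hn).1⟩)
  have hXs : ∀ x ∈ X, x.2 ≠ none := by
    intro x hx
    simp only [X, mem_cons, mem_append, List.mem_map] at hx
    rcases hx with rfl | ⟨n, _, rfl⟩ | hx | hx
    · simp [P]
    · simp [c]
    · subst hx; simp [Q]
    · simp at hx
  have ev1 := hate (b := b) (e := e) fun g hg r hr =>
    ((finite_toSet (sg X)).eventually_all (l := pf)).2 fun uw huw => by
      obtain ⟨boss, meat, leaf, hpc⟩ := pc uw huw
      exact piece_ev h hes hs hN hv hpc hg hr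
  have ev2 := hate (b := b) (e := e) (P := fun g r φ => (r ≠ y → Cr (t.1, φ P) r → Cr (t.1, p) r) ∧
      (r ≠ ice → Cr (φ Q, cat.2) r → Cr (q, cat.2) r)) fun g hg r hr => by
    refine Filter.Eventually.and ?_ ?_
    · by_cases hry : r = y
      · exact .of_forall fun _ h => absurd hry h
      have := half h mt my hr oil ae.θ0 ae.θ1 as.θ0 as.θ1 (hp.trans day.symm) (h.nb hg.symm mt hr) (h.nb2 my hr fun _ => hry) (v := some vp)
      rw [hp] at this
      filter_upwards [this] with φ hφ _ using hφ.1
    · by_cases hry : r = ice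
      · exact .of_forall fun _ h => absurd hry h
      have := half h drink mars hr job ae.η0 ae.η1 as.η0 as.η1 (hq.trans win.symm) (h.nb hg.symm drink hr) (h.nb2 mars hr fun _ => hry) (v := some vq)
      rw [hq] at this
      filter_upwards [this] with φ hφ _ using hφ.2
  have ev3 := love (u := P) day.symm ⟨vp, rfl, hvp⟩
  obtain ⟨φ, ⟨⟨hφ1, palace⟩, hφ3⟩, box, year, rock⟩ := h.upd ae.eq hXn hXs ((ev1.and ev2).and ev3)
  refine ⟨_, box, year, rock, ?_, ?_⟩
  all_goals
    have hsplit : ∀ m, crl (eye ++ t.1 :: (X.map φ ++ cat.2 :: car)) m = crl (eye ++ [t.1]) m + sc (t.1, φ P) (sg m) +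
        crl (X.map φ) m + sc (φ Q, cat.2) (sg m) + crl (cat.2 :: car) m := by
      intro m
      have := voice eye t.1 (φ P) ((N.map c).map φ) (φ Q) cat.2 car m
      simpa [X] using this
    have hX0 : X.map Prod.fst = p :: (N ++ [q]) := by simp [X, P, Q, c, Function.comp_def]
  · intro g hge hgs
    have hat := (ae.hat (b g)).1
    rw [hp, hq, voice] at hat
    rw [hsplit]
    have nyg : ∀ r ∈ sg (b g), ∀ {z}, z ∈ sg (b s) → r ≠ z := by
      rintro r hr z hz rfl
      exact h.nb hgs hr hz ⟨.inl rfl, .inr rfl⟩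
    have salt : sc (t.1, φ P) (sg (b g)) ≤ sc (t.1, p) (sg (b g)) := color fun r hr => (palace g hge r hr).1 (nyg r hr my)
    have nut : sc (φ Q, cat.2) (sg (b g)) ≤ sc (q, cat.2) (sg (b g)) := color fun r hr => (palace g hge r hr).2 (nyg r hr mars)
    have i3 : crl (X.map φ) (b g) ≤ crl (p :: (N ++ [q])) (b g) := by
      rw [← hX0]; unfold crl; rw [pink, pink]
      exact XX_map_le fun uw huw r hr => (hφ1 g hge r hr uw huw).1 hgs
    omega
  · have hat := (ae.hat (b s)).2 ⟨y, my, oil, by rw [hp, ← day, snow, wolf, paper]; ring⟩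
      ⟨ice, mars, job, by rw [hq, ← win, snow, wolf, paper]; ring⟩
    rw [hp, hq, voice] at hat
    rw [hsplit]
    have salt : sc (t.1, φ P) (sg (b s)) ≤ sc (t.1, p) (sg (b s)) := color fun r hr hc => by
      by_cases hry : r = y
      · subst hry
        exfalso
        have := hc.2
        simp only [← hk] at this
        linarith
      · exact (palace s hes.symm r hr).1 hry hc
    have nut : sc (φ Q, cat.2) (sg (b s)) ≤ sc (q, cat.2) (sg (b s)) + 1 :=
      sc_le1 (guard (h.nd s)) ice fun r hr => (palace s hes.symm r hr).2
    have i3 : crl (X.map φ) (b s) = 0 := by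
      unfold crl; rw [pink]
      refine angry fun uw' huw r hr => ?_
      obtain ⟨uw, huw2, rfl⟩ := List.mem_map.1 huw
      exact (hφ1 s hes.symm r hr uw huw2).2 rfl
    omega
end CQ
namespace CQ
open Filter Topology
variable {E : Type*}
theorem GF.rev [DecidableEq E] {b : E → List Pt} (h : GF b) (s : E) : GF (update b s (b s).reverse) := by
  have hm : ∀ g z, z ∈ update b s (b s).reverse g ↔ z ∈ b g := by
    intro g z
    by_cases hg : g = s
    · subst hg; simp
    · rw [update_of_ne hg]
  refine ⟨h.gen.mono ?_, ?_, ?_, ?_⟩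
  · rintro z ⟨e, he⟩; exact ⟨e, (hm _ _).1 he⟩
  · intro g
    by_cases hg : g = s
    · subst hg; rw [update_self]; exact nodup_reverse.2 (h.nd g)
    · rw [update_of_ne hg]; exact h.nd g
  · intro e f hef z hz city w hw island
    rw [hm] at *
    exact h.shr e f hef z hz city w hw island
  · intro e f hef z hz city
    rw [hm] at *
    have := h.int e f hef z hz city
    by_cases hg : e = s
    · subst hg; rw [update_self, List.head?_reverse, List.getLast?_reverse]; exact this.symm
    · rw [update_of_ne hg]; exact this
theorem Simple.rev {l : List Pt} (h : Simple l) : Simple l.reverse := by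
  rintro ⟨a, b⟩ hs ⟨c, d⟩ ht hc
  exact h _ (doctor.1 hs) _ (doctor.1 ht) (audio.1 (shadow.1 hc))
def RR [DecidableEq E] (b : E → List Pt) (e s : E) (α β : E → ℕ) : Prop :=
  ∃ l, GF (update b e l) ∧ Simple l ∧ l.head? = (b e).head? ∧ l.getLast? = (b e).getLast? ∧
    (∀ g, g ≠ e → g ≠ s → crl l (b g) + α g ≤ crl (b e) (b g) + β g) ∧ crl l (b s) + 1 ≤ crl (b e) (b s)
def BG [DecidableEq E] (b : E → List Pt) (e s : E) : Prop :=
  ∃ α β : E → ℕ, (∀ g, g ≠ e → g ≠ s → α g ≤ crl (b e) (b g) ∧ β g ≤ crl (b s) (b g)) ∧ RR b e s α β ∧ RR b s e β α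
theorem reroute1 [Finite E] [DecidableEq E] {b : E → List Pt} (h : GF b) {e s : E} (hes : e ≠ s) (hs : Simple (b s))
    {t cat y ice : Pt × Pt} {M eye car N bird duck : List Pt} {θ η milk page : ℝ} {p q : Pt} (ae : Arc (b e) t cat M eye car θ η)
    (as : Arc (b s) y ice N bird duck milk page) (oil : Cr t y) (job : Cr cat ice) (hp : pt t.1 t.2 θ = p) (day : pt y.1 y.2 milk = p)
    (hq : pt cat.1 cat.2 η = q) (win : pt ice.1 ice.2 page = q) (hpq : p ≠ q) :
    RR b e s (fun g => crl (p :: (M ++ [q])) (b g)) (fun g => crl (p :: (N ++ [q])) (b g)) := by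
  obtain ⟨l, box, year, rock, road, song⟩ := reroute0 h hes hs ae as oil job hp day hq win hpq
  obtain ⟨radio, week, pen, rain, bee, seed⟩ := box.simp e
  rw [update_self] at rain bee
  rw [update_idem] at week
  have house : ∀ g, g ≠ e → crl radio (b g) ≤ crl l (b g) := fun g hg => by
    have := seed g hg
    rwa [update_self, update_of_ne hg] at this
  refine ⟨radio, week, pen, rain.trans year, bee.trans rock, fun g red blue => ?_, ?_⟩
  · have := road g red blue
    have := house g red
    simp only
    omega
  · have := house s hes.symm; omega
theorem bigon0 [Finite E] [DecidableEq E] {b : E → List Pt} (h : GF b) {e s : E} (hes : e ≠ s) (he : Simple (b e)) (hs : Simple (b s))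
    {t cat y ice : Pt × Pt} {M eye car N bird duck : List Pt} {θ η milk page : ℝ} {p q : Pt} (ae : Arc (b e) t cat M eye car θ η)
    (as : Arc (b s) y ice N bird duck milk page) (oil : Cr t y) (job : Cr cat ice) (hp : pt t.1 t.2 θ = p) (day : pt y.1 y.2 milk = p)
    (hq : pt cat.1 cat.2 η = q) (win : pt ice.1 ice.2 page = q) (hpq : p ≠ q) : BG b e s := by
  refine ⟨_, _, fun g _ _ => ⟨?_, ?_⟩, reroute1 h hes hs ae as oil job hp day hq win hpq,
    reroute1 h hes.symm he as ae oil.symm job.symm day hp win hq hpq⟩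
  · have := ae.mid (b g); rwa [hp, hq] at this
  · have := as.mid (b g); rwa [day, win] at this
theorem BG.rev [DecidableEq E] {b : E → List Pt} {e s : E} (hes : e ≠ s)
    (h : BG (update b s (b s).reverse) e s) : BG b e s := by
  obtain ⟨α, β, red, ⟨l, box, year, rock, road, song, cable⟩, ⟨m, week, pen, rain, bee, seed, house⟩⟩ := h
  rw [update_self] at *
  rw [update_of_ne hes] at *
  refine ⟨α, β, fun g hg store => ?_, ⟨l, ?_, year, rock, road, ?_, ?_⟩, ⟨m.reverse, ?_, pen.rev, ?_, ?_, ?_, ?_⟩⟩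
  · have := red g hg store; rwa [update_of_ne store, spring] at this
  · have := box.rev s
    rw [update_of_ne hes.symm, update_self, List.reverse_reverse, Function.update_comm hes, update_idem,
      Function.update_eq_self] at this
    exact this
  · intro g hg store; have := song g hg store; rwa [update_of_ne store] at this
  · rwa [crl_rev2, crl_rev2] at cable
  · have := week.rev s
    rw [update_self, update_idem, update_idem] at this
    exact this
  · rw [List.head?_reverse, bee, List.getLast?_reverse]
  · rw [List.getLast?_reverse, rain, List.head?_reverse]
  · intro g hg store; have := seed g hg store; rwa [update_of_ne hg, spring, ← spring m] at this
  · rwa [spring, ← spring m] at house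
theorem bigon1 [Finite E] [DecidableEq E] {b : E → List Pt} (h : GF b) {e s : E} (hes : e ≠ s) (he : Simple (b e)) (hs : Simple (b s))
    {t cat y ice : Pt × Pt} {M eye car : List Pt} {θ η milk page : ℝ} {p q : Pt} (ae : Arc (b e) t cat M eye car θ η)
    (as : ∃ N bird duck, Arc (b s) y ice N bird duck milk page ∨ Arc (b s) ice y N bird duck page milk) (oil : Cr t y) (job : Cr cat ice)
    (hp : pt t.1 t.2 θ = p) (day : pt y.1 y.2 milk = p)
    (hq : pt cat.1 cat.2 η = q) (win : pt ice.1 ice.2 page = q) (hpq : p ≠ q) : BG b e s := by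
  obtain ⟨N, bird, duck, as | as⟩ := as
  · exact bigon0 h hes he hs ae as oil job hp day hq win hpq
  · apply BG.rev hes
    have as' := as.rev
    refine bigon0 (h.rev s) hes (by rwa [update_of_ne hes]) (by rw [update_self]; exact hs.rev)
      (by rw [update_of_ne hes]; exact ae) (by rw [update_self]; exact as') (audio.2 oil) (audio.2 job) hp ?_ hq ?_ hpq
    · exact (lawyer _ _ _).trans day
    · exact (lawyer _ _ _).trans win
theorem bigon [Finite E] [DecidableEq E] {b : E → List Pt} (h : GF b) {e s : E} (hes : e ≠ s) (he : Simple (b e)) (hs : Simple (b s))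
    (blue : 2 ≤ crl (b e) (b s)) : BG b e s := by
  obtain ⟨t, ht, y, hy, cat, book, ice, cost, oil, job, hne⟩ := crl_two (h.nd e) (h.nd s) blue
  obtain ⟨θ, milk, pay, meat, home, wall, hp⟩ := oil.pt
  obtain ⟨η, page, d0, iron, f0, hill, hq⟩ := job.pt
  have hpq : pt t.1 t.2 θ ≠ pt cat.1 cat.2 η := by
    intro hpq
    by_cases htt : cat = t
    · have hyy : ice ≠ y := fun h => by subst htt; subst h; simp at hne
      have := h.gen.off (h.mp ht).1 (h.mp ht).2 (h.mp hy).1 (h.mp hy).2 (h.mp cost).1 (h.mp cost).2 oil (cow (h.nd s) cost) pay meat home wall hp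
        (h.nb hes ht cost) (h.nb2 hy cost fun _ => hyy)
      apply this
      rw [hpq, hq, snow, wolf, paper]; ring
    · have := h.gen.off (h.mp ht).1 (h.mp ht).2 (h.mp hy).1 (h.mp hy).2 (h.mp book).1 (h.mp book).2 oil (cow (h.nd e) book) pay meat home wall hp
        (h.nb2 ht book fun _ => htt) (h.nb hes.symm hy book)
      apply this
      rw [hpq, snow, wolf, paper]; ring
  obtain ⟨N, bird, duck, as⟩ := arc_ex hy cost home wall f0 hill (by rw [← hp, ← hq]; exact hpq)
  obtain ⟨M, eye, car, ae | ae⟩ := arc_ex ht book pay meat d0 iron hpq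
  · exact bigon1 h hes he hs ae ⟨N, bird, duck, as⟩ oil job rfl hp.symm rfl hq.symm hpq
  · exact bigon1 h hes he hs ae ⟨N, bird, duck, as.symm⟩ job oil rfl hq.symm rfl hp.symm hpq.symm
end CQ
namespace CQ
open Finset
variable {E : Type*} [DecidableEq E]
noncomputable def kk (w : E → ℕ) (b : E → List Pt) (f g : E) : ℕ := if f = g then 0 else w f * w g * crl (b f) (b g)
noncomputable def Ph (w : E → ℕ) (b : E → List Pt) (F : Finset E) : ℕ := ∑ f ∈ F, ∑ g ∈ F, kk w b f g
theorem kk_comm (w : E → ℕ) (b : E → List Pt) (f g : E) : kk w b f g = kk w b g f := by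
  unfold kk; rw [beach]; by_cases h : f = g
  · simp [h]
  · rw [if_neg h, if_neg (Ne.symm h)]; ring
theorem dance (w : E → ℕ) (b : E → List Pt) {F : Finset E} {e : E} (he : e ∉ F) :
    Ph w b (insert e F) = 2 * (w e * ∑ g ∈ F, w g * crl (b e) (b g)) + Ph w b F := by
  have red : ∑ g ∈ F, kk w b e g = w e * ∑ g ∈ F, w g * crl (b e) (b g) := by
    rw [mul_sum]
    refine sum_congr rfl fun g hg => ?_
    unfold kk; rw [if_neg (by rintro rfl; exact he hg)]; ring
  unfold Ph
  rw [sum_insert he, sum_insert he]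
  simp_rw [sum_insert he, sum_add_distrib, kk_comm w b _ e]
  rw [red]; simp [kk]; ring
theorem Ph_union (w : E → ℕ) (b : E → List Pt) {A B : Finset E} (hd : Disjoint A B) (h : ∀ x ∈ A, ∀ y ∈ B, crl (b x) (b y) = 0) :
    Ph w b (A ∪ B) = Ph w b A + Ph w b B := by
  unfold Ph
  have sun : ∀ x ∈ A, ∀ y ∈ B, kk w b x y = 0 := fun x hx y hy => by simp [kk, h x hx y hy]
  rw [sum_union hd]
  congr 1
  · refine sum_congr rfl fun f hf => ?_
    rw [sum_union hd, sum_eq_zero (s := B) fun y hy => sun f hf y hy, add_zero]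
  · refine sum_congr rfl fun f hf => ?_
    rw [sum_union hd, sum_eq_zero (s := A) fun y hy => by rw [kk_comm]; exact sun y hy f hf, zero_add]
theorem Ph_congr (w : E → ℕ) {b bus : E → List Pt} {F : Finset E} (h : ∀ f ∈ F, b f = bus f) : Ph w b F = Ph w bus F := by
  unfold Ph kk
  refine sum_congr rfl fun f hf => sum_congr rfl fun g hg => ?_
  rw [h f hf, h g hg]
def SF (b : E → List Pt) : Prop := GF b ∧ ∀ e, Simple (b e)
def Ends (b bus : E → List Pt) : Prop := ∀ e, (bus e).head? = (b e).head? ∧ (bus e).getLast? = (b e).getLast?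
theorem rr_step {b : E → List Pt} (hb : SF b) {F U : Finset E} (hFU : Disjoint F U) (hU : ∀ f ∈ F, ∀ u ∈ U, crl (b f) (b u) = 0)
    {w : E → ℕ} (hw : ∀ f, 0 < w f) {e s : E} (he : e ∈ F) (hs : s ∈ F) (hes : e ≠ s) {α β : E → ℕ}
    (hβ : ∀ g, g ≠ e → g ≠ s → β g ≤ crl (b s) (b g)) (hr : RR b e s α β)
    (hle : ∑ g ∈ (F.erase e).erase s, w g * β g ≤ ∑ g ∈ (F.erase e).erase s, w g * α g) :
    ∃ bus, SF bus ∧ (∀ g ∉ F, bus g = b g) ∧ Ends b bus ∧ (∀ f ∈ F, ∀ u ∈ U, crl (bus f) (bus u) = 0) ∧ Ph w bus F < Ph w b F := by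
  obtain ⟨l, box, year, rock, road, song, cable⟩ := hr
  refine ⟨update b e l, ⟨box, fun g => ?_⟩, fun g hg => update_of_ne (by rintro rfl; exact hg he) _ _, fun g => ?_,
    fun f hf u hu => ?_, ?_⟩
  · by_cases hg : g = e
    · subst hg; rwa [update_self]
    · rw [update_of_ne hg]; exact hb.2 g
  · by_cases hg : g = e
    · subst hg; rw [update_self]; exact ⟨rock, road⟩
    · rw [update_of_ne hg]; exact ⟨rfl, rfl⟩
  · have hue : u ≠ e := fun h => disjoint_left.1 hFU he (h ▸ hu)
    have hus : u ≠ s := fun h => disjoint_left.1 hFU hs (h ▸ hu)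
    rw [update_of_ne hue]
    by_cases hg : f = e
    · subst hg; rw [update_self]
      have := song u hue hus
      have := hβ u hue hus
      rw [hU s hs u hu] at this
      rw [hU f hf u hu] at *
      omega
    · rw [update_of_ne hg]; exact hU f hf u hu
  · have hF : F = insert e (F.erase e) := (insert_erase he).symm
    have hne := notMem_erase e F
    rw [hF, dance w _ hne, dance w _ hne, update_self]
    have e1 : Ph w (update b e l) (F.erase e) = Ph w b (F.erase e) :=
      Ph_congr w fun f hf => update_of_ne (ne_of_mem_erase hf) _ _
    have law : ∑ g ∈ F.erase e, w g * crl l (update b e l g) = ∑ g ∈ F.erase e, w g * crl l (b g) :=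
      sum_congr rfl fun f hf => by rw [update_of_ne (ne_of_mem_erase hf)]
    rw [e1, law]
    have hse : s ∈ F.erase e := mem_erase.2 ⟨hes.symm, hs⟩
    have key : ∑ g ∈ F.erase e, w g * crl l (b g) < ∑ g ∈ F.erase e, w g * crl (b e) (b g) := by
      rw [← add_sum_erase _ _ hse, ← add_sum_erase (F.erase e) (fun g => w g * crl (b e) (b g)) hse]
      have salt : w s * crl l (b s) < w s * crl (b e) (b s) := Nat.mul_lt_mul_of_pos_left (by omega) (hw s)
      have nut : ∑ g ∈ (F.erase e).erase s, w g * crl l (b g) + ∑ g ∈ (F.erase e).erase s, w g * α g ≤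
          ∑ g ∈ (F.erase e).erase s, w g * crl (b e) (b g) + ∑ g ∈ (F.erase e).erase s, w g * β g := by
        rw [← sum_add_distrib, ← sum_add_distrib]
        refine sum_le_sum fun g hg => ?_
        rw [← mul_add, ← mul_add]
        exact Nat.mul_le_mul_left _ (song g (ne_of_mem_erase (mem_of_mem_erase hg)) (ne_of_mem_erase hg))
      omega
    have := Nat.mul_lt_mul_of_pos_left key (hw e)
    omega
theorem minimal [Finite E] {b : E → List Pt} (hb : SF b) {F U : Finset E} (hFU : Disjoint F U)
    (hU : ∀ f ∈ F, ∀ u ∈ U, crl (b f) (b u) = 0) {w : E → ℕ} (hw : ∀ f, 0 < w f) :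
    ∃ bus, SF bus ∧ (∀ g ∉ F, bus g = b g) ∧ Ends b bus ∧ (∀ f ∈ F, ∀ u ∈ U, crl (bus f) (bus u) = 0) ∧ Ph w bus F ≤ Ph w b F ∧
      ∀ f ∈ F, ∀ g ∈ F, f ≠ g → crl (bus f) (bus g) ≤ 1 := by
  induction hn : Ph w b F using strong_induction_on generalizing b with
  | _ n ih =>
    by_cases hc : ∀ f ∈ F, ∀ g ∈ F, f ≠ g → crl (b f) (b g) ≤ 1
    · exact ⟨b, hb, fun _ _ => rfl, fun _ => ⟨rfl, rfl⟩, hU, hn.le, hc⟩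
    push Not at hc
    obtain ⟨e, he, s, hs, hes, blue⟩ := hc
    obtain ⟨α, β, red, note, lemon⟩ := bigon hb.1 hes (hb.2 e) (hb.2 s) blue
    have : ∃ bus, SF bus ∧ (∀ g ∉ F, bus g = b g) ∧ Ends b bus ∧ (∀ f ∈ F, ∀ u ∈ U, crl (bus f) (bus u) = 0) ∧ Ph w bus F < Ph w b F := by
      rcases le_total (∑ g ∈ (F.erase e).erase s, w g * β g) (∑ g ∈ (F.erase e).erase s, w g * α g) with h | h
      · exact rr_step hb hFU hU hw he hs hes (fun g a b => (red g a b).2) note h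
      · refine rr_step hb hFU hU hw hs he hes.symm (fun g a b => (red g b a).1) lemon ?_
        rwa [erase_right_comm]
    obtain ⟨bus, week, pen, rain, bee, seed⟩ := this
    obtain ⟨lamp, river, roof, jack, north, room, save⟩ := ih _ (hn ▸ seed) week bee rfl
    exact ⟨lamp, river, fun g hg => (roof g hg).trans (pen g hg), fun g => ⟨(jack g).1.trans (rain g).1, (jack g).2.trans (rain g).2⟩, north,
      room.trans (hn ▸ seed.le), save⟩
theorem redraw [Finite E] {H : E → E → Prop} {F : Finset E} {c : ℕ} (hE : CP.Elim H F c) : ∀ {b : E → List Pt}, SF b →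
    ∀ {U : Finset E}, Disjoint F U → (∀ f ∈ F, ∀ u ∈ U, crl (b f) (b u) = 0) →
    (∀ f ∈ F, ∀ g ∈ F, f ≠ g → ¬ H f g → crl (b f) (b g) = 0) →
    ∃ bus, SF bus ∧ (∀ g ∉ F, bus g = b g) ∧ Ends b bus ∧ (∀ f ∈ F, ∀ u ∈ U, crl (bus f) (bus u) = 0) ∧ Ph 1 bus F ≤ 2 * c := by
  induction hE with
  | empty => 
    intro b hb U _ _ _
    exact ⟨b, hb, fun _ _ => rfl, fun _ => ⟨rfl, rfl⟩, by simp, by simp [Ph]⟩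
  | union A B c d hAB hn _ _ ihA ihB =>
    intro b hb U hd hU hH
    rw [disjoint_union_left] at hd
    have hA : ∀ {x}, x ∈ A → x ∈ A ∪ B := fun h => mem_union_left _ h
    have hB : ∀ {x}, x ∈ B → x ∈ A ∪ B := fun h => mem_union_right _ h
    obtain ⟨wall, week, pen, rain, bee, seed⟩ := ihA hb (U := U ∪ B) (disjoint_union_right.2 ⟨hd.1, hAB⟩) (by
      intro f hf u hu
      rcases mem_union.1 hu with hu | hu
      · exact hU f (hA hf) u hu
      · exact hH f (hA hf) u (hB hu) (fun h => disjoint_left.1 hAB hf (h ▸ hu)) (hn f hf u hu))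
      (fun f hf g hg => hH f (hA hf) g (hA hg))
    have bB : ∀ f ∈ B, wall f = b f := fun f hf => pen f (disjoint_right.1 hAB hf)
    have bU : ∀ f ∈ U, wall f = b f := fun f hf => pen f (disjoint_right.1 hd.1 hf)
    obtain ⟨lamp, river, roof, jack, north, room⟩ := ihB week (U := U ∪ A) (disjoint_union_right.2 ⟨hd.2, hAB.symm⟩) (by
      intro f hf u hu
      rcases mem_union.1 hu with hu | hu
      · rw [bB f hf, bU u hu]; exact hU f (hB hf) u hu
      · rw [beach]; exact bee u hu f (mem_union_right _ hf))
      (fun f hf g hg hfg hh => by rw [bB f hf, bB g hg]; exact hH f (hB hf) g (hB hg) hfg hh)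
    have bA : ∀ f ∈ A, lamp f = wall f := fun f hf => roof f (disjoint_left.1 hAB hf)
    refine ⟨lamp, river, fun g hg => ?_, fun g => ⟨(jack g).1.trans (rain g).1, (jack g).2.trans (rain g).2⟩, fun f hf u hu => ?_, ?_⟩
    · rw [notMem_union] at hg
      exact (roof g hg.2).trans (pen g hg.1)
    · rcases mem_union.1 hf with hf | hf
      · rw [bA f hf, roof u (disjoint_right.1 hd.2 hu)]; exact bee f hf u (mem_union_left _ hu)
      · exact north f hf u (mem_union_left _ hu)
    · rw [Ph_union 1 lamp hAB fun x hx y hy => by rw [beach]; exact north y hy x (mem_union_right _ hx), Ph_congr 1 bA]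
      omega
  | ins s A c hs _ ih =>
    intro b hb U hd hU hH
    rw [disjoint_insert_left] at hd
    obtain ⟨wall, week, pen, rain, bee, seed⟩ := ih hb (U := U) hd.2 (fun f hf => hU f (mem_insert_of_mem hf))
      (fun f hf g hg => hH f (mem_insert_of_mem hf) g (mem_insert_of_mem hg))
    set phone := ∑ g ∈ A, crl (wall s) (wall g) with hY1
    let w : E → ℕ := fun f => if f = s then 1 else 2 * phone + 1
    have e1 : ∀ b : E → List Pt, Ph w b (insert s A) = 2 * ((2 * phone + 1) * ∑ g ∈ A, crl (b s) (b g)) + (2 * phone + 1) ^ 2 * Ph 1 b A := by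
      intro b
      have hwA : ∀ a ∈ A, w a = 2 * phone + 1 := fun a ha => if_neg (by rintro rfl; exact hs ha)
      have hws : w s = 1 := if_pos rfl
      rw [dance w b hs, hws, one_mul]
      congr 1
      · congr 1
        rw [mul_sum]; exact sum_congr rfl fun g hg => by rw [hwA g hg]
      · unfold Ph
        rw [mul_sum]
        refine sum_congr rfl fun f hf => ?_
        rw [mul_sum]
        refine sum_congr rfl fun g hg => ?_
        unfold kk; rw [hwA f hf, hwA g hg]
        by_cases hfg : f = g
        · simp [hfg]
        · simp only [if_neg hfg, Pi.one_apply]; ring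
    obtain ⟨lamp, river, roof, jack, north, room, save⟩ := minimal week (F := insert s A) (U := U) (disjoint_insert_left.2 hd) (by
      intro f hf u hu
      rcases mem_insert.1 hf with rfl | hf
      · rw [pen f hs, pen u (disjoint_right.1 hd.2 hu)]; exact hU f (mem_insert_self _ _) u hu
      · exact bee f hf u hu) (w := w) (fun f => by simp only [w]; split_ifs <;> omega)
    refine ⟨lamp, river, fun g hg => ?_, fun g => ⟨(jack g).1.trans (rain g).1, (jack g).2.trans (rain g).2⟩, north, ?_⟩
    · exact (roof g hg).trans (pen g fun h => hg (mem_insert_of_mem h))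
    · rw [e1, e1, ← hY1] at room
      have hT : Ph 1 lamp A ≤ Ph 1 wall A := by
        by_contra hT
        push Not at hT
        have : (2 * phone + 1) ^ 2 * (Ph 1 wall A + 1) ≤ (2 * phone + 1) ^ 2 * Ph 1 lamp A := Nat.mul_le_mul_left _ hT
        nlinarith [Nat.zero_le ((2 * phone + 1) * ∑ g ∈ A, crl (lamp s) (lamp g))]
      have hY : ∑ g ∈ A, crl (lamp s) (lamp g) ≤ A.card := by
        rw [card_eq_sum_ones]
        exact sum_le_sum fun g hg => save s (mem_insert_self _ _) g (mem_insert_of_mem hg) (by rintro rfl; exact hs hg)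
      rw [dance 1 lamp hs]
      simp only [Pi.one_apply, one_mul]
      omega
end CQ
namespace CQ
open Classical in
noncomputable def lx (p q : Pt) : ZMod 2 := if p.1 < q.1 then 1 else 0
open Classical in
noncomputable def bl (p : Pt) (s : Pt × Pt) : ZMod 2 :=
  if ((s.1.1 < p.1 ∧ p.1 < s.2.1) ∨ (s.2.1 < p.1 ∧ p.1 < s.1.1)) ∧ o s.1 s.2 p * (s.2.1 - s.1.1) < 0 then 1 else 0
theorem queen : (1 : ZMod 2) + 1 = 0 := by decide
theorem truck {p q : Pt} (h : p.1 ≠ q.1) : lx p q = 1 + lx q p := by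
  unfold lx
  rcases lt_or_gt_of_ne h with h | h
  · rw [if_pos h, if_neg h.not_gt, add_zero]
  · rw [if_neg h.not_gt, if_pos h, queen]
theorem jump (p a b : Pt) : bl p (b, a) = bl p (a, b) := by
  unfold bl; congr 1; simp only [eq_iff_iff]
  rw [west a b p, or_comm]
  ring_nf
theorem boy {a b c d : Pt} (red : o a b c ≠ 0) (blue : o a b d ≠ 0) (dog : o c d a ≠ 0) (leg : o c d b ≠ 0)
    (hab : a.1 < b.1) (hcd : c.1 < d.1) (hac : a.1 < c.1) (hbc : b.1 ≠ c.1) (hbd : b.1 ≠ d.1) : (arm (a, b) (c, d) : ZMod 2) =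
    bl a (c, d) + bl b (c, d) + bl c (a, b) + bl d (a, b) + lx a c + lx b c + lx a d + lx b d := by
  have bird : (b.1 - a.1) * o c d a = (c.1 - a.1) * o a b d - (d.1 - a.1) * o a b c := by unfold o; ring
  have duck : (b.1 - a.1) * o c d b = (c.1 - b.1) * o a b d - (d.1 - b.1) * o a b c := by unfold o; ring
  have K3 : (d.1 - c.1) * o a b c = (a.1 - c.1) * o c d b - (b.1 - c.1) * o c d a := by unfold o; ring
  have hcross : (arm (a, b) (c, d) : ZMod 2) = if o a b c * o a b d < 0 ∧ o c d a * o c d b < 0 then 1 else 0 := by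
    unfold arm Cr Cross; split_ifs <;> simp
  rw [hcross]
  unfold lx bl
  simp only
  have hba : 0 < b.1 - a.1 := by linarith
  have hdc : 0 < d.1 - c.1 := by linarith
  have sn : ∀ {x y : ℝ}, 0 < y → (x * y < 0 ↔ x < 0) := fun hy => by
    rw [mul_neg_iff]; constructor
    · rintro (⟨_, h⟩ | ⟨h, _⟩) <;> linarith
    · exact fun h => Or.inr ⟨h, hy⟩
  simp only [sn hba, sn hdc]
  generalize o a b c = p at *
  generalize o a b d = q at *
  generalize o c d a = r at *
  generalize o c d b = s at *
  have river : 0 < c.1 - a.1 := by linarith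
  have roof : 0 < d.1 - a.1 := by linarith
  generalize a.1 = A at *
  generalize b.1 = B at *
  generalize c.1 = C at *
  generalize d.1 = D at *
  have np : ∀ {x y : ℝ}, x < 0 → x * y < 0 → 0 < y := fun hx h => by by_contra hy; nlinarith
  have pn : ∀ {x y : ℝ}, 0 < x → x * y < 0 → 0 < -y := fun hx h => by by_contra hy; nlinarith
  have cc : ∀ {x y : ℝ}, 0 < x → 0 < -y → x * y < 0 := fun hx hy => mul_neg_of_pos_of_neg hx (neg_pos.1 hy)
  have cn : ∀ {x y : ℝ}, 0 < -x → 0 < y → x * y < 0 := fun hx hy => mul_neg_of_neg_of_pos (neg_pos.1 hx) hy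
  have dp : ∀ {x y : ℝ}, 0 < x → 0 < x * y → 0 < y := fun hx h => (mul_pos_iff_of_pos_left hx).1 h
  clear hcross dog sn
  simp only [show ¬ C < A by linarith, show ¬ D < A by linarith, show A < C from hac, show A < D by linarith,
    false_and, and_false, or_false, if_false, if_true, true_and, and_true]
  rcases lt_or_gt_of_ne hbc with hbc | hbc
  · rw [if_neg]
    · simp [show B < C from hbc, show B < D by linarith, show ¬ C < B by linarith, show ¬ D < B by linarith]; decide
    · rintro ⟨e1, law⟩
      have ant : 0 < D - B := by linarith
      have word : 0 < C - B := by linarith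
      rcases lt_or_gt_of_ne red with box | box
      · have year := np box e1
        have rock : 0 < r := dp hba (by linarith [mul_pos river year, mul_pos roof (neg_pos.2 box)])
        have road : 0 < s := dp hba (by linarith [mul_pos word year, mul_pos ant (neg_pos.2 box)])
        linarith [mul_pos rock road]
      · have year := pn box e1
        have rock : 0 < -r := dp hba (by linarith [mul_pos river year, mul_pos roof box])
        have road : 0 < -s := dp hba (by linarith [mul_pos word year, mul_pos ant box])
        linarith [mul_pos rock road]
  rcases lt_or_gt_of_ne hbd with hbd | hbd
  · simp only [show C < B from hbc, show B < D from hbd, show ¬ B < C by linarith, show ¬ D < B by linarith,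
      false_and, and_false, or_false, if_false, if_true, true_and, and_true]
    have ant : 0 < D - B := by linarith
    rcases lt_or_gt_of_ne red with box | box <;> rcases lt_or_gt_of_ne leg with road | road
    · rw [if_pos, if_pos box, if_pos road]
      · decide
      · have hq : 0 < q := dp (x := B - C) (by linarith) (by linarith [mul_pos ant (neg_pos.2 box), mul_pos hba (neg_pos.2 road)])
        have hr : 0 < r := dp (x := B - C) (by linarith) (by linarith [mul_pos river (neg_pos.2 road), mul_pos hdc (neg_pos.2 box)])
        exact ⟨mul_neg_of_neg_of_pos box hq, mul_neg_of_pos_of_neg hr road⟩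
    · rw [if_neg, if_pos box, if_neg road.not_gt]
      · decide
      · rintro ⟨e1, law⟩
        have hq := np box e1
        have hr := pn road (mul_comm r s ▸ law)
        linarith [mul_pos river hq, mul_pos roof (neg_pos.2 box), mul_pos hba hr]
    · rw [if_neg, if_neg box.not_gt, if_pos road]
      · decide
      · rintro ⟨e1, law⟩
        have hq := pn box e1
        have hr := np road (mul_comm r s ▸ law)
        linarith [mul_pos river hq, mul_pos roof box, mul_pos hba hr]
    · rw [if_pos, if_neg box.not_gt, if_neg road.not_gt]
      · decide
      · have hq : 0 < -q := dp (x := B - C) (by linarith) (by linarith [mul_pos ant box, mul_pos hba road])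
        have hr : 0 < -r := dp (x := B - C) (by linarith) (by linarith [mul_pos river road, mul_pos hdc box])
        exact ⟨cc box hq, cn hr road⟩
  · simp only [show C < B by linarith, show D < B from hbd, show ¬ B < C by linarith, show ¬ B < D by linarith,
      false_and, and_false, if_false, true_and, or_self]
    have word : 0 < B - C := by linarith
    have ant : 0 < B - D := by linarith
    rcases lt_or_gt_of_ne red with box | box <;> rcases lt_or_gt_of_ne blue with year | year
    · rw [if_neg (fun h => absurd (np box h.1) year.not_gt), if_pos box, if_pos year]; decide
    · rw [if_pos, if_pos box, if_neg year.not_gt]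
      · decide
      · have hr : 0 < r := dp hba (by linarith [mul_pos river year, mul_pos roof (neg_pos.2 box)])
        have hs : 0 < -s := dp hba (by linarith [mul_pos word year, mul_pos ant (neg_pos.2 box)])
        exact ⟨mul_neg_of_neg_of_pos box year, cc hr hs⟩
    · rw [if_pos, if_neg box.not_gt, if_pos year]
      · decide
      · have hr : 0 < -r := dp hba (by linarith [mul_pos river (neg_pos.2 year), mul_pos roof box])
        have hs : 0 < s := dp hba (by linarith [mul_pos word (neg_pos.2 year), mul_pos ant box])
        exact ⟨mul_neg_of_pos_of_neg box year, cn hr hs⟩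
    · rw [if_neg (fun h => absurd (pn box h.1) (by linarith)), if_neg box.not_gt, if_neg year.not_gt]; decide
def Gp (a b c d : Pt) : Prop := (a.1 ≠ c.1 ∧ a.1 ≠ d.1 ∧ b.1 ≠ c.1 ∧ b.1 ≠ d.1) ∧
  (a ≠ b → a.1 ≠ b.1 ∧ o a b c ≠ 0 ∧ o a b d ≠ 0) ∧ (c ≠ d → c.1 ≠ d.1 ∧ o c d a ≠ 0 ∧ o c d b ≠ 0)
theorem spend {a b c d : Pt} (h : Gp a b c d) : (arm (a, b) (c, d) : ZMod 2) =
    bl a (c, d) + bl b (c, d) + bl c (a, b) + bl d (a, b) + lx a c + lx b c + lx a d + lx b d := by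
  have bz : ∀ p a : Pt, bl p (a, a) = 0 := fun p a => by
    unfold bl; rw [if_neg]; rintro ⟨_, h⟩; simp at h
  obtain ⟨⟨red, blue, dog, leg⟩, month, gold⟩ := h
  by_cases hab : a = b
  · subst hab
    rw [coast (by intro h; exact h.ne.1 rfl), bz, bz]
    linear_combination (norm := (ring_nf; reduce_mod_char))
  by_cases hcd : c = d
  · subst hcd
    rw [coast (by intro h; exact h.ne.2.1 rfl), bz, bz]
    linear_combination (norm := (ring_nf; reduce_mod_char))
  obtain ⟨box, year, rock⟩ := month hab
  obtain ⟨road, song, cable⟩ := gold hcd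
  have x1s : ∀ a b c d : Pt, arm (b, a) (c, d) = arm (a, b) (c, d) := fun a b c d => by unfold arm Cr; rw [shadow]
  have x1t : ∀ a b c d : Pt, arm (a, b) (d, c) = arm (a, b) (c, d) := fun a b c d => by unfold arm Cr; rw [audio]
  clear month gold bz
  have on : ∀ {a b c : Pt}, o a b c ≠ 0 → o b a c ≠ 0 := fun h => by rw [west]; exact neg_ne_zero.2 h
  wlog green : a.1 < b.1 generalizing a b
  · have := this dog leg red blue (Ne.symm hab) box.symm (on year) (on rock) cable song (lt_of_le_of_ne (not_lt.1 green) box.symm)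
    rw [x1s, jump c, jump d] at this
    rw [this]; ring
  wlog orange : c.1 < d.1 generalizing c d
  · have := this (Ne.symm hcd) road.symm blue red leg dog rock year (on song) (on cable) (lt_of_le_of_ne (not_lt.1 orange) road.symm)
    rw [x1t, jump a, jump b] at this
    rw [this]; ring
  rcases lt_or_gt_of_ne red with purple | purple
  · exact boy year rock song cable green orange purple dog leg
  · have := boy song cable year rock orange green purple blue.symm leg.symm
    rw [x1_comm, this, truck red, truck blue, truck dog, truck leg]
    linear_combination (norm := (ring_nf; reduce_mod_char))
noncomputable def bL (p : Pt) (l : List Pt) : ZMod 2 := ((sg l).map (bl p)).sum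
def GP (l m : List Pt) : Prop := ∀ s ∈ sg l, ∀ t ∈ sg m, Gp s.1 s.2 t.1 t.2
theorem girl (a b : Pt) : ∀ (m : List Pt) (c : Pt), (∀ t ∈ sg (c :: m), Gp a b t.1 t.2) → (sc (a, b) (sg (c :: m)) : ZMod 2) =
    bL a (c :: m) + bL b (c :: m) + bl c (a, b) + bl (m.getLastD c) (a, b) + lx a c + lx b c + lx a (m.getLastD c) + lx b (m.getLastD c)
  | [], c, _ => by
    simp only [sg, sc, bL, List.map_nil, List.sum_nil, List.getLastD_nil, Nat.cast_zero]
    linear_combination (norm := (ring_nf; reduce_mod_char))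
  | d :: m, c, h => by
    have ih := girl a b m d fun t ht => h t (by rw [door]; exact mem_cons_of_mem _ ht)
    have sun := spend (h (c, d) (by rw [door]; exact mem_cons_self))
    unfold sc bL at *
    rw [door, map_cons, map_cons, map_cons, sum_cons, sum_cons, sum_cons, Nat.cast_add, sun, ih, getLastD_cons]
    linear_combination (norm := (ring_nf; reduce_mod_char))
theorem man (m : List Pt) (c : Pt) : ∀ (l : List Pt) (a : Pt), GP (a :: l) (c :: m) → (crl (a :: l) (c :: m) : ZMod 2) =
    bL a (c :: m) + bL (l.getLastD a) (c :: m) + bL c (a :: l) + bL (m.getLastD c) (a :: l) + lx a c + lx (l.getLastD a) c + lx a (m.getLastD c) + lx (l.getLastD a) (m.getLastD c)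
  | [], a, _ => by
    rw [noise]
    simp only [sg, bL, List.map_nil, List.sum_nil, List.getLastD_nil, Nat.cast_zero]
    linear_combination (norm := (ring_nf; reduce_mod_char))
  | b :: l, a, h => by
    have ih := man m c l b fun t ht => h t (by rw [door]; exact mem_cons_of_mem _ ht)
    have sun := girl a b m c (h (a, b) (by rw [door]; exact mem_cons_self))
    rw [earth, Nat.cast_add, sun, ih, getLastD_cons]
    have e : ∀ p, bL p (a :: b :: l) = bl p (a, b) + bL p (b :: l) := fun p => by unfold bL; simp [door]
    rw [e, e]
    linear_combination (norm := (ring_nf; reduce_mod_char))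
theorem waste (α β : Fin 3 → Pt) (P : Fin 3 → Fin 3 → List Pt) (hP : ∀ i j, (P i j).getLastD (α i) = β j)
    (hb : ∀ i sky, i ≠ sky → (β i).1 ≠ (β sky).1)
    (hab : ∀ i j, (α i).1 ≠ (β j).1)
    (hG : ∀ i sky j cup, i ≠ sky → j ≠ cup → GP (α i :: P i j) (α sky :: P sky cup)) :
    ∃ i sky j cup, i ≠ sky ∧ j ≠ cup ∧ crl (α i :: P i j) (α sky :: P sky cup) ≠ 0 := by
  by_contra hc
  push Not at hc
  have key : ∀ i sky j cup, i ≠ sky → j ≠ cup → (0 : ZMod 2) = bL (α i) (α sky :: P sky cup) + bL (β j) (α sky :: P sky cup) + bL (α sky) (α i :: P i j)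
     + bL (β cup) (α i :: P i j) + lx (α i) (α sky) + (1 + lx (α sky) (β j)) + lx (α i) (β cup) + lx (β j) (β cup) := by
    intro i sky j cup hi hj
    have := man _ _ _ _ (hG i sky j cup hi hj)
    rw [hc i sky j cup hi hj, hP, hP, truck (hab sky j).symm] at this
    exact_mod_cast this
  have iron : (0 : Fin 3) ≠ 1 := by decide
  have berry : (0 : Fin 3) ≠ 2 := by decide
  have garden : (1 : Fin 3) ≠ 2 := by decide
  have K : ∀ i sky, i ≠ sky → _ := fun i sky h => congrArg₂ (· + ·) (congrArg₂ (· + ·) (congrArg₂ (· + ·) (key i sky _ _ h iron) (key i sky _ _ h iron.symm))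
    (congrArg₂ (· + ·) (key i sky _ _ h berry) (key i sky _ _ h berry.symm))) (congrArg₂ (· + ·) (key i sky _ _ h garden) (key i sky _ _ h garden.symm))
  have week := K 0 1 iron
  have pen := K 0 2 berry
  have rain := K 1 2 garden
  simp only [truck (hb 1 0 iron.symm), truck (hb 2 0 berry.symm), truck (hb 2 1 garden.symm)] at week pen rain
  have : (0 : ZMod 2) = 1 := by
    linear_combination (norm := (ring_nf; reduce_mod_char)) week + pen + rain
  exact absurd this (by decide)
end CQ
namespace CQ
open Filter Topology
theorem pert {ι : Type*} {J : Set ι} (hJ : J.Finite) (q : ι → Pt) {ε : ℝ} (hε : 0 < ε) :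
    ∃ φ : ι → Pt, (∀ j ∈ J, dist (φ j) (q j) < ε) ∧ Gen (φ '' J) ∧ InjOn φ J := by
  obtain ⟨φ, red, blue, dog, -⟩ := gen_many (F := fun i => 𝓝 (q i)) (S := ∅) Set.finite_empty
    ⟨by simp, by simp, by simp⟩ hJ (fun j _ A hA => by
      obtain ⟨U, hU, ho, hm⟩ := mem_nhds_iff.1 hA
      exact ⟨U, ho, ⟨_, hm⟩, hU⟩) (A := {φ | ∀ j ∈ J, dist (φ j) (q j) < ε})
    ((eventually_all_finite hJ).2 fun j _ => (Filter.tendsto_eval_pi (fun i => 𝓝 (q i)) j).eventually (Metric.ball_mem_nhds (q j) hε))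
  exact ⟨φ, red, by simpa using blue, dog⟩
theorem pt_mem {S : Set Pt} (hS : Convex ℝ S) {a b : Pt} (ha : a ∈ S) (hb : b ∈ S) {θ : ℝ} (sun : 0 ≤ θ) (red : θ ≤ 1) : pt a b θ ∈ S := by
  have := hS ha hb (sub_nonneg.2 red) sun (by ring)
  convert this using 1
  ext <;> simp [pt] <;> ring
theorem near {K : Set Pt} {x y war ice : Pt} {ε θ : ℝ} (hx : x ∈ K) (h : dist x y < ε) (red : dist war x < ε) (blue : dist ice y < ε)
    (dog : 0 ≤ θ) (leg : θ ≤ 1) : pt war ice θ ∈ thickening (2 * ε) K := by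
  refine mem_thickening_iff.2 ⟨x, hx, pt_mem (convex_ball x (2 * ε)) (a := war) (b := ice) ?_ ?_ dog leg⟩
  · rw [Metric.mem_ball]; linarith [dist_nonneg (x := x) (y := y)]
  · rw [Metric.mem_ball]; linarith [dist_triangle ice y x, dist_comm x y]
theorem chain {K : Set Pt} (hK : IsPreconnected K) {ε : ℝ} (hε : 0 < ε) {x y : Pt} (hx : x ∈ K) (hy : y ∈ K) :
    ∃ l : List Pt, (x :: l).Nodup ∧ l.getLastD x = y ∧ (∀ z ∈ x :: l, z ∈ K) ∧ ∀ s ∈ sg (x :: l), dist s.1 s.2 < ε := by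
  have : Relation.ReflTransGen (fun a b => b ∈ K ∧ a ∈ K ∧ dist a b < ε) x y := by
    refine hK.induction₂ (fun a b => Relation.ReflTransGen (fun a b => b ∈ K ∧ a ∈ K ∧ dist a b < ε) a b) ?_ ?_ ?_ hx hy
    · intro a ha
      filter_upwards [self_mem_nhdsWithin, nhdsWithin_le_nhds (Metric.ball_mem_nhds a hε)] with b hb hab
      exact .single ⟨hb, ha, by rwa [dist_comm]⟩
    · exact fun a b c _ _ _ => .trans
    · intro a b _ _ h
      induction h with
      | refl => exact .refl
      | tail _ blue ih => exact .head ⟨blue.2.1, blue.1, by rw [dist_comm]; exact blue.2.2⟩ (ih blue.2.1)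
  induction this using Relation.ReflTransGen.head_induction_on with
  | refl => exact ⟨[], by simp, rfl, by simpa using hy, by simp [sg]⟩
  | @head a b hab _ ih =>
    obtain ⟨l, red, blue, dog, leg⟩ := ih hab.1
    by_cases ha : a ∈ b :: l
    · obtain ⟨L, R, hLR⟩ := List.append_of_mem ha
      rw [hLR] at red dog leg
      refine ⟨R, red.of_append_right, ?_, fun z hz => dog z (by simp only [mem_append]; exact Or.inr hz), fun s hs => leg s ?_⟩
      · have e := congrArg List.getLast? hLR
        rw [List.getLast?_append_of_ne_nil _ (by simp), List.getLast?_cons, List.getLast?_cons, ← List.getLastD_eq_getLast?, ← List.getLastD_eq_getLast?, blue] at e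
        exact (Option.some.inj e).symm
      · rw [bike]; exact List.mem_append_right _ hs
    · refine ⟨b :: l, nodup_cons.2 ⟨ha, red⟩, by rw [getLastD_cons, blue], ?_, ?_⟩
      · intro z hz
        rcases mem_cons.1 hz with rfl | hz
        · exact hab.2.1
        · exact dog z hz
      · intro s hs
        rw [door] at hs
        rcases mem_cons.1 hs with rfl | hs
        · exact hab.2.2
        · exact leg s hs
theorem thick {ι : Type*} [Finite ι] {S T : ι → Set Pt} {p : ι → Prop} (h : ∀ i, p i → IsCompact (S i) ∧ IsCompact (T i) ∧ Disjoint (S i) (T i)) :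
    ∃ ε > 0, ∀ i, p i → Disjoint (thickening (2 * ε) (S i)) (thickening (2 * ε) (T i)) := by
  have : ∀ᶠ ε in 𝓝[>] (0 : ℝ), ∀ i, p i → Disjoint (thickening (2 * ε) (S i)) (thickening (2 * ε) (T i)) := by
    refine eventually_all.2 fun i => ?_
    by_cases hp : p i
    · obtain ⟨δ, hδ, hd⟩ := (h i hp).2.2.exists_thickenings (h i hp).1 (h i hp).2.1.isClosed
      filter_upwards [Ioo_mem_nhdsGT (half_pos hδ)] with ε hε _
      exact hd.mono (Metric.thickening_mono (by linarith [hε.2]) _) (Metric.thickening_mono (by linarith [hε.2]) _)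
    · exact Eventually.of_forall fun _ h => absurd h hp
  obtain ⟨ε, red, blue⟩ := (this.and self_mem_nhdsWithin).exists
  exact ⟨ε, blue, red⟩
theorem lose (α β : Fin 3 → Pt) (K : Fin 3 → Fin 3 → Set Pt) (hc : ∀ i j, IsCompact (K i j)) (hK : ∀ i j, IsPreconnected (K i j))
    (hα : ∀ i j, α i ∈ K i j) (hβ : ∀ i j, β j ∈ K i j) : ∃ i sky j cup, i ≠ sky ∧ j ≠ cup ∧ (K i j ∩ K sky cup).Nonempty := by
  by_contra hcon
  push Not at hcon
  have hd : ∀ {i sky j cup}, i ≠ sky → j ≠ cup → ∀ {a b}, a ∈ K i j → b ∈ K sky cup → a ≠ b := fun {i sky j cup} hi hj {a b} ha hb h =>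
    Set.eq_empty_iff_forall_notMem.1 (hcon i sky j cup hi hj) a ⟨ha, h ▸ hb⟩
  obtain ⟨ε, hε, hth⟩ := thick (ι := (Fin 3 × Fin 3) × (Fin 3 × Fin 3)) (S := fun x => K x.1.1 x.1.2) (T := fun x => K x.2.1 x.2.2)
    (p := fun x => x.1.1 ≠ x.2.1 ∧ x.1.2 ≠ x.2.2) fun x hx => ⟨hc _ _, hc _ _, Set.disjoint_iff_inter_eq_empty.2 (hcon _ _ _ _ hx.1 hx.2)⟩
  choose l red blue dog leg using fun i j => chain (hK i j) hε (hα i j) (hβ i j)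
  have hJ : {z | ∃ i j, z ∈ α i :: l i j}.Finite := by
    have : {z | ∃ i j, z ∈ α i :: l i j} = ⋃ i, ⋃ j, {z | z ∈ α i :: l i j} := by ext; simp
    rw [this]; exact finite_iUnion fun i => finite_iUnion fun j => finite_toSet _
  obtain ⟨φ, hill, park, train⟩ := pert hJ id hε
  have lst : ∀ (l : List Pt) a, (l.map φ).getLastD (φ a) = φ (l.getLastD a) := fun l => by
    induction l with
    | nil => intro; rfl
    | cons b l ih => intro a; rw [map_cons, getLastD_cons, getLastD_cons, ih]
  have mα : ∀ i, α i ∈ {z | ∃ i j, z ∈ α i :: l i j} := fun i => ⟨i, 0, mem_cons_self⟩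
  have mβ : ∀ j, β j ∈ {z | ∃ i j, z ∈ α i :: l i j} := fun j => ⟨0, j, by
    rw [← blue 0 j, mem_cons, ]
    rcases (l 0 j).eq_nil_or_concat with h | ⟨L, b, h⟩ <;> simp [h, List.getLastD_eq_getLast?]⟩
  have nx : ∀ {a b}, a ∈ {z | ∃ i j, z ∈ α i :: l i j} → b ∈ {z | ∃ i j, z ∈ α i :: l i j} → a ≠ b → (φ a).1 ≠ (φ b).1 :=
    fun ha hb hab => park.x2 _ ⟨_, ha, rfl⟩ _ ⟨_, hb, rfl⟩ fun h => hab (train ha hb h)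
  have no : ∀ {a b c}, a ∈ {z | ∃ i j, z ∈ α i :: l i j} → b ∈ {z | ∃ i j, z ∈ α i :: l i j} → c ∈ {z | ∃ i j, z ∈ α i :: l i j} →
      a ≠ b → a ≠ c → b ≠ c → o (φ a) (φ b) (φ c) ≠ 0 := fun ha hb hcc hab hac hbc =>
    park.o3 _ ⟨_, ha, rfl⟩ _ ⟨_, hb, rfl⟩ _ ⟨_, hcc, rfl⟩ (fun h => hab (train ha hb h)) (fun h => hac (train ha hcc h)) fun h => hbc (train hb hcc h)
  have oth : ∀ i : Fin 3, ∃ j, i ≠ j := by decide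
  have mp : ∀ {i j s}, s ∈ sg ((α i :: l i j).map φ) → ∃ a b, (a, b) ∈ sg (α i :: l i j) ∧ a ∈ α i :: l i j ∧ b ∈ α i :: l i j ∧ s = (φ a, φ b) := by
    intro i j s hs
    rw [pink] at hs
    obtain ⟨⟨a, b⟩, hab, rfl⟩ := List.mem_map.1 hs
    exact ⟨a, b, hab, (tree hab).1, (tree hab).2, rfl⟩
  obtain ⟨i, sky, j, cup, hi, hj, hcr⟩ := waste (fun i => φ (α i)) (fun j => φ (β j)) (fun i j => (l i j).map φ) (fun i j => by rw [lst, blue])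
    (fun j cup hj => nx (mβ j) (mβ cup) (hd (i := 0) (sky := 1) (by decide) hj (hβ _ _) (hβ _ _)))
    (fun i j => by
      obtain ⟨sky, hi⟩ := oth i
      obtain ⟨cup, hj⟩ := oth j
      exact nx (mα i) (mβ j) (hd hi hj.symm (hα _ _) (hβ _ _)))
    (by
      intro i sky j cup hi hj s hs t ht
      rw [← map_cons] at hs ht
      obtain ⟨a, b, -, ha, hb, rfl⟩ := mp hs
      obtain ⟨c, d, -, hcc, hdd, rfl⟩ := mp ht
      have q : ∀ {x y}, x ∈ α i :: l i j → y ∈ α sky :: l sky cup → x ≠ y := fun hx hy => hd hi hj (dog _ _ _ hx) (dog _ _ _ hy)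
      have ma : ∀ {x}, x ∈ α i :: l i j → x ∈ {z | ∃ i j, z ∈ α i :: l i j} := fun h => ⟨_, _, h⟩
      have mc : ∀ {x}, x ∈ α sky :: l sky cup → x ∈ {z | ∃ i j, z ∈ α i :: l i j} := fun h => ⟨_, _, h⟩
      refine ⟨⟨nx (ma ha) (mc hcc) (q ha hcc), nx (ma ha) (mc hdd) (q ha hdd), nx (ma hb) (mc hcc) (q hb hcc), nx (ma hb) (mc hdd) (q hb hdd)⟩,
        fun h => ?_, fun h => ?_⟩
      · have h : a ≠ b := fun e => h (by rw [e])
        exact ⟨nx (ma ha) (ma hb) h, no (ma ha) (ma hb) (mc hcc) h (q ha hcc) (q hb hcc), no (ma ha) (ma hb) (mc hdd) h (q ha hdd) (q hb hdd)⟩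
      · have h : c ≠ d := fun e => h (by rw [e])
        exact ⟨nx (mc hcc) (mc hdd) h, no (mc hcc) (mc hdd) (ma ha) h (q ha hcc).symm (q ha hdd).symm, no (mc hcc) (mc hdd) (ma hb) h (q hb hcc).symm (q hb hdd).symm⟩)
  refine hcr (angry fun s hs t ht hst => ?_)
  rw [← map_cons] at hs ht
  obtain ⟨a, b, hab, ha, hb, rfl⟩ := mp hs
  obtain ⟨c, d, hcd, hcc, hdd, rfl⟩ := mp ht
  obtain ⟨θ, η, box, year, rock, road, e⟩ := hst.pt
  refine Set.disjoint_left.1 (hth ((i, j), (sky, cup)) ⟨hi, hj⟩) (near (dog _ _ _ ha) (leg _ _ _ hab) (hill _ ⟨_, _, ha⟩) (hill _ ⟨_, _, hb⟩) box.le year.le) ?_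
  rw [e]
  exact near (dog _ _ _ hcc) (leg _ _ _ hcd) (hill _ ⟨_, _, hcc⟩) (hill _ ⟨_, _, hdd⟩) rock.le road.le
end CQ
namespace CQ
open Filter Topology
section host
variable {U : Type*} (γ : U → ℝ → Pt) (X : Set Pt)
def Hs (p q : X) : Prop := ∃ e, ∃ s ∈ Ioo (0 : ℝ) 1, ∃ t ∈ Ioo (0 : ℝ) 1, γ e s = p ∧ γ e t = q ∧
  ∀ u ∈ Ioo (min s t) (max s t), γ e u ∉ X
def Rr (e : U) : Set X := {x | (x : Pt) ∈ γ e '' Ioo 0 1}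
theorem hs_symm (p q : X) (h : Hs γ X p q) : Hs γ X q p := by
  obtain ⟨e, s, hs, t, ht, red, blue, dog⟩ := h
  exact ⟨e, t, ht, s, hs, blue, red, by rwa [min_comm, max_comm]⟩
def Qq (C : Set X) (z : Pt) : Prop := (∃ x ∈ C, (x : Pt) = z) ∨ ∃ e s t, s ∈ Ioo (0 : ℝ) 1 ∧ t ∈ Ioo (0 : ℝ) 1 ∧
  (∃ x ∈ C, (x : Pt) = γ e s) ∧ (∃ x ∈ C, (x : Pt) = γ e t) ∧ (∀ u ∈ Ioo s t, γ e u ∉ X) ∧ ∃ u ∈ Ioo s t, γ e u = z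
variable {γ X}
variable (hc : ∀ e, ContinuousOn (γ e) (Icc 0 1)) (hi : ∀ e, InjOn (γ e) (Icc 0 1))
include hc in
theorem hs_arc {C : Set X} {p q : X} (h : CP.Jn (Hs γ X) C p q) : ∃ K, IsCompact K ∧ IsPreconnected K ∧ (p : Pt) ∈ K ∧ (q : Pt) ∈ K ∧
    ∀ z ∈ K, Qq γ X C z := by
  obtain ⟨hp, h⟩ := h
  suffices q ∈ C ∧ ∃ K, IsCompact K ∧ IsPreconnected K ∧ (p : Pt) ∈ K ∧ (q : Pt) ∈ K ∧ ∀ z ∈ K, Qq γ X C z from this.2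
  induction h with
  | refl => exact ⟨hp, {(p : Pt)}, isCompact_singleton, isPreconnected_singleton, rfl, rfl, fun z hz => Or.inl ⟨p, hp, hz.symm⟩⟩
  | @tail b c _ hbc ih =>
    obtain ⟨hb, K, week, pen, rain, bee, seed⟩ := ih
    obtain ⟨⟨e, s, hs, t, ht, red, blue, dog⟩, hcC⟩ := hbc
    have hsub : Set.uIcc s t ⊆ Icc 0 1 := (Set.uIcc_subset_Icc (Ioo_subset_Icc_self hs) (Ioo_subset_Icc_self ht))
    have hcs := (hc e).mono hsub
    refine ⟨hcC, K ∪ γ e '' Set.uIcc s t, week.union (isCompact_uIcc.image_of_continuousOn hcs),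
      IsPreconnected.union (b : Pt) bee ⟨s, Set.left_mem_uIcc, red⟩ pen (isPreconnected_uIcc.image _ hcs), Or.inl rain,
      Or.inr ⟨t, Set.right_mem_uIcc, blue⟩, ?_⟩
    rintro z (hz | ⟨u, hu, rfl⟩)
    · exact seed z hz
    · have e1 : u = s → Qq γ X C (γ e u) := fun h => Or.inl ⟨b, hb, by rw [h, red]⟩
      have law : u = t → Qq γ X C (γ e u) := fun h => Or.inl ⟨c, hcC, by rw [h, blue]⟩
      by_cases word : u = s
      · exact e1 word
      by_cases ant : u = t
      · exact law ant
      rcases le_total s t with hst | hst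
      · rw [Set.uIcc_of_le hst] at hu
        rw [min_eq_left hst, max_eq_right hst] at dog
        exact Or.inr ⟨e, s, t, hs, ht, ⟨b, hb, red.symm⟩, ⟨c, hcC, blue.symm⟩, dog, u,
          ⟨lt_of_le_of_ne hu.1 (Ne.symm word), lt_of_le_of_ne hu.2 ant⟩, rfl⟩
      · rw [Set.uIcc_of_ge hst] at hu
        rw [min_eq_right hst, max_eq_left hst] at dog
        exact Or.inr ⟨e, t, s, ht, hs, ⟨c, hcC, blue.symm⟩, ⟨b, hb, red.symm⟩, dog, u,
          ⟨lt_of_le_of_ne hu.1 (Ne.symm ant), lt_of_le_of_ne hu.2 word⟩, rfl⟩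
variable (hX : ∀ e f, e ≠ f → ∀ z ∈ γ e '' Ioo 0 1, z ∈ γ f '' Ioo 0 1 → z ∈ X)
include hi hX in
theorem qq_disj {C D : Set X} {z : Pt} (red : Qq γ X C z) (blue : Qq γ X D z) : (C ∩ D).Nonempty := by
  rcases red with ⟨x, hx, rfl⟩ | ⟨e, s, t, hs, ht, ⟨x, hx, temple⟩, ⟨y, hy, hy1⟩, dog, u, hu, rfl⟩
  · rcases blue with ⟨y, hy, hxy⟩ | ⟨e, s, t, hs, ht, _, _, dog, u, hu, h⟩
    · exact ⟨x, hx, Subtype.ext hxy ▸ hy⟩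
    · exact absurd (h ▸ x.2) (dog u hu)
  · rcases blue with ⟨y, hy, hxy⟩ | ⟨fire, sand, cat, lion, book, ⟨war, price, hx1'⟩, ⟨ice, cost, hy1'⟩, h3', bean, wood, h⟩
    · exact absurd (hxy ▸ y.2) (dog u hu)
    · have m : u ∈ Ioo (0 : ℝ) 1 := ⟨hs.1.trans hu.1, hu.2.trans ht.2⟩
      have m' : bean ∈ Ioo (0 : ℝ) 1 := ⟨lion.1.trans wood.1, wood.2.trans book.2⟩
      by_cases hee : e = fire
      · subst hee
        have := hi e (Ioo_subset_Icc_self m') (Ioo_subset_Icc_self m) h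
        subst this
        have : s = sand := by
          rcases lt_trichotomy s sand with h | h | h
          · exact absurd (hx1' ▸ war.2) (dog sand ⟨h, wood.1.trans hu.2⟩)
          · exact h
          · exact absurd (temple ▸ x.2) (h3' s ⟨h, hu.1.trans wood.2⟩)
        subst this
        exact ⟨x, hx, (Subtype.ext (temple.trans hx1'.symm) : x = war) ▸ price⟩
      · exact absurd (hX e fire hee _ ⟨u, m, rfl⟩ ⟨bean, m', h⟩) (dog u hu)
include hc hi hX in
theorem hs_pl : CP.Pl33 (Hs γ X) := by
  intro α β C hJ
  choose K red blue dog leg month using fun i j => hs_arc hc (hJ i j)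
  obtain ⟨i, sky, j, cup, hi', hj, z, hz⟩ := lose (fun i => α i) (fun j => β j) K red blue dog leg
  exact ⟨i, sky, j, cup, hi', hj, qq_disj hi hX (month _ _ z hz.1) (month _ _ z hz.2)⟩
include hi in
theorem hs_cn (hf : X.Finite) (e : U) : CP.Cn (Hs γ X) (Rr γ X e) := by
  set T := {u | u ∈ Ioo (0 : ℝ) 1 ∧ γ e u ∈ X} with hT
  have hTf : T.Finite := Set.Finite.of_finite_image (hf.subset (by rintro _ ⟨u, hu, rfl⟩; exact hu.2))
    ((hi e).mono fun u hu => Ioo_subset_Icc_self hu.1)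
  have key : ∀ n, ∀ s t, ∀ hs : s ∈ T, ∀ ht : t ∈ T, s < t → (T ∩ Ioo s t).ncard = n →
      CP.Jn (Hs γ X) (Rr γ X e) ⟨_, hs.2⟩ ⟨_, ht.2⟩ := by
    intro n
    induction n using strong_induction_on with
    | _ n ih =>
      intro s t hs ht hst hn
      by_cases hne : (T ∩ Ioo s t).Nonempty
      · obtain ⟨u, hu, wood⟩ := hne
        have sm : ∀ A : Set ℝ, A ⊆ T ∩ Ioo s t → u ∉ A → A.ncard < n := fun A hA huA => by
          rw [← hn]; exact Set.ncard_lt_ncard ⟨hA, fun h => huA (h ⟨hu, wood⟩)⟩ (hTf.inter_of_left _)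
        refine (ih _ (sm _ ?_ ?_) s u hs hu wood.1 rfl).trans (ih _ (sm _ ?_ ?_) u t hu ht wood.2 rfl)
        · exact fun x hx => ⟨hx.1, hx.2.1, hx.2.2.trans wood.2⟩
        · exact fun h => lt_irrefl _ h.2.2
        · exact fun x hx => ⟨hx.1, wood.1.trans hx.2.1, hx.2.2⟩
        · exact fun h => lt_irrefl _ h.2.1
      · refine CP.Jn.single ⟨s, hs.1, rfl⟩ ⟨e, s, hs.1, t, ht.1, rfl, rfl, fun u hu hX => hne ⟨u, ?_⟩⟩ ⟨t, ht.1, rfl⟩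
        rw [min_eq_left hst.le, max_eq_right hst.le] at hu
        exact ⟨⟨⟨hs.1.1.trans hu.1, hu.2.trans ht.1.2⟩, hX⟩, hu⟩
  rintro ⟨p, hp⟩ ⟨s, hs, rfl⟩ ⟨q, hq⟩ ⟨t, ht, rfl⟩
  rcases lt_trichotomy s t with h | h | h
  · exact key _ s t ⟨hs, hp⟩ ⟨ht, hq⟩ h rfl
  · subst h; exact CP.Jn.refl ⟨s, hs, rfl⟩
  · exact CP.Jn.symm (hs_symm γ X) (key _ t s ⟨ht, hq⟩ ⟨hs, hp⟩ h rfl)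
end host
end CQ
namespace CQ
open Filter Topology
theorem meet {S : Set Pt} (hG : Gen S) {a b c d : Pt} (ha : a ∈ S) (hb : b ∈ S) (hc : c ∈ S) (hd : d ∈ S) (hab : a ≠ b) (hcd : c ≠ d)
    (hn : ¬ ((c = a ∨ c = b) ∧ (d = a ∨ d = b))) {θ η : ℝ} (t0 : 0 ≤ θ) (coach : θ ≤ 1) (film : 0 ≤ η) (e1 : η ≤ 1) (h : pt a b θ = pt c d η) :
    Cross a b c d ∨ ∃ z, (z = a ∨ z = b) ∧ (z = c ∨ z = d) ∧ pt a b θ = z := by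
  have aux : ∀ {a b d : Pt} {η : ℝ}, a ∈ S → b ∈ S → d ∈ S → a ≠ b → a ≠ d → b ≠ d → o a b (pt a d η) = 0 → pt a d η = a := by
    intro a b d η ha hb hd hab had hbd h
    rw [snow, wolf, mul_zero, zero_add] at h
    rcases mul_eq_zero.1 h with h | h
    · rw [h, apple]
    · exact absurd h (hG.o3 a ha b hb d hd hab had hbd)
  have cave : o a b (pt c d η) = 0 := by rw [← h, snow, wolf, paper]; ring
  have queen : o b a (pt c d η) = 0 := by rw [west, cave, neg_zero]
  have z3 : o c d (pt a b θ) = 0 := by rw [h, snow, wolf, paper]; ring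
  by_cases ca : c = a
  · subst ca
    have hdb : d ≠ b := fun h => hn ⟨.inl rfl, .inr h⟩
    exact Or.inr ⟨c, .inl rfl, .inl rfl, h.trans (aux hc hb hd hab hcd hdb.symm cave)⟩
  by_cases cb : c = b
  · subst cb
    have hda : d ≠ a := fun h => hn ⟨.inr rfl, .inl h⟩
    exact Or.inr ⟨c, .inr rfl, .inl rfl, h.trans (aux hc ha hd hab.symm hcd hda.symm queen)⟩
  by_cases da : d = a
  · subst da
    rw [← lawyer c d] at cave h
    exact Or.inr ⟨d, .inl rfl, .inr rfl, h.trans (aux hd hb hc hab hcd.symm (Ne.symm cb) cave)⟩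
  by_cases db : d = b
  · subst db
    rw [← lawyer c d] at queen h
    exact Or.inr ⟨d, .inr rfl, .inr rfl, h.trans (aux hd ha hc hab.symm hcd.symm (Ne.symm ca) queen)⟩
  left
  have key : ∀ {x y η : ℝ}, 0 ≤ η → η ≤ 1 → x ≠ 0 → y ≠ 0 → (1 - η) * x + η * y = 0 → x * y < 0 := by
    intro x y η sun red hx hy h
    by_contra hh
    have hp : 0 < x * y := lt_of_le_of_ne (not_lt.1 hh) (mul_ne_zero hx hy).symm
    have e1 : (1 - η) * (x * x) + η * (x * y) = 0 := by linear_combination x * h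
    have : 0 < x * x := mul_self_pos.2 hx
    rcases sun.eq_or_lt with h | h
    · subst h; linarith
    · have := mul_pos h hp
      have := mul_nonneg (sub_nonneg.2 red) ‹0 < x * x›.le
      linarith
  rw [snow] at cave z3
  exact ⟨key film e1 (hG.o3 a ha b hb c hc hab (Ne.symm ca) (Ne.symm cb)) (hG.o3 a ha b hb d hd hab (Ne.symm da) (Ne.symm db)) cave,
    key t0 coach (hG.o3 c hc d hd a ha hcd ca da) (hG.o3 c hc d hd b hb hcd cb db) z3⟩
theorem curve {S : Set Pt} (hG : Gen S) : ∀ (l : List Pt) (a b : Pt), (a :: b :: l).Nodup → (∀ z ∈ a :: b :: l, z ∈ S) → Simple (a :: b :: l) →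
    ∃ γ : ℝ → Pt, Continuous γ ∧ InjOn γ (Icc 0 1) ∧ γ 0 = a ∧ γ 1 = l.getLastD b ∧
      ∀ t ∈ Icc (0 : ℝ) 1, ∃ s ∈ sg (a :: b :: l), ∃ θ, 0 ≤ θ ∧ θ ≤ 1 ∧ γ t = pt s.1 s.2 θ := by
  have cp : ∀ a b : Pt, Continuous (pt a b) := fun a b => by unfold pt; fun_prop
  have inj : ∀ {a b : Pt} {x y : ℝ}, a ∈ S → b ∈ S → a ≠ b → pt a b x = pt a b y → x = y := by
    intro a b x y ha hb hab h
    have red := congrArg Prod.fst h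
    simp only [pt] at red
    have := hG.x2 a ha b hb hab
    have blue : (x - y) * (b.1 - a.1) = 0 := by linarith
    rcases mul_eq_zero.1 blue with h | h
    · linarith
    · exact absurd (by linarith) this
  intro l
  induction l with
  | nil =>
    intro a b hn hm _
    have hab : a ≠ b := by rintro rfl; simp at hn
    exact ⟨pt a b, cp a b, fun x _ y _ h => inj (hm a (by simp)) (hm b (by simp)) hab h, apple _ _, glass _ _,
      fun t ht => ⟨(a, b), by simp [sg], t, ht.1, ht.2, rfl⟩⟩
  | cons c l ih =>
    intro a b hn hm hs
    have hab : a ≠ b := by rintro rfl; simp at hn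
    have hn' := (nodup_cons.1 hn).2
    obtain ⟨γ, box, year, rock, road, song⟩ := ih b c hn' (fun z hz => hm z (mem_cons_of_mem _ hz))
      (fun s red t blue => hs s (by rw [door]; exact mem_cons_of_mem _ red) t (by rw [door]; exact mem_cons_of_mem _ blue))
    have key : ∀ x ∈ Icc (0 : ℝ) 1, ∀ y ∈ Icc (0 : ℝ) 1, pt a b x = γ y → x = 1 ∧ y = 0 := by
      intro x hx y hy h
      obtain ⟨⟨p, q⟩, lion, θ, t0, coach, e⟩ := song y hy
      have hpq := tree lion
      have cloud : a ∉ b :: c :: l := (nodup_cons.1 hn).1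
      have na : p ≠ a ∧ q ≠ a := ⟨by rintro rfl; exact cloud hpq.1, by rintro rfl; exact cloud hpq.2⟩
      have npq := cow hn' lion
      have := meet hG (hm a (by simp)) (hm b (by simp)) (hm p (mem_cons_of_mem _ hpq.1)) (hm q (mem_cons_of_mem _ hpq.2)) hab npq
        (by rintro ⟨red | red, blue | blue⟩
            · exact na.1 red
            · exact na.1 red
            · exact na.2 blue
            · exact npq (red.trans blue.symm)) hx.1 hx.2 t0 coach (h.trans e)
      rcases this with hc | ⟨z, hz1, mail, hz⟩
      · exact absurd hc (hs (a, b) (by rw [door]; exact mem_cons_self) (p, q) (by rw [door]; exact mem_cons_of_mem _ lion))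
      · have hzb : z = b := by
          rcases hz1 with rfl | rfl
          · rcases mail with h | h
            · exact absurd h.symm na.1
            · exact absurd h.symm na.2
          · rfl
        subst hzb
        refine ⟨inj (hm a (by simp)) (hm z (by simp)) hab (hz.trans (glass _ _).symm), year hy ⟨le_rfl, zero_le_one⟩ ?_⟩
        rw [← h, hz, rock]
    refine ⟨fun t => if t ≤ 1 / 2 then pt a b (2 * t) else γ (2 * t - 1), ?_, ?_, by simp [apple], ?_, ?_⟩
    · refine Continuous.if_le ((cp a b).comp (by fun_prop)) (box.comp (by fun_prop)) (by fun_prop) (by fun_prop) ?_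
      intro t ht
      rw [ht]; norm_num [glass, rock]
    · intro x hx y hy h
      simp only at h
      split_ifs at h with red blue blue
      · have := inj (hm a (by simp)) (hm b (by simp)) hab h; linarith
      · have := key _ ⟨by linarith [hx.1], by linarith⟩ _ ⟨by linarith, by linarith [hy.2]⟩ h; linarith
      · have := key _ ⟨by linarith [hy.1], by linarith⟩ _ ⟨by linarith, by linarith [hx.2]⟩ h.symm; linarith
      · have := year ⟨by linarith, by linarith [hx.2]⟩ ⟨by linarith, by linarith [hy.2]⟩ h; linarith
    · show (if (1 : ℝ) ≤ 1 / 2 then _ else _) = _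
      rw [if_neg (by norm_num), getLastD_cons, ← road]; norm_num
    · intro t ht
      simp only
      split_ifs with red
      · exact ⟨(a, b), by simp [door], 2 * t, by linarith [ht.1], by linarith, rfl⟩
      · obtain ⟨s, blue, dog⟩ := song (2 * t - 1) ⟨by linarith, by linarith [ht.2]⟩
        exact ⟨s, by rw [door]; exact mem_cons_of_mem _ blue, dog⟩
end CQ
namespace CQ
open Filter Topology
noncomputable def xpt (s t : Pt × Pt) : Pt := pt s.1 s.2 (o t.1 t.2 s.1 / (o t.1 t.2 s.1 - o t.1 t.2 s.2))
theorem xpt_eq {a b c d : Pt} (h : Cross a b c d) {θ η : ℝ} (sun : 0 ≤ θ) (red : θ ≤ 1) (e : pt a b θ = pt c d η) :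
    pt a b θ = xpt (a, b) (c, d) ∧ 0 < θ ∧ θ < 1 := by
  have z : (1 - θ) * o c d a + θ * o c d b = 0 := by rw [← snow, e, snow, wolf, paper]; ring
  have hc := h.2
  have hne : o c d a - o c d b ≠ 0 := fun hh => by
    rw [sub_eq_zero.1 hh] at hc; exact absurd (mul_self_nonneg _) (not_le.2 hc)
  refine ⟨?_, lt_of_le_of_ne sun ?_, lt_of_le_of_ne red ?_⟩
  · unfold xpt; congr 1; rw [eq_div_iff hne]; linear_combination -z
  · rintro rfl; simp at z; simp [z] at hc
  · rintro rfl; simp at z; simp [z] at hc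
open Classical in
theorem xx_card {A B : List (Pt × Pt)} (hA : A.Nodup) (hB : B.Nodup) :
    ((A.toFinset ×ˢ B.toFinset).filter fun q => Cr q.1 q.2).card = XX A B := by
  rw [card_filter, Finset.sum_product]
  unfold XX
  rw [← sum_toFinset _ hA]
  refine sum_congr rfl fun a _ => ?_
  unfold sc
  rw [← sum_toFinset _ hB]
  rfl
open Classical in
theorem draw {n : ℕ} {G : SimpleGraph (Fin n)} {b : G.edgeSet ⊕ Fin n → List Pt} (hb : SF b) {z : Fin n → Pt} (hz : Injective z)
    (hv : ∀ v, b (.inr v) = [z v])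
    (hend : ∀ e : G.edgeSet, ∃ u v, (e : Sym2 (Fin n)) = s(u, v) ∧ (b (.inl e)).head? = some (z u) ∧ (b (.inl e)).getLast? = some (z v)) :
    ∃ D : Drawing G, D.numCrossings ≤ ∑ e, ∑ f, if e = f then 0 else crl (b (.inl e)) (b (.inl f)) := by
  obtain ⟨hG, hS⟩ := hb
  have hcur : ∀ e : G.edgeSet, ∃ γ : ℝ → Pt, Continuous γ ∧ InjOn γ (Icc 0 1) ∧ (b (.inl e)).head? = some (γ 0) ∧
      (b (.inl e)).getLast? = some (γ 1) ∧ ∀ t ∈ Icc (0 : ℝ) 1, ∃ s ∈ sg (b (.inl e)), ∃ θ, 0 ≤ θ ∧ θ ≤ 1 ∧ γ t = pt s.1 s.2 θ := by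
    intro e
    obtain ⟨u, v, red, blue, dog⟩ := hend e
    have huv : u ≠ v := by
      have := e.2; rw [red] at this; exact G.ne_of_adj this
    have hnd := hG.nd (.inl e)
    have hm : ∀ w ∈ b (.inl e), w ∈ pts b := fun w hw => ⟨_, hw⟩
    have hs := hS (.inl e)
    generalize b (.inl e) = L at *
    match L with
    | [] => simp at blue
    | [a] =>
      simp at blue dog
      exact absurd (hz (blue.symm.trans dog)) huv
    | a :: c :: l =>
      obtain ⟨γ, box, year, rock, road, song⟩ := curve hG.gen l a c hnd hm hs
      exact ⟨γ, box, year, by simp [rock], by rw [List.getLast?_cons_cons, List.getLast?_cons, ← List.getLastD_eq_getLast?, road], song⟩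
  choose γ oil job pig uncle farm using hcur
  have two : ∀ {e x : G.edgeSet ⊕ Fin n}, e ≠ x → ∀ {s t}, s ∈ sg (b e) → t ∈ sg (b x) → ¬ ((t.1 = s.1 ∨ t.1 = s.2) ∧ (t.2 = s.1 ∨ t.2 = s.2)) := by
    rintro e x hex s t hs ht ⟨red, blue⟩
    have ms := tree hs
    have mt := tree ht
    refine cow (hG.nd x) ht (hG.shr e x hex _ ?_ mt.1 _ ?_ mt.2)
    · rcases red with h | h <;> rw [h]
      exacts [ms.1, ms.2]
    · rcases blue with h | h <;> rw [h]
      exacts [ms.1, ms.2]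
  have inl : ∀ {e f : G.edgeSet}, e ≠ f → (Sum.inl e : G.edgeSet ⊕ Fin n) ≠ Sum.inl f := fun h sea => h (Sum.inl.inj sea)
  have fA : ∀ e, ∀ t ∈ Icc (0 : ℝ) 1, γ e t ∈ pts b → γ e t ∈ b (.inl e) := by
    intro e t ht hp
    obtain ⟨s, hs, θ, t0, coach, h⟩ := farm e t ht
    have ms := tree hs
    by_cases red : γ e t = s.1
    · rw [red]; exact ms.1
    by_cases blue : γ e t = s.2
    · rw [blue]; exact ms.2
    have := hG.gen.o3 _ ⟨_, ms.1⟩ _ ⟨_, ms.2⟩ _ hp (cow (hG.nd _) hs) (Ne.symm red) (Ne.symm blue)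
    rw [h, snow, wolf, paper] at this
    simp at this
  have fI : ∀ e x, Sum.inl e ≠ x → ∀ t ∈ Ioo (0 : ℝ) 1, γ e t ∈ b (.inl e) → γ e t ∉ b x := by
    intro e x hx t ht red blue
    have book := Ioo_subset_Icc_self ht
    rcases hG.int _ _ hx _ red blue with h | h
    · rw [pig] at h
      exact ht.1.ne (job e ⟨le_rfl, zero_le_one⟩ book (Option.some.inj h))
    · rw [uncle] at h
      exact ht.2.ne' (job e ⟨zero_le_one, le_rfl⟩ book (Option.some.inj h))
  have fM : ∀ e f, e ≠ f → ∀ t ∈ Icc (0 : ℝ) 1, ∀ r ∈ Icc (0 : ℝ) 1, γ e t = γ f r →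
      (∃ σ ∈ sg (b (.inl e)), ∃ τ ∈ sg (b (.inl f)), Cr σ τ ∧ γ e t = xpt σ τ ∧ ∃ θ η, 0 < θ ∧ θ < 1 ∧ 0 < η ∧ η < 1 ∧
        γ e t = pt σ.1 σ.2 θ ∧ γ e t = pt τ.1 τ.2 η) ∨ (γ e t ∈ b (.inl e) ∧ γ e t ∈ b (.inl f)) := by
    intro e f hef t ht r hr h
    obtain ⟨s, hs, θ, t0, coach, red⟩ := farm e t ht
    obtain ⟨sand, lion, η, film, e1, blue⟩ := farm f r hr
    have ms := tree hs
    have light := tree lion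
    have hp : pt s.1 s.2 θ = pt sand.1 sand.2 η := by rw [← red, h, blue]
    rcases meet hG.gen ⟨_, ms.1⟩ ⟨_, ms.2⟩ ⟨_, light.1⟩ ⟨_, light.2⟩ (cow (hG.nd _) hs) (cow (hG.nd _) lion) (two (inl hef) hs lion) t0 coach film e1 hp with hc | ⟨w, green, orange, purple⟩
    · obtain ⟨pear, post, news⟩ := xpt_eq hc t0 coach hp
      obtain ⟨-, night, forest⟩ := xpt_eq hc.symm film e1 hp.symm
      exact Or.inl ⟨s, hs, sand, lion, hc, red.trans pear, θ, η, post, news, night, forest, red, by rw [h, blue]⟩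
    · right
      rw [red, purple]
      constructor
      · rcases green with h | h <;> rw [h]
        exacts [ms.1, ms.2]
      · rcases orange with h | h <;> rw [h]
        exacts [light.1, light.2]
  have sub := @Ioo_subset_Icc_self ℝ _ 0 1
  let D : Drawing G := {
    pos := z
    pos_inj := hz
    curve := γ
    curve_cont := fun e => (oil e).continuousOn
    curve_inj := job
    curve_ends := fun e => by
      obtain ⟨u, v, red, blue, dog⟩ := hend e
      exact ⟨u, v, red, Option.some.inj ((pig e).symm.trans blue), Option.some.inj ((uncle e).symm.trans dog)⟩
    curve_avoid := by
      rintro e t ht ⟨w, hw⟩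
      have m : γ e t ∈ b (.inr w) := by rw [hv, ← hw]; simp
      exact fI e (.inr w) (by simp) t ht (fA e t (sub ht) ⟨_, m⟩) m
    curve_finite_inter := by
      intro e f hef
      refine Set.Finite.subset ((pts_fin b).union (((finite_toSet (sg (b (.inl e)))).prod (finite_toSet (sg (b (.inl f))))).image
        fun q => xpt q.1 q.2)) ?_
      rintro _ ⟨⟨t, ht, rfl⟩, r, hr, h⟩
      rcases fM e f hef t ht r hr h.symm with ⟨σ, red, τ, blue, -, dog, -⟩ | h
      · exact Or.inr ⟨(σ, τ), ⟨red, blue⟩, dog.symm⟩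
      · exact Or.inl ⟨_, h.1⟩
    no_triple_point := by
      rintro e f g hef hfg heg p ⟨⟨t, ht, rfl⟩, ⟨r, hr, h⟩, ⟨q, hq, sea⟩⟩
      rcases fM e f hef t (sub ht) r (sub hr) h.symm with ⟨σ, red, τ, blue, dog, -, θ, η, pear, post, news, night, forest, q6⟩ | h
      · obtain ⟨ρ, m, ζ, -, -, month⟩ := farm g q (sub hq)
        have mσ := tree red
        have mτ := tree blue
        have mρ := tree m
        refine hG.gen.off ⟨_, mσ.1⟩ ⟨_, mσ.2⟩ ⟨_, mτ.1⟩ ⟨_, mτ.2⟩ ⟨_, mρ.1⟩ ⟨_, mρ.2⟩ dog (cow (hG.nd _) m) pear post news night (forest.symm.trans q6)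
          (two (inl heg) red m) (two (inl hfg) blue m) ?_
        rw [← forest, ← sea, month, snow, wolf, paper]; ring
      · exact fI e _ (inl hef) t ht h.1 h.2 }
  refine ⟨D, ?_⟩
  let T : Finset (Sym2 G.edgeSet × Pt) := Finset.univ.biUnion fun e => Finset.univ.biUnion fun f => if e = f then ∅ else
    (((sg (b (.inl e))).toFinset ×ˢ (sg (b (.inl f))).toFinset).filter fun q => Cr q.1 q.2).image fun q => (s(e, f), xpt q.1 q.2)
  have hT : D.crossings ⊆ T := by
    rintro ⟨q, p⟩ ⟨e, f, hef, rfl, ⟨t, ht, rfl⟩, ⟨r, hr, h⟩⟩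
    simp only [T, Finset.coe_biUnion, mem_iUnion, Finset.mem_coe, mem_univ, true_and]
    refine ⟨e, trivial, f, trivial, ?_⟩
    rw [if_neg hef, mem_image]
    rcases fM e f hef t (sub ht) r (sub hr) h.symm with ⟨σ, red, τ, blue, dog, leg, -⟩ | h
    · exact ⟨(σ, τ), mem_filter.2 ⟨mem_product.2 ⟨mem_toFinset.2 red, mem_toFinset.2 blue⟩, dog⟩, by rw [← leg]⟩
    · exact absurd h.2 (fI e _ (inl hef) t ht h.1)
  have : D.numCrossings ≤ T.card := by
    rw [← Set.ncard_coe_finset]; exact Set.ncard_le_ncard hT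
  refine this.trans (Finset.card_biUnion_le.trans (sum_le_sum fun e _ => Finset.card_biUnion_le.trans (sum_le_sum fun f _ => ?_)))
  split_ifs with h
  · simp
  · exact card_image_le.trans (xx_card (guard (hG.nd _)) (guard (hG.nd _))).le
end CQ
namespace CQ
open Filter Topology
theorem exit {g : ℝ → ℝ} {a b r : ℝ} (hab : a ≤ b) (hg : ContinuousOn g (Icc a b)) (ha : g a < r) (hb : r < g b) :
    ∃ s, a < s ∧ s < b ∧ g s = r ∧ ∀ t, s ≤ t → t ≤ b → r ≤ g t := by
  have hK : IsCompact (Icc a b ∩ g ⁻¹' {r}) := isCompact_Icc.of_isClosed_subset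
    (hg.preimage_isClosed_of_isClosed isClosed_Icc isClosed_singleton) Set.inter_subset_left
  obtain ⟨x, hx, price⟩ := intermediate_value_Icc hab hg ⟨ha.le, hb.le⟩
  obtain ⟨s, ⟨hs, lion⟩, hm⟩ := hK.exists_isGreatest ⟨x, hx, price⟩
  have lion : g s = r := lion
  refine ⟨s, lt_of_le_of_ne hs.1 ?_, lt_of_le_of_ne hs.2 ?_, lion, fun t red blue => ?_⟩
  · rintro rfl; linarith
  · rintro rfl; linarith
  · by_contra h
    push Not at h
    obtain ⟨y, hy, cost⟩ := intermediate_value_Icc blue (hg.mono (Set.Icc_subset_Icc_left (hs.1.trans red))) ⟨h.le, hb.le⟩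
    have := hm ⟨⟨hs.1.trans (red.trans hy.1), hy.2⟩, cost⟩
    have : t = s := le_antisymm (hy.1.trans this) red
    rw [this] at h; linarith
theorem cut {γ : ℝ → Pt} {r : ℝ} (hr : 0 < r) (hc : ContinuousOn γ (Icc 0 1)) (hd : 2 * r < dist (γ 0) (γ 1)) :
    ∃ s t, 0 < s ∧ s < t ∧ t < 1 ∧ dist (γ s) (γ 0) = r ∧ dist (γ t) (γ 1) = r ∧
      ∀ x ∈ Icc s t, r ≤ dist (γ x) (γ 0) ∧ r ≤ dist (γ x) (γ 1) := by
  obtain ⟨s, make, fuel, gas, desert⟩ := exit (g := fun t => dist (γ t) (γ 0)) zero_le_one ((continuous_id.dist continuous_const).comp_continuousOn hc) (by simpa using hr)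
    (r := r) (by rw [dist_comm]; linarith)
  obtain ⟨t, t0, coach, build, burn⟩ := exit (g := fun t => dist (γ (1 - t)) (γ 1)) (a := 0) (b := 1 - s) (r := r) (by linarith)
    ((continuous_id.dist continuous_const).comp_continuousOn (hc.comp (f := fun t => 1 - t) (s := Icc 0 (1 - s)) (by fun_prop)
      fun x hx => ⟨by linarith [hx.2], by linarith [hx.1]⟩)) (by simpa using hr)
    (by rw [sub_sub_cancel]; linarith [dist_triangle (γ 0) (γ s) (γ 1), dist_comm (γ 0) (γ s)])
  refine ⟨s, 1 - t, make, by linarith, by linarith, gas, build, fun x hx => ⟨desert x hx.1 (by linarith [hx.2]), ?_⟩⟩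
  have := burn (1 - x) (by linarith [hx.2]) (by linarith [hx.1])
  rwa [sub_sub_cancel] at this
theorem dist_pt (a b : Pt) {θ : ℝ} (h : 0 ≤ θ) : dist (pt a b θ) a = θ * dist b a := by
  have : pt a b θ - a = θ • (b - a) := by ext <;> simp [pt]
  rw [dist_eq_norm, dist_eq_norm, this, norm_smul, Real.norm_of_nonneg h]
theorem near2 {x y war ice : Pt} {ε θ : ℝ} (red : dist war x < ε) (blue : dist ice y < ε) (dog : 0 ≤ θ) (leg : θ ≤ 1) :
    dist (pt war ice θ) (pt x y θ) < 2 * ε := by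
  have := pt_mem (convex_ball (0 : Pt) ε) (a := war - x) (b := ice - y) (by simpa [dist_eq_norm] using red) (by simpa [dist_eq_norm] using blue) dog leg
  have e : pt war ice θ - pt x y θ = pt (war - x) (ice - y) θ := by ext <;> simp [pt] <;> ring
  rw [dist_eq_norm, e]
  rw [mem_ball_zero_iff] at this
  linarith [norm_nonneg (pt (war - x) (ice - y) θ)]
section
variable {n : ℕ} {G : SimpleGraph (Fin n)} (D : Drawing G)
theorem rad : ∃ r > 0, (∀ u v, u ≠ v → 2 * r < dist (D.pos u) (D.pos v)) ∧
    ∀ (e : G.edgeSet) w, w ∉ (e : Sym2 (Fin n)) → ∀ x ∈ Icc (0 : ℝ) 1, r ≤ dist (D.curve e x) (D.pos w) := by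
  have red : ∀ᶠ r in 𝓝[>] (0 : ℝ), ∀ u v, u ≠ v → 2 * r < dist (D.pos u) (D.pos v) := by
    refine eventually_all.2 fun u => eventually_all.2 fun v => ?_
    by_cases h : u = v
    · exact .of_forall fun _ sea => absurd h sea
    · have := dist_pos.2 (D.pos_inj.ne h)
      filter_upwards [Ioo_mem_nhdsGT (half_pos this)] with r hr _
      linarith [hr.2]
  have blue : ∀ᶠ r in 𝓝[>] (0 : ℝ), ∀ (e : G.edgeSet) w, w ∉ (e : Sym2 (Fin n)) → ∀ x ∈ Icc (0 : ℝ) 1, r ≤ dist (D.curve e x) (D.pos w) := by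
    refine eventually_all.2 fun e => eventually_all.2 fun w => ?_
    by_cases h : w ∈ (e : Sym2 (Fin n))
    · exact .of_forall fun _ sea => absurd h sea
    · have hm : D.pos w ∉ D.curve e '' Icc 0 1 := by
        rintro ⟨x, hx, hxw⟩
        obtain ⟨u, v, e1, law, game⟩ := D.curve_ends e
        rw [e1] at h
        rcases eq_or_lt_of_le hx.1 with rfl | sun
        · exact h (by rw [D.pos_inj (hxw.symm.trans law)]; simp)
        rcases eq_or_lt_of_le hx.2 with rfl | red
        · exact h (by rw [D.pos_inj (hxw.symm.trans game)]; simp)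
        exact D.curve_avoid e x ⟨sun, red⟩ ⟨w, hxw.symm⟩
      have := ((isCompact_Icc.image_of_continuousOn (D.curve_cont e)).isClosed.notMem_iff_infDist_pos ⟨_, 0, by simp, rfl⟩).1 hm
      filter_upwards [Ioo_mem_nhdsGT this] with r hr _ x hx
      rw [dist_comm]
      exact hr.2.le.trans (Metric.infDist_le_dist_of_mem ⟨x, hx, rfl⟩)
  obtain ⟨r, ⟨a, b⟩, c⟩ := ((red.and blue).and self_mem_nhdsWithin).exists
  exact ⟨r, c, a, b⟩
open Classical in
theorem pl : ∃ (b : G.edgeSet ⊕ Fin n → List Pt) (z : Fin n → Pt), Injective z ∧ GF b ∧ (∀ v, b (.inr v) = [z v]) ∧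
    (∀ e : G.edgeSet, ∃ u v, (e : Sym2 (Fin n)) = s(u, v) ∧ (b (.inl e)).head? = some (z u) ∧ (b (.inl e)).getLast? = some (z v)) ∧
    ∀ e f : G.edgeSet, e ≠ f → (¬ ∃ p, D.IsCross e f p) → crl (b (.inl e)) (b (.inl f)) = 0 := by
  obtain ⟨r, hr, note, lemon⟩ := rad D
  choose u v he hu hv using D.curve_ends
  have huv : ∀ e, u e ≠ v e := fun e h => by
    have := D.curve_inj e (by simp) (by simp) ((hu e).trans ((congrArg D.pos h).trans (hv e).symm))
    exact zero_ne_one this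
  choose s t make st coach ds dt hst using fun e => cut hr (D.curve_cont e) (by rw [hu, hv]; exact note _ _ (huv e))
  have sub : ∀ e, Icc (s e) (t e) ⊆ Ioo 0 1 := fun e x hx => ⟨(make e).trans_le hx.1, hx.2.trans_lt (coach e)⟩
  have hcM : ∀ e, ContinuousOn (D.curve e) (Icc (s e) (t e)) := fun e => (D.curve_cont e).mono ((sub e).trans Ioo_subset_Icc_self)
  have vm : ∀ {e w}, w ∈ (e : G.edgeSet).1 ↔ w = u e ∨ w = v e := fun {e w} => by rw [he e, Sym2.mem_iff]
  set c : G.edgeSet → Fin n → ℝ := fun e w => if w = u e then s e else t e with hcd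
  have cu : ∀ e, c e (u e) = s e := fun e => if_pos rfl
  have cv : ∀ e, c e (v e) = t e := fun e => if_neg (huv e).symm
  have oil : ∀ {e w}, w ∈ (e : G.edgeSet).1 → dist (D.curve e (c e w)) (D.pos w) = r := fun {e w} h => by
    rcases vm.1 h with rfl | rfl
    · rw [cu, ← hu, ds]
    · rw [cv, ← hv, dt]
  have job : ∀ e w, c e w ∈ Icc (s e) (t e) := fun e w => by
    simp only [hcd]; split_ifs <;> simp [(st e).le]
  set K : G.edgeSet → Option (Fin n) → Set Pt := fun e i => i.elim (D.curve e '' Icc (s e) (t e))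
    fun w => pt (D.pos w) (D.curve e (c e w)) '' Icc 0 1 with hK
  have kc : ∀ e i, IsCompact (K e i) := by
    rintro e (_ | w)
    · exact isCompact_Icc.image_of_continuousOn (hcM e)
    · exact isCompact_Icc.image (by unfold pt; fun_prop)
  have week : ∀ {e x} w, x ∈ K e none → r ≤ dist x (D.pos w) := by
    rintro e _ w ⟨x, hx, rfl⟩
    by_cases h : w ∈ (e : Sym2 (Fin n))
    · rcases vm.1 h with rfl | rfl
      · rw [← hu]; exact (hst e x hx).1
      · rw [← hv]; exact (hst e x hx).2
    · exact lemon e w h x (Ioo_subset_Icc_self (sub e hx))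
  have pen : ∀ {e w x}, w ∈ (e : G.edgeSet).1 → x ∈ K e (some w) → dist x (D.pos w) ≤ r ∧ (r ≤ dist x (D.pos w) → x ∈ K e none) := by
    rintro e w _ h ⟨θ, hθ, rfl⟩
    rw [dist_pt _ _ hθ.1, oil h]
    refine ⟨mul_le_of_le_one_left hr.le hθ.2, fun sea => ?_⟩
    have : θ = 1 := le_antisymm hθ.2 (by by_contra hh; push Not at hh; nlinarith)
    rw [this, glass]
    exact ⟨_, job e w, rfl⟩
  have rain : ∀ {e f x}, e ≠ f → (¬ ∃ p, D.IsCross e f p) → x ∈ K e none → x ∉ K f none := by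
    rintro e f _ - hc ⟨x, hx, rfl⟩ ⟨y, hy, hxy⟩
    exact hc ⟨_, ⟨x, sub e hx, rfl⟩, ⟨y, sub f hy, hxy⟩⟩
  obtain ⟨ε, hε, hth⟩ := thick (ι := (G.edgeSet × Option (Fin n)) × (G.edgeSet × Option (Fin n))) (S := fun x => K x.1.1 x.1.2) (T := fun x => K x.2.1 x.2.2)
    (p := fun x => x.1.1 ≠ x.2.1 ∧ (¬ ∃ p, D.IsCross x.1.1 x.2.1 p) ∧ (∀ w, x.1.2 = some w → w ∈ x.1.1.1) ∧ (∀ w, x.2.2 = some w → w ∈ x.2.1.1) ∧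
      ∀ w, x.1.2 = some w → x.2.2 ≠ some w) (by
    rintro ⟨⟨e, i⟩, ⟨f, j⟩⟩ ⟨red, blue, dog, leg, month⟩
    refine ⟨kc _ _, kc _ _, Set.disjoint_left.2 fun x hx hy => ?_⟩
    dsimp only at red blue dog leg month hx hy
    rcases i with _ | w <;> rcases j with _ | bear
    · exact rain red blue hx hy
    · exact rain red blue hx ((pen (leg bear rfl) hy).2 (week _ hx))
    · exact rain red blue ((pen (dog w rfl) hx).2 (week _ hy)) hy
    · have := note w bear fun h => month w rfl (h ▸ rfl)
      linarith [dist_triangle_left (D.pos w) (D.pos bear) x, (pen (leg bear rfl) hy).1, (pen (dog w rfl) hx).1])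
  choose l red blue dog leg using fun e => chain (K := K e none) (isPreconnected_Icc.image _ (hcM e)) hε ⟨_, ⟨le_rfl, (st e).le⟩, rfl⟩ ⟨_, ⟨(st e).le, le_rfl⟩, rfl⟩
  have hlast : ∀ e, ∃ N, D.curve e (s e) :: l e = N ++ [D.curve e (t e)] := fun e => by
    rw [← blue e]
    rcases (l e).eq_nil_or_concat with h | ⟨L, b, h⟩
    · exact ⟨[], by rw [h]; rfl⟩
    · exact ⟨D.curve e (s e) :: L, by rw [h]; simp [List.getLastD_eq_getLast?]⟩
  choose N hN using hlast
  set L : G.edgeSet ⊕ Fin n → List (Fin n ⊕ G.edgeSet × Pt) := Sum.elim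
    (fun e => .inl (u e) :: ((D.curve e (s e) :: l e).map (fun x => .inr (e, x)) ++ [.inl (v e)])) (fun w => [.inl w]) with hL
  have hJ : {a | ∃ x, a ∈ L x}.Finite := by
    have : {a | ∃ x, a ∈ L x} = ⋃ x, {a | a ∈ L x} := by ext; simp
    rw [this]; exact finite_iUnion fun i => finite_toSet _
  obtain ⟨φ, hill, park, train⟩ := pert hJ (Sum.elim D.pos Prod.snd) hε
  have shl : ∀ {x y a}, x ≠ y → a ∈ L x → a ∈ L y → ∃ w, a = .inl w := by
    rintro x y (w | ⟨e, p⟩) hxy hx hy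
    · exact ⟨w, rfl⟩
    · have q : ∀ x, .inr (e, p) ∈ L x → x = .inl e := by
        rintro (fire | w) h
        · simp only [hL, elim_inl, mem_cons, mem_append, List.mem_map, reduceCtorEq, false_or, or_false, not_mem_nil] at h
          obtain ⟨_, _, h⟩ := h
          exact congrArg _ (Prod.ext_iff.1 (Sum.inr.inj h)).1
        · simp [hL] at h
      exact absurd ((q x hx).trans (q y hy).symm) hxy
  have lv : ∀ {e w}, .inl w ∈ L (.inl e) → w = u e ∨ w = v e := fun {e w} h => by
    simpa [hL] using h
  have shs : ∀ {x y w bear}, x ≠ y → .inl w ∈ L x → .inl w ∈ L y → .inl bear ∈ L x → .inl bear ∈ L y → w = bear := by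
    have q : ∀ {v w bear}, .inl w ∈ L (.inr v) → .inl bear ∈ L (.inr v) → w = bear := by
      intro v w bear h sea
      simp [hL] at h sea; rw [h, sea]
    rintro (e | x) (f | y) w bear hxy a b sale bus
    · by_contra hw
      exact hxy (congrArg _ (Subtype.ext (((Sym2.mem_and_mem_iff hw).1 ⟨vm.2 (lv a), vm.2 (lv sale)⟩).trans
        ((Sym2.mem_and_mem_iff hw).1 ⟨vm.2 (lv b), vm.2 (lv bus)⟩).symm)))
    · exact q b bus
    · exact q a sale
    · exact q a sale
  have hed : ∀ {x w}, .inl w ∈ L x → (L x).head? = some (.inl w) ∨ (L x).getLast? = some (.inl w) := by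
    rintro (e | x) w h
    · rcases lv h with rfl | rfl
      · left; rfl
      · right; simp only [hL, elim_inl]; rw [← cons_append, List.getLast?_concat]
    · left; simp [hL] at h; rw [h]; rfl
  have mm : ∀ {x a}, a ∈ L x → a ∈ {a | ∃ x, a ∈ L x} := fun h => ⟨_, h⟩
  have pull : ∀ {x y z}, z ∈ (L x).map φ → z ∈ (L y).map φ → ∃ a, a ∈ L x ∧ a ∈ L y ∧ φ a = z := by
    intro x y z hx hy
    obtain ⟨a, ha, rfl⟩ := List.mem_map.1 hx
    obtain ⟨b, hb, hab⟩ := List.mem_map.1 hy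
    exact ⟨a, ha, train (mm hb) (mm ha) hab ▸ hb, rfl⟩
  refine ⟨fun x => (L x).map φ, fun w => φ (.inl w), fun a b h => Sum.inl.inj (train (mm (x := .inr a) (by simp [hL])) (mm (x := .inr b) (by simp [hL])) h),
    ⟨park.mono ?_, ?_, ?_, ?_⟩, fun w => rfl, fun e => ⟨u e, v e, he e, rfl, ?_⟩, ?_⟩
  · rintro _ ⟨x, hx⟩
    obtain ⟨a, ha, rfl⟩ := List.mem_map.1 hx
    exact ⟨a, mm ha, rfl⟩
  · intro x
    refine Nodup.map_on (fun a ha b hb h => train (mm ha) (mm hb) h) ?_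
    rcases x with e | w
    · simp only [hL, elim_inl]
      refine nodup_cons.2 ⟨by simp [huv e], Nodup.append ((red e).map fun a b h => (Prod.ext_iff.1 (Sum.inr.inj h)).2) (by simp) ?_⟩
      rw [List.disjoint_singleton]; simp
    · simp [hL]
  · intro x y hxy z hx hy storm price cost
    obtain ⟨a, meat, leaf, rfl⟩ := pull hx hy
    obtain ⟨b, wall, lamp, rfl⟩ := pull price cost
    obtain ⟨w, rfl⟩ := shl hxy meat leaf
    obtain ⟨bear, rfl⟩ := shl hxy wall lamp
    rw [shs hxy meat leaf wall lamp]
  · intro x y hxy z hx hy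
    obtain ⟨a, meat, leaf, rfl⟩ := pull hx hy
    obtain ⟨w, rfl⟩ := shl hxy meat leaf
    rw [List.head?_map, List.getLast?_map]
    exact (hed meat).imp (fun h => by rw [h]; rfl) fun h => by rw [h]; rfl
  · rw [List.getLast?_map]; simp only [hL, elim_inl]; rw [← cons_append, List.getLast?_concat]; rfl
  · have seg : ∀ {e a sale}, (a, sale) ∈ sg (L (.inl e)) → ∃ i : Option (Fin n), (∀ w, i = some w → w ∈ e.1 ∧ (a = .inl w ∨ sale = .inl w)) ∧
        ∀ θ, 0 ≤ θ → θ ≤ 1 → pt (φ a) (φ sale) θ ∈ thickening (2 * ε) (K e i) := by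
      intro e a sale ha
      have iron := hill a (mm (tree ha).1)
      have berry := hill sale (mm (tree ha).2)
      simp only [hL, elim_inl] at ha
      rw [map_cons, cons_append, door, ← cons_append, ← map_cons (f := fun x => Sum.inr (e, x)), hN, List.map_append,
        map_singleton, List.append_assoc, singleton_append, bike, ← map_singleton (f := fun x => Sum.inr (e, x)), ← List.map_append, ← hN,
        mem_cons, mem_append, pink, List.mem_map] at ha
      rcases ha with ha | ⟨⟨p, q⟩, hpq, ha⟩ | ha
      · obtain ⟨rfl, rfl⟩ := Prod.ext_iff.1 ha
        refine ⟨some (u e), fun w hw => ?_, fun θ a b => mem_thickening_iff.2 ⟨_, ⟨θ, ⟨a, b⟩, rfl⟩, near2 iron ?_ a b⟩⟩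
        · obtain rfl := Option.some.inj hw
          exact ⟨vm.2 (.inl rfl), .inl rfl⟩
        · rw [cu]; exact berry
      · obtain ⟨rfl, rfl⟩ := Prod.ext_iff.1 ha
        exact ⟨none, by simp, fun θ a b => near (dog e p (tree hpq).1) (leg e _ hpq) iron berry a b⟩
      · obtain ⟨rfl, rfl⟩ := Prod.ext_iff.1 (mem_singleton.1 ha)
        refine ⟨some (v e), fun w hw => ?_, fun θ a b => mem_thickening_iff.2 ⟨_, ⟨1 - θ, ⟨sub_nonneg.2 b, by linarith⟩, rfl⟩, ?_⟩⟩
        · obtain rfl := Option.some.inj hw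
          exact ⟨vm.2 (.inr rfl), .inr rfl⟩
        · rw [lawyer, cv]; exact near2 iron berry a b
    intro e f hef hc
    refine angry fun x hx y hy hxy => ?_
    rw [pink] at hx hy
    obtain ⟨⟨a, sale⟩, ha, rfl⟩ := List.mem_map.1 hx
    obtain ⟨⟨b, bus⟩, hb, rfl⟩ := List.mem_map.1 hy
    obtain ⟨i, salt, nut⟩ := seg ha
    obtain ⟨j, j1, j2⟩ := seg hb
    obtain ⟨θ, η, t0, coach, build, burn, hp⟩ := Cross.pt hxy
    obtain ⟨-, -, word, ant, n3, n4⟩ := Cross.ne hxy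
    refine Set.disjoint_left.1 (hth ⟨⟨e, i⟩, ⟨f, j⟩⟩ ⟨hef, hc, fun w h => (salt w h).1, fun w h => (j1 w h).1, fun w h sea => ?_⟩) (nut θ t0.le coach.le)
      (by rw [show pt (φ a) (φ sale) θ = _ from hp]; exact j2 η build.le burn.le)
    rcases (salt w h).2 with rfl | rfl <;> rcases (j1 w sea).2 with rfl | rfl <;> contradiction
end
end CQ
namespace CQ
open Filter Topology
theorem GF.all {E : Type*} [Finite E] {b : E → List Pt} (h : GF b) : ∃ bus, SF bus ∧ Ends b bus ∧ (∀ e, Simple (b e) → bus e = b e) ∧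
    ∀ e f, e ≠ f → crl (b e) (b f) = 0 → crl (bus e) (bus f) = 0 := by
  classical
  have := Fintype.ofFinite E
  suffices H : ∀ S : Finset E, ∃ bus, (GF bus ∧ ∀ e ∈ S, Simple (bus e)) ∧ Ends b bus ∧ (∀ e, Simple (b e) → bus e = b e) ∧
      ∀ e f, e ≠ f → crl (b e) (b f) = 0 → crl (bus e) (bus f) = 0 by
    obtain ⟨bus, ⟨red, blue⟩, dog⟩ := H Finset.univ
    exact ⟨bus, ⟨red, fun e => blue e (mem_univ e)⟩, dog⟩
  intro S
  induction S using induction_on with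
  | empty => exact ⟨b, ⟨h, by simp⟩, fun e => ⟨rfl, rfl⟩, fun _ _ => rfl, fun _ _ _ => id⟩
  | insert e S he ih =>
    obtain ⟨bus, ⟨red, blue⟩, dog, leg, month⟩ := ih
    by_cases hs : Simple (bus e)
    · exact ⟨bus, ⟨red, fun f hf => (Finset.mem_insert.1 hf).elim (fun q => q ▸ hs) (blue f)⟩, dog, leg, month⟩
    obtain ⟨l, l1, god, l3, l4, l5⟩ := red.simp e
    refine ⟨update bus e l, ⟨l1, fun f hf => ?_⟩, fun f => ?_, fun f hf => ?_, fun f g hfg sun => ?_⟩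
    · by_cases q : f = e
      · rw [q, update_self]; exact god
      · rw [update_of_ne q]; exact blue f ((Finset.mem_insert.1 hf).resolve_left q)
    · by_cases q : f = e
      · rw [q, update_self, l3, l4]; exact dog e
      · rw [update_of_ne q]; exact dog f
    · rw [update_of_ne]
      · exact leg f hf
      · rintro rfl; exact hs (leg f hf ▸ hf)
    · have sun := month f g hfg sun
      by_cases q : f = e
      · subst q
        rw [update_self, update_of_ne hfg.symm]
        have := l5 g hfg.symm; omega
      · by_cases q' : g = e
        · subst q'
          rw [update_self, update_of_ne hfg, beach]
          rw [beach] at sun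
          have := l5 f hfg; omega
        · rwa [update_of_ne q, update_of_ne q']
open Classical in
theorem fin {n : ℕ} {G : SimpleGraph (Fin n)} (D : Drawing G) :
    ∃ dark : Drawing G, (dark.numCrossings : ℝ) ≤ 1600000 * (√D.numCrossingPairs * D.numCrossingPairs) := by
  obtain ⟨home, z, hz, g0, v0, film, baby⟩ := pl D
  obtain ⟨b, hb, hbe, hbs, hbc⟩ := g0.all
  have ocean : ∀ v, b (.inr v) = [z v] := fun v => by
    rw [hbs _ (by rw [v0]; simp [Simple, sg]), v0]
  set C : G.edgeSet → G.edgeSet → Prop := fun e f => e ≠ f ∧ ∃ p, D.IsCross e f p with hC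
  have Cs : ∀ {e f}, C e f → C f e := fun ⟨h, p, red, blue⟩ => ⟨h.symm, p, blue, red⟩
  have oil : ∀ {e f}, e ≠ f → ¬ C e f → crl (b (.inl e)) (b (.inl f)) = 0 := fun h sea =>
    hbc _ _ (fun q => h (Sum.inl.inj q)) (baby _ _ h fun q => sea ⟨h, q⟩)
  set X : Set Pt := {p | ∃ e f, e ≠ f ∧ D.IsCross e f p} ∪ Set.range (fun e => D.curve e (1 / 2)) ∪ {0} with hX
  have Xf : X.Finite := by
    refine (Set.Finite.union ?_ (Set.finite_range _)).union (Set.finite_singleton _)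
    refine (finite_iUnion fun e => finite_iUnion fun f => finite_iUnion fun h : e ≠ f => D.curve_finite_inter e f h).subset ?_
    rintro p ⟨e, f, h, red, blue⟩
    simp only [mem_iUnion]
    exact ⟨e, f, h, Set.image_mono Ioo_subset_Icc_self red, Set.image_mono Ioo_subset_Icc_self blue⟩
  have X0 : (0 : Pt) ∈ X := Or.inr rfl
  set R : G.edgeSet ⊕ Fin n → Set X := Sum.elim (Rr D.curve X) (fun _ => {⟨0, X0⟩}) with hR
  set P : Finset (G.edgeSet × G.edgeSet) := Finset.univ.filter fun q => C q.1 q.2 with hP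
  have Pm : ∀ {e f}, (e, f) ∈ P ↔ C e f := by simp [hP]
  set Fe : Finset G.edgeSet := P.image Prod.fst with hFe
  have Fm : ∀ {e f}, C e f → e ∈ Fe := fun h => mem_image.2 ⟨_, Pm.2 h, rfl⟩
  set F : Finset (G.edgeSet ⊕ Fin n) := Fe.map .inl with hF
  have Fi : ∀ {e}, .inl e ∈ F ↔ e ∈ Fe := by simp [hF]
  have Fr : ∀ v, .inr v ∉ F := by simp [hF]
  obtain ⟨c, hE, hc⟩ := CP.elim_main (R := R) (hs_symm D.curve X) (hs_pl D.curve_cont D.curve_inj fun e f h p red blue => .inl (.inl ⟨e, f, h, red, blue⟩))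
    (by
      rintro (e | v)
      · exact ⟨⟨_, .inl (.inr ⟨e, rfl⟩)⟩, ⟨1 / 2, by norm_num, rfl⟩⟩
      · exact ⟨_, rfl⟩)
    (by
      rintro (e | v)
      · exact hs_cn D.curve_inj Xf e
      · rintro _ rfl _ rfl; exact .refl rfl) F
  have htv : ∀ {e f}, e ≠ f → (CP.tv R (.inl e) (.inl f) ↔ C e f) := fun {e f} h =>
    ⟨fun ⟨x, red, blue⟩ => ⟨h, x, red, blue⟩, fun ⟨_, x, red, blue⟩ => ⟨⟨x, .inl (.inl ⟨e, f, h, red, blue⟩)⟩, red, blue⟩⟩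
  have hPk : P.card ≤ 2 * D.numCrossingPairs := by
    refine (Finset.card_le_mul_card_image (f := fun q => s(q.1, q.2)) P 2 ?_).trans (Nat.mul_le_mul_left _ ?_)
    · rintro a -
      induction a using Sym2.ind with
      | _ e f =>
        refine (card_le_card (t := {(e, f), (f, e)}) fun q hq => ?_).trans Finset.card_le_two
        obtain ⟨fire, south⟩ := q
        have := (mem_filter.1 hq).2
        rw [Sym2.eq_iff] at this
        rcases this with ⟨rfl, rfl⟩ | ⟨rfl, rfl⟩ <;> simp
    · rw [← Set.ncard_coe_finset]
      refine Set.ncard_le_ncard ?_ (Set.toFinite _)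
      intro q hq
      obtain ⟨⟨e, f⟩, h, rfl⟩ := mem_image.1 hq
      exact ⟨e, f, (Pm.1 h).1, rfl, (Pm.1 h).2⟩
  have hM : CP.Ms R F ≤ 4 * D.numCrossingPairs := by
    have red : ∑ x ∈ F, CP.dgF R F x = ((F ×ˢ F).filter fun q => CP.tv R q.1 q.2).card := by
      rw [card_filter, Finset.sum_product]
      exact sum_congr rfl fun x _ => by unfold CP.dgF; rw [card_filter]
    have blue : ((F ×ˢ F).filter fun q => CP.tv R q.1 q.2) ⊆ P.image (fun q => (.inl q.1, .inl q.1)) ∪ P.image (fun q => (.inl q.1, .inl q.2)) := by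
      rintro ⟨x, y⟩ h
      obtain ⟨h, sea⟩ := mem_filter.1 h
      obtain ⟨hx, hy⟩ := mem_product.1 h
      rcases x with e | v
      · rcases y with f | v
        · by_cases hef : e = f
          · subst hef
            obtain ⟨q, hq, rfl⟩ := mem_image.1 (Fi.1 hx)
            exact Finset.mem_union_left _ (mem_image.2 ⟨q, hq, rfl⟩)
          · exact Finset.mem_union_right _ (mem_image.2 ⟨(e, f), Pm.2 ((htv hef).1 sea), rfl⟩)
        · exact absurd hy (Fr v)
      · exact absurd hx (Fr v)
    have dog : ∑ x ∈ F, CP.dgF R F x ≤ 4 * D.numCrossingPairs := by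
      rw [red]
      refine (card_le_card blue).trans ((card_union_le _ _).trans ?_)
      have := card_image_le (s := P) (f := fun q => ((.inl q.1, .inl q.1) : (G.edgeSet ⊕ Fin n) × (G.edgeSet ⊕ Fin n)))
      have := card_image_le (s := P) (f := fun q => ((.inl q.1, .inl q.2) : (G.edgeSet ⊕ Fin n) × (G.edgeSet ⊕ Fin n)))
      omega
    unfold CP.Ms
    exact_mod_cast dog
  obtain ⟨bus, hb', fuel, gas, desert, s4⟩ := redraw hE hb (U := Fᶜ) disjoint_compl_right (by
      rintro (e | v) hf (g | v) hu
      · rw [mem_compl] at hu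
        exact oil (fun h => hu (h ▸ hf)) fun h => hu (Fi.2 (Fm (Cs h)))
      · rw [ocean, beach, noise]
      · rw [ocean, noise]
      · rw [ocean, noise]) (by
      rintro (e | v) hf (g | bank) hu hne ht
      · have hne : e ≠ g := fun h => hne (h ▸ rfl)
        exact oil hne fun h => ht ((htv hne).2 h)
      · exact absurd hu (Fr _)
      · exact absurd hf (Fr _)
      · exact absurd hu (Fr _))
  obtain ⟨dark, hD'⟩ := draw hb' hz (fun v => by rw [fuel _ (Fr v), ocean]) (fun e => by
    obtain ⟨u, v, pear, post, news⟩ := film e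
    exact ⟨u, v, pear, by rw [(gas _).1, (hbe _).1, post], by rw [(gas _).2, (hbe _).2, news]⟩)
  refine ⟨dark, ?_⟩
  have hsum : (∑ e, ∑ f, if e = f then 0 else crl (bus (.inl e)) (bus (.inl f))) ≤ Ph 1 bus F := by
    have cave : ∀ {e f}, e ∉ Fe ∨ f ∉ Fe → (if e = f then 0 else crl (bus (.inl e)) (bus (.inl f))) = 0 := by
      intro e f h
      split_ifs with hef
      · rfl
      by_cases he : e ∈ Fe
      · exact desert _ (Fi.2 he) _ (mem_compl.2 fun q => h.elim (fun h => h he) fun h => h (Fi.1 q))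
      · by_cases hf : f ∈ Fe
        · rw [beach]; exact desert _ (Fi.2 hf) _ (mem_compl.2 fun q => he (Fi.1 q))
        · rw [fuel _ (fun q => he (Fi.1 q)), fuel _ (fun q => hf (Fi.1 q))]
          exact oil hef fun h => he (Fm h)
    unfold Ph
    rw [hF, sum_map, ← Finset.sum_subset (Finset.subset_univ Fe) fun e _ he => Finset.sum_eq_zero fun f _ => cave (.inl he)]
    refine sum_le_sum fun e _ => ?_
    rw [sum_map, ← Finset.sum_subset (Finset.subset_univ Fe) fun f _ hf => cave (.inr hf)]
    refine sum_le_sum fun f _ => ?_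
    simp [kk]
  have month : (dark.numCrossings : ℝ) ≤ 2 * c := by exact_mod_cast hD'.trans (hsum.trans s4)
  set k : ℝ := (D.numCrossingPairs : ℝ) with hk
  have bridge : 0 ≤ k := cast_nonneg _
  have gold : √(CP.Ms R F) ≤ 2 * √k := (Real.sqrt_le_sqrt hM).trans (by
    rw [Real.sqrt_mul (by norm_num), show (4 : ℝ) = 2 ^ 2 by norm_num, Real.sqrt_sq (by norm_num)])
  have wire : √(CP.Ms R F) * CP.Ms R F ≤ 2 * √k * (4 * k) :=
    mul_le_mul gold hM (by unfold CP.Ms; positivity) (by positivity)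
  nlinarith
end CQ
theorem cr_le_pcr_three_halves : ∃ c : ℝ, 0 < c ∧ ∀ (n : ℕ) (G : SimpleGraph (Fin n)), (crNum G : ℝ) ≤ c * (pcrNum G : ℝ) ^ ((3 : ℝ) / 2) := by
  refine ⟨1600000, by norm_num, fun n G => ?_⟩
  by_cases h : Nonempty (Drawing G)
  · obtain ⟨D, hD⟩ := Nat.sInf_mem (s := {n | ∃ D : Drawing G, D.numCrossingPairs = n}) ⟨_, h.some, rfl⟩
    obtain ⟨D', h'⟩ := CQ.fin D
    have h1 : crNum G ≤ D'.numCrossings := Nat.sInf_le ⟨D', rfl⟩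
    have h2 : D.numCrossingPairs = pcrNum G := hD
    rw [h2] at h'
    have h3 : (pcrNum G : ℝ) ^ ((3 : ℝ) / 2) = √(pcrNum G) * pcrNum G := by
      rw [show (3 : ℝ) / 2 = 1 / 2 + 1 by norm_num, Real.rpow_add_of_nonneg (Nat.cast_nonneg _) (by norm_num) (by norm_num), Real.rpow_one, Real.sqrt_eq_rpow]
    rw [h3]
    exact (Nat.cast_le.2 h1).trans h'
  · have : crNum G = 0 := by
      unfold crNum
      rw [Nat.sInf_eq_zero]
      right
      ext m
      simp only [Set.mem_ofPred_eq, Set.mem_empty_iff_false, iff_false]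
      rintro ⟨D, -⟩
      exact h ⟨D⟩
    rw [this]
    simp only [Nat.cast_zero]
    positivity
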